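/- arXiv:2301.09197 — 2 statements merged into one kernel-verified Lean document; each statement's English description precedes it below -/
import Mathlib

section
/- There exist universal constants C > 0 and K > 0 such that for every real β ≥ 1, every real h with 0 < h < h_w(β) = log(e^{4β}/(e^{4β}−1)), every integer m ≥ K and every integer N ≥ 1, letting H = ⌊(4β)^{−1} log N⌋, one has P_N^{β,h}( {φ ∈ Ω_N : |{x ∈ Λ_N : φ(x) ≥ H + m}| > e^{−2βm} N²} ) ≤ exp( −C e^{−2βm} N · min(1, e^{−2βm} N (log N)^{−8}) ). -/
open Real Finset
open scoped Classical

noncomputable section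

/-- The box `Λ_N = {1,…,N}²` in `ℤ²`. -/
def Lam (N : ℕ) : Finset (ℤ × ℤ) := Finset.Icc (1:ℤ) (N:ℤ) ×ˢ Finset.Icc (1:ℤ) (N:ℤ)

/-- The four nearest neighbors of a site of `ℤ²`. -/
def nbrs (x : ℤ × ℤ) : Finset (ℤ × ℤ) :=
  {(x.1 + 1, x.2), (x.1 - 1, x.2), (x.1, x.2 + 1), (x.1, x.2 - 1)}

/-- An enlarged box containing all edges touching `Λ_N`. -/
def Box (N : ℕ) : Finset (ℤ × ℤ) := Finset.Icc (0:ℤ) ((N:ℤ)+1) ×ˢ Finset.Icc (0:ℤ) ((N:ℤ)+1)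

/-- The SOS Hamiltonian with zero boundary conditions, for fields vanishing outside `Λ_N`:
each edge `{x,y}` with `x ~ y` touching `Λ_N` is counted twice in the double sum (once from
each endpoint, both endpoints lying in `Box N`), whence the factor `1/2`.  Since the field
vanishes outside `Λ_N`, this equals
`Σ_{{x,y}⊂Λ_N, x~y} |φ(x)−φ(y)| + Σ_{x∈Λ_N, y∉Λ_N, x~y} |φ(x)|`. -/
def Ham (N : ℕ) (φ : ℤ × ℤ → ℤ) : ℝ :=
  (1/2) * ∑ x ∈ Box N, ∑ y ∈ nbrs x, |(φ x : ℝ) - (φ y : ℝ)|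

/-- The level set `φ⁻¹(k)` inside `Λ_N`. -/
def levelSet (N : ℕ) (φ : ℤ × ℤ → ℤ) (k : ℤ) : Finset (ℤ × ℤ) :=
  (Lam N).filter fun x => φ x = k

/-- The configuration space `Ω_N`: nonnegative integer fields vanishing outside `Λ_N`. -/
def Conf (N : ℕ) : Type :=
  {φ : ℤ × ℤ → ℤ // (∀ x, 0 ≤ φ x) ∧ ∀ x ∉ Lam N, φ x = 0}

/-- The Boltzmann weight `exp(−β H_N(φ) + h |φ⁻¹(0)|)`. -/
def weight (N : ℕ) (β h : ℝ) (φ : ℤ × ℤ → ℤ) : ℝ :=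
  Real.exp (-β * Ham N φ + h * ((levelSet N φ 0).card : ℝ))

/-- The partition function `Z_N^{β,h}`. -/
def Z (N : ℕ) (β h : ℝ) : ℝ := ∑' φ : Conf N, weight N β h φ.val

/-- The probability of an event `E ⊆ Ω_N` under `P_N^{β,h}`. -/
def prob (N : ℕ) (β h : ℝ) (E : Set (Conf N)) : ℝ :=
  (∑' φ : Conf N, if φ ∈ E then weight N β h φ.val else 0) / Z N β h

/-- The critical pinning value `h_w(β) = log(e^{4β}/(e^{4β}−1))`. -/
def hw (β : ℝ) : ℝ := Real.log (Real.exp (4*β) / (Real.exp (4*β) - 1))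

namespace SOS

/-! ### Counting self-avoiding walks: a finite-memory bound on the connective constant -/

/-- The three possible turns of a nearest-neighbour walk without backtracking. -/
inductive Turn
  | S
  | L
  | R

/-- The heading after a left turn. -/
def rotL (h : ℤ × ℤ) : ℤ × ℤ := (-h.2, h.1)

/-- The heading after a right turn. -/
def rotR (h : ℤ × ℤ) : ℤ × ℤ := (h.2, -h.1)

/-- The heading after the given turn. -/
def Turn.act : Turn → ℤ × ℤ → ℤ × ℤ
  | .S, h => h
  | .L, h => rotL h
  | .R, h => rotR h

/-- The heading before the given turn. -/
def Turn.unact : Turn → ℤ × ℤ → ℤ × ℤ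
  | .S, h => h
  | .L, h => rotR h
  | .R, h => rotL h

/-- The points visited before `v` by a walk arriving at `v` with heading `h`, whose earlier turns
are listed with the most recent one first. -/
def back (v h : ℤ × ℤ) : List Turn → List (ℤ × ℤ)
  | [] => [v - h]
  | t :: w => (v - h) :: back (v - h) (t.unact h) w

/-- The site reached from the origin, entered with heading `(0, 1)`, after a turn. -/
def Turn.target (t : Turn) : ℤ × ℤ := t.act (0, 1)

/-- The next step of the walk does not hit its past. -/
def Free (t : Turn) (w : List Turn) : Prop := t.target ∉ back (0, 0) (0, 1) w

/-- The turn sequences (most recent first) of walks whose every step but the first avoids the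
past. -/
def IsSAW : List Turn → Prop
  | [] => True
  | t :: w => IsSAW w ∧ Free t w

/-- A ternary tree of weights indexed by the recent past of a walk. -/
inductive Trie
  | nil
  | node (v : ℕ) (s l r : Trie)

namespace Trie

/-- The weight at the root. -/
def val : Trie → ℕ
  | nil => 0
  | node v _ _ _ => v

/-- The subtree reached through a turn; where the tree ends the weight stays constant. -/
def step : Trie → Turn → Trie
  | nil, _ => nil
  | node v nil _ _, .S => node v nil nil nil
  | node _ (node a b c d) _ _, .S => node a b c d
  | node v _ nil _, .L => node v nil nil nil
  | node _ _ (node a b c d) _, .L => node a b c d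
  | node v _ _ nil, .R => node v nil nil nil
  | node _ _ _ (node a b c d), .R => node a b c d

/-- The weight attached to a walk, read from its most recent turns. -/
def look : Trie → List Turn → ℕ
  | T, [] => T.val
  | T, t :: w => look (T.step t) w

/-- The empty tree. -/
def isNil : Trie → Bool
  | nil => true
  | node _ _ _ _ => false

/-- The weights decrease along branches. -/
def mono : Trie → Bool
  | nil => true
  | node v s l r => Nat.ble s.val v && Nat.ble l.val v && Nat.ble r.val v &&
      mono s && mono l && mono r

/-- The reflected tree. -/
def mirror : Trie → Trie
  | nil => nil
  | node v s l r => node v s.mirror r.mirror l.mirror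

/-- A tree without children. -/
def leaf (v : ℕ) : Trie := node v nil nil nil

/-- A node whose right subtree is the reflected left one. -/
def sym (v : ℕ) (l s : Trie) : Trie := node v s l l.mirror

/-- The test that a site is the given one. -/
def hits (v : ℤ × ℤ) (a b : ℤ) : Bool := decide (v.1 = a) && decide (v.2 = b)

/-- The weight gate blocked. -/
def gate (b : Bool) (n : ℕ) : ℕ := bif b then 0 else n

/-- Verification that the weights form a supersolution with ratio `2714 / 1000`. The tree is
descended along a past `w`, together with the trees of weights of `S :: w`, `L :: w`, `R :: w`, the
current site and heading (backwards in time) and the record of which next steps are blocked. -/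
def check : Trie → Trie → Trie → Trie → ℤ × ℤ → ℤ × ℤ → Bool → Bool → Bool → Bool
  | nil, _, _, _, _, _, _, _, _ => true
  | node a s l r, cS, cL, cR, v, h, bS, bL, bR =>
    let u := v - h
    let dS := bS || hits u 0 1
    let dL := bL || hits u (-1) 0
    let dR := bR || hits u 1 0
    Nat.ble (1000 * (gate dS cS.val + gate dL cL.val + gate dR cR.val)) (2714 * a) &&
      check s (cS.step .S) (cL.step .S) (cR.step .S) u h dS dL dR &&
      check l (cS.step .L) (cL.step .L) (cR.step .L) u (rotR h) dS dL dR &&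
      check r (cS.step .R) (cL.step .R) (cR.step .R) u (rotL h) dS dL dR

theorem mono_step {T : Trie} (hT : T.mono = true) (t : Turn) : (T.step t).mono = true := by
  cases T with
  | nil => rfl
  | node v s l r =>
    simp only [mono, Bool.and_eq_true] at hT
    cases t
    · cases s
      · simp [step, mono, val]
      · simpa [step] using hT.1.1.2
    · cases l
      · simp [step, mono, val]
      · simpa [step] using hT.1.2
    · cases r
      · simp [step, mono, val]
      · simpa [step] using hT.2

theorem val_step_le {T : Trie} (hT : T.mono = true) (t : Turn) : (T.step t).val ≤ T.val := by
  cases T with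
  | nil => rfl
  | node v s l r =>
    simp only [mono, Bool.and_eq_true, Nat.ble_eq] at hT
    cases t
    · cases s
      · simp [step, val]
      · simpa [step, val] using hT.1.1.1.1.1
    · cases l
      · simp [step, val]
      · simpa [step, val] using hT.1.1.1.1.2
    · cases r
      · simp [step, val]
      · simpa [step, val] using hT.1.1.1.2

theorem look_le_val (w : List Turn) : ∀ {T : Trie}, T.mono = true → T.look w ≤ T.val := by
  induction w with
  | nil => intro T _; exact le_rfl
  | cons t w ih => intro T hT; exact (ih (mono_step hT t)).trans (val_step_le hT t)

theorem look_leaf (v : ℕ) (w : List Turn) : (node v nil nil nil).look w = v := by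
  induction w with
  | nil => rfl
  | cons t w ih => cases t <;> exact ih

/-- The next step is blocked, either already or by the past. -/
def blocked (b : Bool) (t : Turn) (v h : ℤ × ℤ) (w : List Turn) : Prop :=
  b = true ∨ t.target ∈ back v h w

theorem hits_iff (t : Turn) (u : ℤ × ℤ) : hits u t.target.1 t.target.2 = true ↔ t.target = u := by
  rw [hits, Bool.and_eq_true, decide_eq_true_eq, decide_eq_true_eq, Prod.ext_iff, eq_comm,
    eq_comm (a := u.2)]

theorem blocked_cons (b : Bool) (t r : Turn) (v h : ℤ × ℤ) (w : List Turn) :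
    blocked b t v h (r :: w) ↔
      blocked (b || hits (v - h) t.target.1 t.target.2) t (v - h) (r.unact h) w := by
  simp only [blocked, back, List.mem_cons, Bool.or_eq_true, hits_iff]
  tauto

theorem ite_blocked_le (b : Bool) (t : Turn) (v h : ℤ × ℤ) (w : List Turn) {T : Trie}
    (hT : T.mono = true) :
    (if blocked b t v h w then 0 else T.look w) ≤
      gate (b || hits (v - h) t.target.1 t.target.2) T.val := by
  split_ifs with hb
  · exact Nat.zero_le _
  · have : (b || hits (v - h) t.target.1 t.target.2) = false := by
      rw [← Bool.not_eq_true, Bool.or_eq_true, hits_iff]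
      intro h'
      apply hb
      refine h'.imp id fun h' => ?_
      cases w <;> simp [back, h']
    rw [this]
    exact look_le_val w hT

theorem check_sound (w : List Turn) : ∀ {T cS cL cR : Trie} {v h : ℤ × ℤ} {bS bL bR : Bool},
    T ≠ nil → check T cS cL cR v h bS bL bR = true → cS.mono = true → cL.mono = true →
    cR.mono = true →
    1000 * ((if blocked bS .S v h w then 0 else cS.look w) +
      (if blocked bL .L v h w then 0 else cL.look w) +
      (if blocked bR .R v h w then 0 else cR.look w)) ≤ 2714 * T.look w := by
  have key : ∀ (w : List Turn) {a : ℕ} {s l r cS cL cR : Trie} {v h : ℤ × ℤ} {bS bL bR : Bool},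
      check (node a s l r) cS cL cR v h bS bL bR = true → cS.mono = true → cL.mono = true →
      cR.mono = true → 1000 * ((if blocked bS .S v h w then 0 else cS.look w) +
      (if blocked bL .L v h w then 0 else cL.look w) +
      (if blocked bR .R v h w then 0 else cR.look w)) ≤ 2714 * a := by
    intro w a s l r cS cL cR v h bS bL bR hc hS hL hR
    simp only [check, Bool.and_eq_true, Nat.ble_eq] at hc
    refine le_trans ?_ hc.1.1.1
    exact Nat.mul_le_mul_left _ (Nat.add_le_add (Nat.add_le_add (ite_blocked_le bS .S v h w hS)
      (ite_blocked_le bL .L v h w hL)) (ite_blocked_le bR .R v h w hR))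
  induction w with
  | nil =>
    intro T cS cL cR v h bS bL bR hT hc hS hL hR
    cases T with
    | nil => exact absurd rfl hT
    | node a s l r => exact key [] hc hS hL hR
  | cons t w ih =>
    intro T cS cL cR v h bS bL bR hT hc hS hL hR
    cases T with
    | nil => exact absurd rfl hT
    | node a s l r =>
      have hk := key (t :: w) hc hS hL hR
      have hc' := hc
      simp only [check, Bool.and_eq_true, Nat.ble_eq] at hc'
      simp only [blocked_cons, look] at hk ⊢
      cases t
      · cases s with
        | nil => rw [show (node a nil l r).step .S = node a nil nil nil from rfl, look_leaf]; exact hk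
        | node a' s' l' r' =>
          exact ih (by simp [step]) hc'.1.1.2 (mono_step hS _) (mono_step hL _) (mono_step hR _)
      · cases l with
        | nil =>
          rw [show (node a s nil r).step .L = node a nil nil nil by cases s <;> rfl, look_leaf]
          exact hk
        | node a' s' l' r' =>
          rw [show (node a s (node a' s' l' r') r).step .L = node a' s' l' r' by cases s <;> rfl]
          exact ih (by simp) hc'.1.2 (mono_step hS _) (mono_step hL _) (mono_step hR _)
      · cases r with
        | nil =>
          rw [show (node a s l nil).step .R = node a nil nil nil by cases s <;> cases l <;> rfl,
            look_leaf]
          exact hk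
        | node a' s' l' r' =>
          rw [show (node a s l (node a' s' l' r')).step .R = node a' s' l' r' by
            cases s <;> cases l <;> rfl]
          exact ih (by simp) hc'.2 (mono_step hS _) (mono_step hL _) (mono_step hR _)

/-- All weights are positive and there is at least one. -/
def pos : Trie → Bool
  | nil => false
  | node v s l r => Nat.ble 1 v && (s.isNil || pos s) && (l.isNil || pos l) && (r.isNil || pos r)

theorem pos_step {T : Trie} (hT : T.pos = true) (t : Turn) : (T.step t).pos = true := by
  cases T with
  | nil => exact hT
  | node v s l r =>
    simp only [pos, Bool.and_eq_true] at hT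
    cases t
    · cases s
      · simp [step, pos, isNil, hT.1.1.1]
      · simpa [step, isNil] using hT.1.1.2
    · cases l
      · simp [step, pos, isNil, hT.1.1.1]
      · simpa [step, isNil] using hT.1.2
    · cases r
      · simp [step, pos, isNil, hT.1.1.1]
      · simpa [step, isNil] using hT.2

theorem one_le_look (w : List Turn) : ∀ {T : Trie}, T.pos = true → 1 ≤ T.look w := by
  induction w with
  | nil =>
    intro T hT
    cases T with
    | nil => simp [pos] at hT
    | node v s l r =>
      simp only [pos, Bool.and_eq_true, Nat.ble_eq] at hT
      exact hT.1.1.1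
  | cons t w ih => intro T hT; exact ih (pos_step hT t)

/-- Weights for walks with memory `12`. -/
def weights : Trie :=
  sym 1546 (node 1362 (node 1274 (node 1233 (node 1217 (node 1215 nil (node 1208 nil (node 1200
  (node 1178 (node 1121 (leaf 961) nil nil) nil nil) nil nil) nil) nil) (node 1182 (node 1156 nil
  (node 1116 (node 1027 (node 842 (leaf 487) nil nil) (node 1026 nil nil (leaf 913)) nil) (node
  1116 nil nil (node 1077 (leaf 938) nil nil)) nil) nil) (node 1154 (node 1094 (node 942 nil nil
  (node 841 nil (leaf 486) nil)) nil (node 1018 nil (node 842 (leaf 486) nil nil) nil)) nil (node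
  1109 nil (node 1024 (node 842 (leaf 487) nil nil) (node 1024 nil nil (leaf 910)) nil) nil)) nil)
  nil) (node 1150 (node 1077 (node 1038 nil (node 966 (node 851 (node 719 nil (leaf 544) nil)
  (node 800 (leaf 785) nil (leaf 497)) nil) (node 951 (node 951 nil nil (leaf 858)) nil (node 813
  (leaf 482) nil nil)) nil) nil) (node 988 (node 812 (node 447 (node 315 nil (leaf 2) nil) nil
  nil) nil (node 773 nil (node 641 nil (leaf 470) nil) nil)) (node 988 nil nil (node 880 nil nil
  (node 822 nil (leaf 478) nil))) (node 942 nil (node 830 (node 698 nil (leaf 526) nil) (node 782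
  nil nil (leaf 479)) nil) nil)) nil) (node 1087 (node 935 nil nil (node 815 (node 772 nil (node
  641 nil (leaf 469) nil) nil) (node 446 (node 314 nil (leaf 2) nil) nil nil) nil)) nil (node 990
  (node 940 nil (node 829 (node 697 nil (leaf 525) nil) (node 781 nil nil (leaf 478)) nil) nil)
  (node 813 (node 446 (node 315 nil (leaf 2) nil) nil nil) nil (node 773 nil (node 641 nil (leaf
  470) nil) nil)) nil)) (node 1144 nil (node 1124 nil (node 1098 (node 1014 (node 836 (leaf 485)
  nil nil) (node 1014 nil nil (leaf 902)) nil) nil nil) nil) nil)) (node 1231 nil (node 1229 nil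
  (node 1226 (node 1208 nil (node 1186 (node 1126 (leaf 964) nil nil) nil nil) nil) nil nil) nil)
  (node 1230 (node 1227 (node 1219 (node 1172 nil nil (node 1106 (leaf 748) nil nil)) nil nil) nil
  nil) nil nil))) (node 1102 (node 979 (node 908 (node 882 nil (node 823 (node 775 nil (node 713
  (leaf 528) nil nil) nil) (node 786 (node 742 nil nil (leaf 464)) nil (node 676 nil (leaf 508)
  nil)) nil) nil) (node 784 (node 606 (node 509 nil (node 337 (leaf 26) (leaf 337) nil) nil) (node
  427 nil nil (node 314 nil (leaf 2) nil)) nil) (node 743 nil nil (node 437 (node 314 nil (leaf 2)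
  nil) nil nil)) (node 768 nil (node 719 nil (node 658 (leaf 493) nil nil) nil) nil)) nil) (node
  801 (node 437 (node 301 (node 253 nil (node 129 nil (leaf 2) nil) nil) (leaf 2) nil) nil (node
  423 nil (node 374 nil (node 309 (leaf 2) nil nil) nil) nil)) nil (node 742 (node 725 nil (node
  676 nil (node 615 (leaf 450) nil nil) nil) nil) (node 581 (node 484 nil (node 313 (leaf 2) (leaf
  312) nil) nil) (node 426 nil nil (node 312 nil (leaf 2) nil)) nil) nil)) (node 973 nil (node 954
  nil (node 927 (node 817 (node 688 nil (leaf 518) nil) (node 771 nil nil (leaf 471)) nil) nil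
  nil) nil) nil)) (node 942 nil nil (node 807 (node 742 (node 724 nil (node 676 nil (node 614
  (leaf 450) nil nil) nil) nil) (node 581 (node 484 nil (node 312 (leaf 2) (leaf 312) nil) nil)
  (node 426 nil nil (node 312 nil (leaf 2) nil)) nil) nil) (node 437 (node 301 (node 252 nil (node
  128 nil (leaf 2) nil) nil) (leaf 2) nil) nil (node 422 nil (node 374 nil (node 309 (leaf 2) nil
  nil) nil) nil)) (node 804 nil (node 786 nil (node 763 (node 632 nil (leaf 462) nil) nil nil)
  nil) nil))) (node 1083 (node 1078 nil (node 1065 nil (node 1048 (node 1003 (node 831 (leaf 482)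
  nil nil) nil nil) nil nil) nil) nil) (node 1031 (node 998 nil (node 942 (node 828 (node 698 nil
  (leaf 526) nil) (node 781 nil nil (leaf 479)) nil) (node 942 nil nil (node 807 (leaf 479) nil
  nil)) nil) nil) (node 983 (node 809 (node 445 (node 314 nil (leaf 2) nil) nil nil) nil (node 770
  nil (node 639 nil (leaf 468) nil) nil)) nil (node 937 nil (node 825 (node 694 nil (leaf 523)
  nil) (node 778 nil nil (leaf 476)) nil) nil)) nil) nil)) (node 1265 (node 1262 nil (node 1259
  nil (node 1256 (node 1247 (node 1200 nil (node 1138 (leaf 969) nil nil) nil) nil nil) nil nil)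
  nil) (node 1257 (node 1248 (node 1230 nil nil (node 1207 (node 1142 (leaf 783) nil nil) nil
  nil)) nil (node 1248 nil (node 1207 nil nil (node 1142 (leaf 783) nil nil)) nil)) nil (node 1257
  nil (node 1251 (node 1207 nil nil (node 1142 (leaf 783) nil nil)) nil nil) nil))) (node 1252
  (node 1247 nil (node 1238 (node 1220 nil (node 1197 (node 1136 (leaf 969) nil nil) nil nil) nil)
  (node 1238 nil nil (node 1197 nil (node 1136 (leaf 969) nil nil) nil)) nil) nil) (node 1236
  (node 1163 (node 1110 nil (node 1024 (node 840 (leaf 483) nil nil) (node 1024 nil nil (leaf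
  910)) nil) nil) (node 1100 (node 944 nil nil (node 839 nil (leaf 483) nil)) nil (node 1018 nil
  (node 840 (leaf 483) nil nil) nil)) nil) nil (node 1231 nil (node 1213 nil (node 1190 (node 1130
  (leaf 965) nil nil) nil nil) nil) nil)) nil) (node 1260 (node 1248 (node 1183 (node 1148 nil nil
  (node 1082 (node 949 nil nil (leaf 776)) nil (node 1082 nil (leaf 776) nil))) nil (node 1115
  (node 745 (node 613 nil nil (leaf 295)) nil nil) (node 1073 nil nil (node 941 nil nil (leaf
  768))) nil)) (node 1242 nil nil (node 1225 nil nil (node 1202 (node 1138 (leaf 782) nil nil) nil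
  nil))) nil) (node 1256 nil nil (node 1247 (node 1229 nil nil (node 1206 (node 1141 (leaf 784)
  nil nil) nil nil)) nil (node 1247 nil (node 1206 nil nil (node 1141 (leaf 784) nil nil)) nil)))
  nil))) (node 972 (node 807 (node 729 (node 697 (node 690 nil (node 672 nil (node 650 (node 591
  (leaf 435) nil nil) nil nil) nil) nil) (node 622 (node 568 nil (node 484 (node 309 (leaf 2)
  (leaf 309) nil) (node 484 nil nil (leaf 379)) nil) nil) (node 560 (node 413 nil nil (node 309
  nil (leaf 2) nil)) nil (node 478 nil (node 309 (leaf 2) (leaf 309) nil) nil)) nil) nil) (node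
  565 (node 456 (node 402 nil (node 294 (node 170 nil (leaf 42) nil) (node 254 (leaf 253) nil
  (leaf 2)) nil) nil) (node 296 (leaf 2) (leaf 295) (node 254 nil (node 130 nil (leaf 2) nil)
  nil)) nil) (node 413 nil nil (node 299 (node 253 nil (node 130 nil (leaf 2) nil) nil) (leaf 2)
  nil)) (node 554 nil (node 518 nil (node 471 (node 305 (leaf 2) (leaf 304) nil) nil nil) nil)
  nil)) (node 728 nil (node 721 nil (node 712 (node 664 nil (node 603 (leaf 442) nil nil) nil) nil
  nil) nil) nil)) (node 434 (node 297 (node 241 (node 223 nil (node 176 nil (node 121 (leaf 2) nil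
  nil) nil) nil) (node 113 (node 65 nil (node 2 nil (leaf 2) nil) nil) (leaf 2) nil) nil) (leaf 2)
  (node 292 nil (node 274 nil (node 250 (node 128 nil (leaf 2) nil) nil nil) nil) nil)) nil (node
  413 (node 406 nil (node 389 nil (node 365 (node 303 (leaf 2) nil nil) nil nil) nil) nil) (node
  353 (node 318 nil (node 252 (node 129 nil (leaf 2) nil) (node 252 nil nil (leaf 2)) nil) nil)
  (node 294 (leaf 2) nil (node 252 nil (node 129 nil (leaf 2) nil) nil)) nil) nil)) (node 797
  (node 795 nil (node 789 nil (node 780 (node 757 (node 628 nil (leaf 459) nil) nil nil) nil nil)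
  nil) nil) (node 768 (node 755 nil (node 731 (node 682 nil (node 621 (leaf 454) nil nil) nil)
  (node 731 nil nil (node 621 nil (leaf 454) nil)) nil) nil) (node 736 (node 578 (node 482 nil
  (node 312 (leaf 2) (leaf 311) nil) nil) (node 424 nil nil (node 311 nil (leaf 2) nil)) nil) nil
  (node 721 nil (node 673 nil (node 611 (leaf 448) nil nil) nil) nil)) nil) nil)) nil (node 943
  (node 931 (node 929 nil (node 922 nil (node 914 (node 891 (node 830 (leaf 482) nil nil) nil nil)
  nil nil) nil) nil) (node 901 (node 881 nil (node 849 (node 781 (node 650 nil (leaf 479) nil)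
  (node 781 nil nil (leaf 479)) nil) (node 849 nil nil (node 807 (leaf 479) nil nil)) nil) nil)
  (node 874 (node 809 (node 445 (node 315 nil (leaf 2) nil) nil nil) nil (node 769 nil (node 639
  nil (leaf 468) nil) nil)) nil (node 844 nil (node 778 (node 647 nil (leaf 476) nil) (node 778
  nil nil (leaf 476)) nil) nil)) nil) nil) (node 870 (node 820 (node 801 nil (node 759 (node 711
  nil (node 649 (leaf 464) nil nil) nil) (node 742 (node 742 nil nil (leaf 464)) nil (node 632 nil
  (leaf 464) nil)) nil) nil) (node 743 (node 583 (node 486 nil (node 315 (leaf 2) (leaf 314) nil)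
  nil) (node 427 nil nil (node 314 nil (leaf 2) nil)) nil) (node 743 nil nil (node 437 (node 314
  nil (leaf 2) nil) nil nil)) (node 727 nil (node 679 nil (node 617 (leaf 453) nil nil) nil) nil))
  nil) (node 801 (node 438 (node 302 (node 253 nil (node 130 nil (leaf 2) nil) nil) (leaf 2) nil)
  nil (node 423 nil (node 375 nil (node 310 (leaf 2) nil nil) nil) nil)) nil (node 742 (node 725
  nil (node 676 nil (node 615 (leaf 451) nil nil) nil) nil) (node 582 (node 484 nil (node 313
  (leaf 2) (leaf 313) nil) nil) (node 426 nil nil (node 313 nil (leaf 2) nil)) nil) nil)) (node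
  866 nil (node 853 nil (node 836 (node 770 (node 641 nil (leaf 472) nil) (node 770 nil nil (leaf
  472)) nil) nil nil) nil) nil)) (node 942 (node 940 nil nil (node 937 (node 928 (node 880 nil nil
  (node 815 (leaf 462) nil nil)) nil nil) nil nil)) (node 940 nil (node 937 (node 919 nil (node
  896 (node 833 (leaf 482) nil nil) nil nil) nil) nil nil) nil) nil))) (node 1333 (node 1319 (node
  1315 nil (node 1313 nil (node 1310 (node 1301 (node 1279 (node 1151 nil (leaf 973) nil) nil nil)
  nil nil) nil nil) nil) (node 1310 (node 1303 nil nil (node 1295 (node 1270 (node 1207 (leaf 849)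
  nil nil) nil nil) nil nil)) nil (node 1307 (node 1307 nil (node 1270 nil nil (node 1207 (leaf
  849) nil nil)) nil) (node 1292 nil nil (node 1270 (node 1207 (leaf 849) nil nil) nil nil))
  nil))) (node 1306 (node 1299 nil (node 1287 (node 1262 (node 1214 nil (node 1151 (leaf 974) nil
  nil) nil) (node 1262 nil nil (node 1151 nil (leaf 974) nil)) nil) (node 1287 nil nil (node 1271
  (node 1151 nil (leaf 974) nil) nil nil)) nil) nil) (node 1294 (node 1263 (node 1106 (node 1011
  nil (node 830 (leaf 471) nil nil) nil) (node 942 nil nil (node 830 nil (leaf 471) nil)) nil) nil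
  (node 1249 nil (node 1201 nil (node 1138 (leaf 966) nil nil) nil) nil)) nil (node 1283 nil (node
  1258 (node 1210 nil (node 1147 (leaf 972) nil nil) nil) (node 1258 nil nil (node 1147 nil (leaf
  972) nil)) nil) nil)) nil) (node 1304 (node 1274 (node 1255 nil nil (node 1223 (node 1154 (node
  1022 nil nil (leaf 846)) nil (node 1154 nil (leaf 846) nil)) nil (node 1223 nil (node 1180 (leaf
  846) nil nil) nil))) nil (node 1248 (node 1182 (node 812 (node 680 nil nil (leaf 344)) nil nil)
  (node 1142 nil nil (node 1010 nil nil (leaf 834))) nil) (node 1217 nil nil (node 1151 (node 1019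
  nil nil (leaf 843)) nil (node 1151 nil (leaf 843) nil))) nil)) (node 1302 nil nil (node 1295 nil
  nil (node 1287 (node 1265 (node 1203 (leaf 848) nil nil) nil nil) nil nil))) (node 1304 nil
  (node 1250 (node 1217 nil nil (node 1151 (node 1019 nil nil (leaf 843)) nil (node 1151 nil (leaf
  843) nil))) nil (node 1183 (node 812 (node 680 nil nil (leaf 344)) nil nil) (node 1142 nil nil
  (node 1010 nil nil (leaf 834))) nil)) nil))) (node 1297 (node 1274 (node 1267 nil (node 1251
  (node 1234 nil (node 1211 (node 1143 (leaf 972) nil nil) nil nil) nil) (node 1245 (node 1245 nil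
  nil (node 1143 nil (leaf 972) nil)) nil (node 1205 nil (node 1143 (leaf 972) nil nil) nil)) nil)
  nil) (node 1238 (node 1163 (node 1110 nil (node 1024 (node 837 (leaf 479) nil nil) (node 1023
  nil nil (leaf 908)) nil) nil) (node 1100 (node 943 nil nil (node 837 nil (leaf 478) nil)) nil
  (node 1017 nil (node 837 (leaf 478) nil nil) nil)) nil) (node 1238 nil nil (node 1107 (node 1017
  nil (node 837 (leaf 478) nil nil) nil) (node 946 nil nil (node 837 nil (leaf 478) nil)) nil))
  (node 1232 nil (node 1214 nil (node 1191 (node 1131 (leaf 964) nil nil) nil nil) nil) nil)) nil)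
  (node 1263 (node 1098 (node 983 (node 930 nil (node 818 (node 686 nil (leaf 515) nil) (node 770
  nil nil (leaf 468)) nil) nil) (node 803 (node 436 (node 304 nil (leaf 2) nil) nil nil) nil (node
  762 nil (node 630 nil (leaf 459) nil) nil)) nil) (node 937 nil nil (node 806 (node 761 nil (node
  629 nil (leaf 459) nil) nil) (node 435 (node 303 nil (leaf 2) nil) nil nil) nil)) (node 1087 nil
  (node 1051 nil (node 1004 (node 827 (leaf 474) nil nil) nil nil) nil) nil)) nil (node 1235 (node
  1228 nil (node 1210 nil (node 1188 (node 1127 (leaf 961) nil nil) nil nil) nil) nil) (node 1160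
  (node 1107 nil (node 1021 (node 835 (leaf 478) nil nil) (node 1020 nil nil (leaf 905)) nil) nil)
  (node 1097 (node 940 nil nil (node 834 nil (leaf 477) nil)) nil (node 1014 nil (node 835 (leaf
  478) nil nil) nil)) nil) nil)) (node 1294 nil (node 1289 nil (node 1282 (node 1258 (node 1211
  nil (node 1148 (leaf 975) nil nil) nil) (node 1258 nil nil (node 1148 nil (leaf 975) nil)) nil)
  nil nil) nil) (node 1291 (node 1282 (node 1265 nil nil (node 1242 (node 1178 (leaf 819) nil nil)
  nil nil)) nil (node 1282 nil (node 1242 nil nil (node 1178 (leaf 819) nil nil)) nil)) nil nil)))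
  (node 1318 (node 1245 (node 1196 (node 1176 nil nil (node 1135 (node 1086 nil nil (node 1023
  (leaf 834) nil nil)) nil (node 1117 (node 1117 nil (leaf 834) nil) (node 1006 nil nil (leaf
  834)) nil))) nil (node 1118 (node 958 (node 860 nil nil (node 684 (leaf 348) nil nil)) nil (node
  797 nil (node 683 nil nil (leaf 348)) nil)) (node 1103 nil nil (node 1054 nil nil (node 991
  (leaf 822) nil nil))) (node 1118 nil (node 807 (node 683 nil nil (leaf 348)) nil nil) nil)))
  (node 1241 nil nil (node 1228 nil nil (node 1211 (node 1146 (node 1016 nil nil (leaf 841)) nil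
  (node 1146 nil (leaf 841) nil)) nil nil))) (node 1175 (node 803 (node 649 (node 601 nil nil
  (node 473 nil nil (leaf 326))) nil (node 302 (node 172 nil nil (leaf 2)) nil nil)) (node 789 nil
  nil (node 740 nil nil (node 675 (leaf 343) nil nil))) nil) (node 1116 (node 1099 nil nil (node
  1051 nil nil (node 988 (leaf 819) nil nil))) nil (node 955 (node 858 nil nil (node 681 (leaf
  347) nil nil)) nil (node 795 nil (node 681 nil nil (leaf 347)) nil))) nil)) (node 1306 (node
  1303 nil nil (node 1297 nil nil (node 1289 (node 1266 (node 1205 (leaf 851) nil nil) nil nil)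
  nil nil))) (node 1305 (node 1298 nil (node 1290 (node 1266 (node 1137 nil (leaf 960) nil) nil
  nil) nil nil) nil) nil nil) (node 1276 (node 1256 nil nil (node 1225 (node 1156 (node 1024 nil
  nil (leaf 849)) nil (node 1156 nil (leaf 849) nil)) nil (node 1224 nil (node 1182 (leaf 849) nil
  nil) nil))) nil (node 1250 (node 1184 (node 815 (node 684 nil nil (leaf 348)) nil nil) (node
  1145 nil nil (node 1013 nil nil (leaf 837))) nil) (node 1219 nil nil (node 1153 (node 1021 nil
  nil (leaf 846)) nil (node 1153 nil (leaf 846) nil))) nil))) nil))) ( sym 1468 (node 1388 (node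
  1330 (node 1299 (node 1289 nil (node 1267 (node 1250 nil (node 1227 (node 1159 (leaf 964) nil
  nil) nil nil) nil) (node 1254 (node 1238 (node 1238 nil nil (leaf 964)) nil (node 1135 nil (leaf
  964) nil)) nil (node 1213 nil (node 1151 (leaf 964) nil nil) nil)) nil) nil) (node 1243 (node
  1162 (node 1108 nil (node 1021 (node 833 (leaf 476) (leaf 823) nil) (node 1021 nil nil (leaf
  897)) nil) nil) (node 1089 (node 930 nil nil (node 823 nil (leaf 466) nil)) (node 1089 nil nil
  (node 1089 nil nil (leaf 932))) (node 1006 nil (node 824 (leaf 467) nil nil) nil)) nil) (node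
  1226 (node 1226 nil nil (node 940 (node 823 nil (leaf 466) nil) nil nil)) nil (node 1094 (node
  1004 nil (node 824 (leaf 467) nil nil) nil) (node 934 nil nil (node 823 nil (leaf 466) nil))
  nil)) (node 1237 nil (node 1219 nil (node 1197 (node 1136 (leaf 954) nil nil) nil nil) nil)
  nil)) nil) (node 1249 (node 1083 (node 967 (node 914 nil (node 802 (node 670 nil (leaf 502) nil)
  (node 755 nil nil (leaf 455)) nil) nil) (node 788 (node 423 (node 291 nil (leaf 2) nil) nil nil)
  nil (node 746 nil (node 614 nil (leaf 447) nil) nil)) nil) (node 922 nil nil (node 791 (node 746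
  nil (node 614 nil (leaf 446) nil) nil) (node 422 (node 290 nil (leaf 2) nil) nil nil) nil))
  (node 1072 nil (node 1037 nil (node 989 (node 813 (leaf 462) nil nil) nil nil) nil) nil)) (node
  1249 nil nil (node 935 (node 792 (node 746 nil (node 614 nil (leaf 446) nil) nil) (node 422
  (node 290 nil (leaf 2) nil) nil nil) nil) nil (node 927 nil (node 881 nil (node 816 (leaf 463)
  nil nil) nil) nil))) (node 1221 (node 1215 nil (node 1197 nil (node 1174 (node 1114 (leaf 948)
  nil nil) nil nil) nil) nil) (node 1146 (node 1093 nil (node 1006 (node 821 (leaf 465) nil nil)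
  (node 1006 nil nil (leaf 891)) nil) nil) (node 1083 (node 926 nil nil (node 820 nil (leaf 465)
  nil)) nil (node 1000 nil (node 820 (leaf 465) nil nil) nil)) nil) nil)) (node 1327 nil (node
  1320 nil (node 1310 (node 1270 (node 1222 nil (node 1159 (leaf 969) nil nil) nil) (node 1252
  (node 1252 nil nil (leaf 969)) nil (node 1142 nil (leaf 969) nil)) nil) nil nil) nil) (node 1326
  (node 1323 (node 1305 nil nil (node 1282 (node 1220 (leaf 863) nil nil) nil nil)) nil nil) nil
  nil))) (node 1317 (node 941 (node 781 (node 711 (node 694 nil (node 645 nil (node 584 (leaf 425)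
  nil nil) nil) nil) (node 551 (node 453 nil (node 288 (leaf 2) (leaf 287) nil) nil) (node 400 nil
  nil (node 287 nil (leaf 2) nil)) nil) nil) (node 412 (node 276 (node 227 nil (node 110 nil (leaf
  2) nil) nil) (leaf 2) nil) nil (node 397 nil (node 348 nil (node 284 (leaf 2) nil nil) nil)
  nil)) (node 776 nil (node 758 nil (node 734 (node 603 nil (leaf 437) nil) nil nil) nil) nil))
  nil (node 919 (node 913 nil (node 895 nil (node 872 (node 808 (leaf 459) nil nil) nil nil) nil)
  nil) (node 854 (node 818 nil (node 751 (node 620 nil (leaf 453) nil) (node 751 nil nil (leaf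
  453)) nil) nil) (node 785 (node 421 (node 290 nil (leaf 2) nil) nil nil) nil (node 742 nil (node
  611 nil (leaf 444) nil) nil)) nil) nil)) nil (node 1250 (node 1219 (node 1213 nil (node 1195 nil
  (node 1172 (node 1112 (leaf 946) nil nil) nil nil) nil) nil) (node 1145 (node 1091 nil (node
  1005 (node 819 (leaf 465) nil nil) (node 1005 nil nil (leaf 890)) nil) nil) (node 1081 (node 925
  nil nil (node 819 nil (leaf 464) nil)) nil (node 998 nil (node 819 (leaf 465) nil nil) nil))
  nil) nil) (node 1083 (node 967 (node 913 nil (node 801 (node 669 nil (leaf 501) nil) (node 754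
  nil nil (leaf 455)) nil) nil) (node 787 (node 422 (node 291 nil (leaf 2) nil) nil nil) nil (node
  745 nil (node 614 nil (leaf 446) nil) nil)) nil) (node 922 nil nil (node 790 (node 745 nil (node
  613 nil (leaf 446) nil) nil) (node 422 (node 290 nil (leaf 2) nil) nil nil) nil)) (node 1072 nil
  (node 1036 nil (node 989 (node 812 (leaf 461) nil nil) nil nil) nil) nil)) (node 1249 nil (node
  1243 nil (node 1234 (node 1186 nil (node 1123 (leaf 953) nil nil) nil) nil nil) nil) nil)))
  (node 1375 (node 1371 nil (node 1366 nil (node 1360 (node 1344 (node 1280 (node 1151 nil (leaf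
  974) nil) (node 1280 nil nil (leaf 974)) nil) nil nil) nil nil) nil) (node 1368 (node 1361 nil
  nil (node 1353 (node 1330 (node 1269 (leaf 912) nil nil) nil nil) nil nil)) nil (node 1368 nil
  (node 1353 nil nil (node 1330 (node 1269 (leaf 912) nil nil) nil nil)) nil))) (node 1353 (node
  1341 nil (node 1320 (node 1278 (node 1230 nil (node 1167 (leaf 973) nil nil) nil) (node 1261
  (node 1261 nil nil (leaf 973)) nil (node 1150 nil (leaf 973) nil)) nil) (node 1320 nil nil (node
  1271 (node 1150 nil (leaf 973) nil) (node 1271 nil nil (leaf 973)) nil)) nil) nil) (node 1332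
  (node 1256 (node 1098 (node 1002 nil (node 821 (leaf 463) nil nil) nil) (node 934 nil nil (node
  821 nil (leaf 463) nil)) nil) (node 1256 nil nil (node 943 (node 821 nil (leaf 463) nil) nil
  nil)) (node 1242 nil (node 1194 nil (node 1131 (leaf 958) nil nil) nil) nil)) nil (node 1315 nil
  (node 1274 (node 1225 nil (node 1162 (leaf 970) nil nil) nil) (node 1256 (node 1256 nil nil
  (leaf 970)) nil (node 1145 nil (leaf 970) nil)) nil) nil)) nil) (node 1369 (node 1339 (node 1320
  nil nil (node 1288 (node 1220 (node 1089 nil nil (leaf 911)) nil (node 1220 nil (leaf 911) nil))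
  nil (node 1288 nil (node 1246 (leaf 911) nil nil) nil))) nil (node 1313 (node 1247 (node 878
  (node 747 nil nil (leaf 400)) nil nil) (node 1209 nil nil (node 1077 nil nil (leaf 900))) nil)
  (node 1283 nil nil (node 1217 (node 1086 nil nil (leaf 908)) nil (node 1217 nil (leaf 908)
  nil))) nil)) (node 1367 nil nil (node 1360 nil nil (node 1352 (node 1329 (node 1269 (leaf 913)
  nil nil) nil nil) nil nil))) nil))) ( sym 1433 (node 1397 (node 1367 (node 1352 nil (node 1326
  (node 1283 (node 1235 nil (node 1170 (leaf 970) nil nil) nil) (node 1264 (node 1259 nil nil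
  (leaf 970)) nil (node 1153 nil (leaf 970) nil)) nil) (node 1320 (node 1320 nil nil (node 1286
  (leaf 970) nil nil)) nil (node 1269 (node 1147 nil (leaf 970) nil) (node 1269 nil nil (leaf
  970)) nil)) nil) nil) (node 1329 (node 1251 (node 1092 (node 995 nil (node 814 (leaf 456) nil
  nil) nil) (node 927 nil nil (node 813 nil (leaf 455) nil)) nil) (node 1251 nil nil (node 937
  (node 813 nil (leaf 455) nil) nil nil)) (node 1237 nil (node 1189 nil (node 1125 (leaf 952) nil
  nil) nil) nil)) (node 1328 nil nil (node 1283 (node 940 (node 813 nil (leaf 455) nil) nil nil)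
  nil (node 1262 nil (node 1135 nil (leaf 959) nil) nil))) (node 1312 nil (node 1270 (node 1222
  nil (node 1158 (leaf 965) nil nil) nil) (node 1253 (node 1253 nil nil (leaf 965)) nil (node 1141
  nil (leaf 965) nil)) nil) nil)) nil) (node 1369 (node 1303 (node 932 (node 779 (node 731 nil
  (node 599 nil (leaf 433) nil) nil) (node 409 (node 277 nil (leaf 2) nil) nil nil) nil) nil (node
  918 nil (node 870 nil (node 804 (leaf 451) nil nil) nil) nil)) nil (node 1248 (node 1233 nil
  (node 1184 nil (node 1121 (leaf 948) nil nil) nil) nil) (node 1088 (node 992 nil (node 810 (leaf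
  454) nil nil) nil) (node 924 nil nil (node 810 nil (leaf 454) nil)) nil) nil)) nil (node 1327
  (node 1309 nil (node 1268 (node 1219 nil (node 1156 (leaf 963) nil nil) nil) (node 1250 (node
  1250 nil nil (leaf 963)) nil (node 1139 nil (leaf 963) nil)) nil) nil) (node 1251 (node 1091
  (node 994 nil (node 813 (leaf 455) nil nil) nil) (node 926 nil nil (node 812 nil (leaf 455)
  nil)) nil) (node 1251 nil nil (node 936 (node 812 nil (leaf 455) nil) nil nil)) (node 1236 nil
  (node 1187 nil (node 1124 (leaf 951) nil nil) nil) nil)) nil)) (node 1394 nil (node 1386 nil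
  (node 1377 (node 1346 (node 1280 (node 1151 nil (leaf 973) nil) (node 1280 nil nil (leaf 973))
  nil) (node 1346 nil nil (node 1305 (leaf 973) nil nil)) nil) nil nil) nil) (node 1393 (node 1386
  nil nil (node 1378 (node 1356 (node 1296 (leaf 941) nil nil) nil nil) nil nil)) nil nil))) ( sym
  1421 (node 1407 (node 1397 nil (node 1383 (node 1350 (node 1282 (node 1151 nil (leaf 972) nil)
  (node 1282 nil nil (leaf 972)) nil) (node 1350 nil nil (node 1308 (leaf 972) nil nil)) nil)
  (node 1383 nil nil (node 1369 (node 1317 (leaf 972) nil nil) nil nil)) nil) nil) (node 1396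
  (node 1371 (node 1307 (node 938 (node 808 nil (leaf 450) nil) nil nil) nil (node 1270 nil (node
  1139 nil (leaf 960) nil) nil)) nil (node 1343 nil (node 1278 (node 1147 nil (leaf 968) nil)
  (node 1278 nil nil (leaf 968)) nil) nil)) nil (node 1379 nil (node 1348 (node 1281 (node 1150
  nil (leaf 971) nil) (node 1281 nil nil (leaf 971)) nil) (node 1348 nil nil (node 1306 (leaf 971)
  nil nil)) nil) nil)) nil) ( sym 1419 (node 1417 nil (node 1414 (node 1406 (node 1385 (node 1326
  (leaf 972) nil nil) nil nil) nil nil) nil nil) nil) (nil)))))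

theorem weights_mono : weights.mono = true := by decide +kernel

theorem weights_pos : weights.pos = true := by decide +kernel

theorem weights_check : check weights (weights.step .S) (weights.step .L) (weights.step .R)
    (0, 0) (0, 1) false false false = true := by decide +kernel

theorem weights_supersolution (w : List Turn) :
    1000 * ((if Free .S w then weights.look (.S :: w) else 0) +
      (if Free .L w then weights.look (.L :: w) else 0) +
      (if Free .R w then weights.look (.R :: w) else 0)) ≤ 2714 * weights.look w := by
  have h := check_sound w (by simp [weights, sym]) weights_check (mono_step weights_mono _)
    (mono_step weights_mono _) (mono_step weights_mono _)
  simp only [blocked, Bool.false_eq_true, false_or] at h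
  have e (t : Turn) (n : ℕ) : (if Free t w then n else 0) =
      if t.target ∈ back (0, 0) (0, 1) w then 0 else n := by
    by_cases ht : t.target ∈ back (0, 0) (0, 1) w <;> simp [Free, ht]
  rw [e, e, e]
  exact h

end Trie

/-- The turn sequences of self-avoiding walks with a given number of turns. -/
def saws : ℕ → Finset (List Turn)
  | 0 => {[]}
  | n + 1 => (saws n).biUnion fun w =>
      (({.S, .L, .R} : Finset Turn).filter fun t => Free t w).image fun t => t :: w

theorem mem_saws (w : List Turn) : w ∈ saws w.length ↔ IsSAW w := by
  induction w with
  | nil => simp [saws, IsSAW]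
  | cons t w ih =>
    simp only [List.length_cons, saws, mem_biUnion, mem_image, mem_filter, List.cons.injEq, IsSAW,
      ← ih]
    constructor
    · rintro ⟨w', hw', t', ⟨_, hf⟩, rfl, rfl⟩
      exact ⟨hw', hf⟩
    · rintro ⟨hw, hf⟩
      exact ⟨w, hw, t, ⟨by cases t <;> simp, hf⟩, rfl, rfl⟩

theorem sum_saws_le (n : ℕ) :
    1000 ^ n * ∑ w ∈ saws n, Trie.weights.look w ≤ 2714 ^ n * Trie.weights.val := by
  induction n with
  | zero => simp [saws, Trie.look]
  | succ n ih =>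
    have h1 : ∑ w ∈ saws (n + 1), Trie.weights.look w ≤
        ∑ w ∈ saws n, ((if Free .S w then Trie.weights.look (.S :: w) else 0) +
      (if Free .L w then Trie.weights.look (.L :: w) else 0) +
      (if Free .R w then Trie.weights.look (.R :: w) else 0)) := by
      rw [saws]
      rw [sum_biUnion]
      swap
      · intro a _ b _ hab
        refine disjoint_left.2 fun u hu hu' => hab ?_
        obtain ⟨_, _, rfl⟩ := mem_image.1 hu
        obtain ⟨_, _, h⟩ := mem_image.1 hu'
        exact (List.cons.inj h).2.symm
      refine sum_le_sum fun w _ => ?_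
      rw [sum_image (by intro a _ b _ h; exact (List.cons.inj h).1), sum_filter]
      rw [sum_insert (by simp), sum_insert (by simp), sum_singleton, add_assoc]
    calc 1000 ^ (n + 1) * ∑ w ∈ saws (n + 1), Trie.weights.look w
        ≤ 1000 ^ n * ∑ w ∈ saws n, 1000 * ((if Free .S w then Trie.weights.look (.S :: w) else 0) +
      (if Free .L w then Trie.weights.look (.L :: w) else 0) +
      (if Free .R w then Trie.weights.look (.R :: w) else 0)) := by
          rw [← mul_sum, pow_succ, mul_assoc]
          gcongr
      _ ≤ 1000 ^ n * ∑ w ∈ saws n, 2714 * Trie.weights.look w := by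
          exact Nat.mul_le_mul_left _ (sum_le_sum fun w _ => Trie.weights_supersolution w)
      _ = 2714 * (1000 ^ n * ∑ w ∈ saws n, Trie.weights.look w) := by
          rw [← mul_sum]; ring
      _ ≤ 2714 * (2714 ^ n * Trie.weights.val) := by gcongr
      _ = 2714 ^ (n + 1) * Trie.weights.val := by ring

theorem card_saws_le (n : ℕ) : ((saws n).card : ℝ) ≤ 1546 * 2.714 ^ n := by
  have h1 : (saws n).card ≤ ∑ w ∈ saws n, Trie.weights.look w := by
    rw [card_eq_sum_ones]
    exact sum_le_sum fun w _ => Trie.one_le_look w Trie.weights_pos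
  have h2 : (1000 : ℝ) ^ n * (saws n).card ≤ 2714 ^ n * 1546 := by
    exact_mod_cast (Nat.mul_le_mul_left _ h1).trans (sum_saws_le n)
  have h3 : (2.714 : ℝ) ^ n = 2714 ^ n / 1000 ^ n := by rw [← div_pow]; norm_num
  rw [h3, mul_div_assoc', le_div_iff₀ (by positivity)]
  linarith

/-! ### Finite sets of cells and their boundary edges -/

/-- The four unit vectors. -/
def dirs : Finset (ℤ × ℤ) := {(1, 0), (-1, 0), (0, 1), (0, -1)}

/-- The boundary edges of a finite set of cells: pairs of a cell and a direction leading out. -/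
def bd (γ : Finset (ℤ × ℤ)) : Finset ((ℤ × ℤ) × (ℤ × ℤ)) :=
  (γ ×ˢ dirs).filter fun e => e.1 + e.2 ∉ γ

/-- Nearest-neighbour connection inside a set. -/
def Linked (S : Set (ℤ × ℤ)) : ℤ × ℤ → ℤ × ℤ → Prop :=
  Relation.ReflTransGen fun a b => b - a ∈ dirs ∧ a ∈ S ∧ b ∈ S

/-- Connected finite sets with connected complement. -/
structure IsPoly (γ : Finset (ℤ × ℤ)) : Prop where
  conn : ∀ p ∈ γ, ∀ q ∈ γ, Linked γ p q
  coconn : ∀ p ∉ γ, ∀ q ∉ γ, Linked (γ : Set (ℤ × ℤ))ᶜ p q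

theorem mem_dirs {r : ℤ × ℤ} :
    r ∈ dirs ↔ r = (1, 0) ∨ r = (-1, 0) ∨ r = (0, 1) ∨ r = (0, -1) := by
  simp [dirs]

theorem mem_bd {γ : Finset (ℤ × ℤ)} {e : (ℤ × ℤ) × (ℤ × ℤ)} :
    e ∈ bd γ ↔ e.1 ∈ γ ∧ e.2 ∈ dirs ∧ e.1 + e.2 ∉ γ := by
  simp [bd, and_assoc]

theorem neg_mem_dirs {r : ℤ × ℤ} (h : r ∈ dirs) : -r ∈ dirs := by
  rcases mem_dirs.1 h with rfl | rfl | rfl | rfl <;> simp [dirs]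

theorem rotL_mem_dirs {r : ℤ × ℤ} (h : r ∈ dirs) : rotL r ∈ dirs := by
  rcases mem_dirs.1 h with rfl | rfl | rfl | rfl <;> simp [dirs, rotL]

theorem rotR_mem_dirs {r : ℤ × ℤ} (h : r ∈ dirs) : rotR r ∈ dirs := by
  rcases mem_dirs.1 h with rfl | rfl | rfl | rfl <;> simp [dirs, rotR]

/-- Two connected sets sharing a cell and their boundary coincide. -/
theorem subset_of_bd_eq {γ γ' : Finset (ℤ × ℤ)} (h : bd γ = bd γ') {x : ℤ × ℤ} (hx : x ∈ γ)
    (hx' : x ∈ γ') (hγ : ∀ p ∈ γ, ∀ q ∈ γ, Linked γ p q) : γ ⊆ γ' := by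
  intro p hp
  induction hγ x hx p hp with
  | refl => exact hx'
  | @tail b c _ hbc ih =>
    obtain ⟨hd, hb, hc⟩ := hbc
    by_contra hc'
    have : (b, c - b) ∈ bd γ' := mem_bd.2 ⟨ih hb, hd, by simpa using hc'⟩
    rw [← h, mem_bd] at this
    exact this.2.2 (by simpa using hc)

/-- Every line in direction `r` through a cell of a finite set leaves the set. -/
theorem exists_exit (γ : Finset (ℤ × ℤ)) {r : ℤ × ℤ} (hr : r ∈ dirs) {x : ℤ × ℤ} (hx : x ∈ γ) :
    ∃ k : ℕ, (∀ i ≤ k, x + (i : ℤ) • r ∈ γ) ∧ x + (k : ℤ) • r + r ∉ γ := by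
  have hinj : Function.Injective fun i : ℕ => x + (i : ℤ) • r := by
    intro i j hij
    rcases mem_dirs.1 hr with rfl | rfl | rfl | rfl <;> simpa using hij
  have hex : ∃ k : ℕ, x + ((k : ℤ) + 1) • r ∉ γ := by
    by_contra! hall
    have : Set.Infinite (Set.range fun i : ℕ => x + ((i + 1 : ℕ) : ℤ) • r) :=
      Set.infinite_range_of_injective fun i j hij => Nat.succ_injective (hinj hij)
    refine this (γ.finite_toSet.subset ?_)
    rintro _ ⟨i, rfl⟩
    simpa using hall i
  refine ⟨Nat.find hex, ?_, ?_⟩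
  · intro i hi
    cases i with
    | zero => simpa using hx
    | succ i =>
      have := Nat.find_min hex (m := i) hi
      simpa using this
  · have := Nat.find_spec hex
    rwa [add_smul, one_smul, ← add_assoc] at this

theorem two_mul_card_le_card_bd (γ : Finset (ℤ × ℤ)) :
    2 * (γ.image Prod.fst).card + 2 * (γ.image Prod.snd).card ≤ (bd γ).card := by
  have key : ∀ r ∈ dirs, ∀ f : ℤ × ℤ → ℤ, (∀ (p : ℤ × ℤ) (k : ℤ), f (p + k • r) = f p) →
      (γ.image f).card ≤ ((bd γ).filter fun e => e.2 = r).card := by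
    intro r hr f hf
    refine (card_le_card ?_).trans
      (card_image_le (s := (bd γ).filter fun e => e.2 = r) (f := fun e => f e.1))
    intro a ha
    obtain ⟨p, hp, rfl⟩ := mem_image.1 ha
    obtain ⟨k, h1, h2⟩ := exists_exit γ hr hp
    exact mem_image.2 ⟨(p + (k : ℤ) • r, r), mem_filter.2 ⟨mem_bd.2 ⟨h1 k le_rfl, hr, h2⟩, rfl⟩,
      hf _ _⟩
  have h1 := key (1, 0) (by simp [dirs]) Prod.snd (by simp)
  have h2 := key (-1, 0) (by simp [dirs]) Prod.snd (by simp)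
  have h3 := key (0, 1) (by simp [dirs]) Prod.fst (by simp)
  have h4 := key (0, -1) (by simp [dirs]) Prod.fst (by simp)
  have hsum : (bd γ).card = ∑ r ∈ dirs, ((bd γ).filter fun e => e.2 = r).card :=
    card_eq_sum_card_fiberwise fun e he => (mem_bd.1 he).2.1
  rw [hsum, dirs, sum_insert (by simp), sum_insert (by simp), sum_insert (by simp), sum_singleton]
  omega

theorem four_le_card_bd {γ : Finset (ℤ × ℤ)} {x : ℤ × ℤ} (hx : x ∈ γ) : 4 ≤ (bd γ).card := by
  have h1 : 0 < (γ.image Prod.fst).card := card_pos.2 ⟨x.1, mem_image_of_mem _ hx⟩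
  have h2 : 0 < (γ.image Prod.snd).card := card_pos.2 ⟨x.2, mem_image_of_mem _ hx⟩
  have := two_mul_card_le_card_bd γ
  omega

theorem six_le_card_bd {γ : Finset (ℤ × ℤ)} {x : ℤ × ℤ} (hx : x ∈ γ) (hne : γ ≠ {x}) :
    6 ≤ (bd γ).card := by
  obtain ⟨y, hy, hyx⟩ : ∃ y ∈ γ, y ≠ x := by
    by_contra! h
    exact hne (eq_singleton_iff_unique_mem.2 ⟨hx, h⟩)
  have h1 : 0 < (γ.image Prod.fst).card := card_pos.2 ⟨x.1, mem_image_of_mem _ hx⟩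
  have h2 : 0 < (γ.image Prod.snd).card := card_pos.2 ⟨x.2, mem_image_of_mem _ hx⟩
  have h3 : 1 < (γ.image Prod.fst).card ∨ 1 < (γ.image Prod.snd).card := by
    by_cases h : y.1 = x.1
    · exact Or.inr (one_lt_card.2 ⟨y.2, mem_image_of_mem _ hy, x.2, mem_image_of_mem _ hx,
        fun h' => hyx (Prod.ext h h')⟩)
    · exact Or.inl (one_lt_card.2 ⟨y.1, mem_image_of_mem _ hy, x.1, mem_image_of_mem _ hx, h⟩)
  have := two_mul_card_le_card_bd γ
  omega

theorem two_mul_card_le {γ : Finset (ℤ × ℤ)} {N : ℕ} (hγ : γ ⊆ Lam N) :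
    2 * γ.card ≤ N * (bd γ).card := by
  have h1 : γ.card ≤ (γ.image Prod.fst).card * (γ.image Prod.snd).card := by
    rw [← card_product]
    refine card_le_card fun p hp => ?_
    exact mem_product.2 ⟨mem_image_of_mem _ hp, mem_image_of_mem _ hp⟩
  have h2 : (γ.image Prod.snd).card ≤ N := by
    have : γ.image Prod.snd ⊆ Finset.Icc (1 : ℤ) N := by
      intro a ha
      obtain ⟨p, hp, rfl⟩ := mem_image.1 ha
      exact (mem_product.1 (hγ hp)).2
    simpa using card_le_card this
  have h3 := two_mul_card_le_card_bd γ
  have h4 : 2 * (γ.image Prod.fst).card ≤ (bd γ).card := by omega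
  calc 2 * γ.card ≤ (2 * (γ.image Prod.fst).card) * (γ.image Prod.snd).card := by
        rw [mul_assoc]; exact Nat.mul_le_mul_left _ h1
    _ ≤ (bd γ).card * N := Nat.mul_le_mul h4 h2
    _ = _ := mul_comm _ _

/-! ### Closed boundary walks cover the boundary -/

/-- The starting point of a boundary edge, traversed with the cell on the left, in coordinates
where the cell `p` is centred at `2 p`. -/
def etail (e : (ℤ × ℤ) × (ℤ × ℤ)) : ℤ × ℤ := e.1 + e.1 + e.2 - rotL e.2

/-- The end point of a boundary edge. -/
def ehead (e : (ℤ × ℤ) × (ℤ × ℤ)) : ℤ × ℤ := e.1 + e.1 + e.2 + rotL e.2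

/-- The signed crossing number of the ray going right from the cell `z` with an edge. -/
def cross (z : ℤ × ℤ) (e : (ℤ × ℤ) × (ℤ × ℤ)) : ℤ :=
  if z.2 = e.1.2 then
    (if e.2 = (1, 0) then (if z.1 ≤ e.1.1 then 1 else 0) else
      if e.2 = (-1, 0) then (if z.1 < e.1.1 then -1 else 0) else 0)
  else 0

/-- The indicator of the ray from the upper right corner of the cell `z`. -/
def ray (z v : ℤ × ℤ) : ℤ := if v.2 = 2 * z.2 + 1 ∧ 2 * z.1 + 1 ≤ v.1 then 1 else 0

theorem cross_sub_right (z : ℤ × ℤ) {e : (ℤ × ℤ) × (ℤ × ℤ)} (he : e.2 ∈ dirs) :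
    cross z e - cross (z + (1, 0)) e =
      (if e = (z, (1, 0)) then 1 else 0) - (if e = (z + (1, 0), (-1, 0)) then 1 else 0) := by
  obtain ⟨⟨p, q⟩, r⟩ := e
  obtain ⟨a, b⟩ := z
  rcases mem_dirs.1 he with h | h | h | h <;> simp only at h <;> subst h <;>
    simp [cross] <;> split_ifs <;> omega

theorem cross_sub_up (z : ℤ × ℤ) {e : (ℤ × ℤ) × (ℤ × ℤ)} (he : e.2 ∈ dirs) :
    cross z e - cross (z + (0, 1)) e =
      (if e = (z, (0, 1)) then 1 else 0) - (if e = (z + (0, 1), (0, -1)) then 1 else 0) +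
        (ray z (ehead e) - ray z (etail e)) := by
  obtain ⟨⟨p, q⟩, r⟩ := e
  obtain ⟨a, b⟩ := z
  rcases mem_dirs.1 he with h | h | h | h <;> simp only at h <;> subst h <;>
    simp [cross, ray, ehead, etail, rotL] <;> split_ifs <;> omega

/-- A closed walk along the boundary of a polyomino visits every boundary edge. -/
theorem IsPoly.exists_eq_of_closed {γ : Finset (ℤ × ℤ)} (hγ : IsPoly γ) {n : ℕ} (hn : 0 < n)
    {e : ℕ → (ℤ × ℤ) × (ℤ × ℤ)} (he : ∀ i, e i ∈ bd γ) (hstep : ∀ i, etail (e (i + 1)) = ehead (e i))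
    (hclosed : etail (e n) = etail (e 0)) {e' : (ℤ × ℤ) × (ℤ × ℤ)} (he' : e' ∈ bd γ) :
    ∃ i < n, e i = e' := by
  set g : ℤ × ℤ → ℤ := fun z => ∑ i ∈ range n, cross z (e i) with hg
  set cnt : (ℤ × ℤ) × (ℤ × ℤ) → ℤ := fun e' => ∑ i ∈ range n, if e i = e' then 1 else 0 with hcnt
  have hdir : ∀ i, (e i).2 ∈ dirs := fun i => (mem_bd.1 (he i)).2.1
  have hcnt0 : ∀ e', e' ∉ bd γ → cnt e' = 0 := fun e' h =>
    sum_eq_zero fun i _ => if_neg fun (h' : e i = e') => h (h' ▸ he i)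
  have hright : ∀ z, g z - g (z + (1, 0)) = cnt (z, (1, 0)) - cnt (z + (1, 0), -(1, 0)) := by
    intro z
    simp only [hg, hcnt, ← sum_sub_distrib]
    exact sum_congr rfl fun i _ => cross_sub_right z (hdir i)
  have hup : ∀ z, g z - g (z + (0, 1)) = cnt (z, (0, 1)) - cnt (z + (0, 1), -(0, 1)) := by
    intro z
    have htel : ∑ i ∈ range n, (ray z (ehead (e i)) - ray z (etail (e i))) = 0 := by
      simp only [← hstep]
      rw [sum_range_sub (fun i => ray z (etail (e i))), hclosed, sub_self]
    refine Eq.trans ?_ (add_zero (cnt (z, (0, 1)) - _))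
    refine Eq.trans ?_ (congrArg _ htel)
    simp only [hg, hcnt, ← sum_sub_distrib, ← sum_add_distrib]
    exact sum_congr rfl fun i _ => cross_sub_up z (hdir i)
  have hjump : ∀ z, ∀ r ∈ dirs, g z - g (z + r) = cnt (z, r) - cnt (z + r, -r) := by
    intro z r hr
    rcases mem_dirs.1 hr with rfl | rfl | rfl | rfl
    · exact hright z
    · have h := hright (z + (-1, 0))
      have e1 : z + (-1, 0) + (1, 0) = z := by ext <;> simp
      rw [e1] at h
      simp only [Prod.neg_mk, neg_zero, neg_neg] at h ⊢
      linarith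
    · exact hup z
    · have h := hup (z + (0, -1))
      have e1 : z + (0, -1) + (0, 1) = z := by ext <;> simp
      rw [e1] at h
      simp only [Prod.neg_mk, neg_zero, neg_neg] at h ⊢
      linarith
  have hconst : ∀ a b, b - a ∈ dirs → (a ∈ γ ↔ b ∈ γ) → g a = g b := by
    intro a b hab hiff
    have h := hjump a (b - a) hab
    have h1 : cnt (a, b - a) = 0 := hcnt0 _ fun h => by
      obtain ⟨h1, _, h2⟩ := mem_bd.1 h
      exact h2 (by simpa using hiff.1 h1)
    have h2 : cnt (a + (b - a), -(b - a)) = 0 := hcnt0 _ fun h => by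
      obtain ⟨h1, _, h2⟩ := mem_bd.1 h
      simp only [add_sub_cancel] at h1
      exact h2 (by simpa using hiff.2 h1)
    rw [h1, h2, add_sub_cancel] at h
    linarith
  have hin : ∀ p ∈ γ, ∀ q ∈ γ, g p = g q := by
    intro p hp q hq
    induction hγ.conn p hp q hq with
    | refl => rfl
    | tail _ hbc ih =>
      exact (ih hbc.2.1).trans (hconst _ _ hbc.1 (iff_of_true hbc.2.1 hbc.2.2))
  have hout : ∀ p ∉ γ, ∀ q ∉ γ, g p = g q := by
    intro p hp q hq
    induction hγ.coconn p hp q hq with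
    | refl => rfl
    | tail _ hbc ih =>
      exact (ih hbc.2.1).trans (hconst _ _ hbc.1 (iff_of_false hbc.2.1 hbc.2.2))
  obtain ⟨M, hM⟩ : ∃ M : ℤ, ∀ p ∈ γ, p.1 < M := by
    obtain ⟨M, hM⟩ := (γ.image Prod.fst).bddAbove
    exact ⟨M + 1, fun p hp => Int.lt_add_one_of_le (hM (mem_coe.2 (mem_image_of_mem _ hp)))⟩
  have hfar : g (M, 0) = 0 := by
    refine sum_eq_zero fun i _ => ?_
    have := hM _ (mem_bd.1 (he i)).1
    simp only [cross]
    split_ifs <;> omega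
  have hMout : (M, (0 : ℤ)) ∉ γ := fun h => lt_irrefl _ (hM _ h)
  have hcg : ∀ e' ∈ bd γ, cnt e' = g e'.1 := by
    intro e' he'
    obtain ⟨h1, h2, h3⟩ := mem_bd.1 he'
    have h := hjump e'.1 e'.2 h2
    rw [hout _ h3 _ hMout, hfar, hcnt0 (e'.1 + e'.2, -e'.2)
      (fun h => h3 (mem_bd.1 h).1)] at h
    simpa using h.symm
  have h0 : 0 < cnt (e 0) := by
    refine sum_pos' (fun i _ => by split_ifs <;> simp) ⟨0, by simpa using hn, by simp⟩
  have hpos : cnt e' ≠ 0 := by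
    rw [hcg _ he', hin _ (mem_bd.1 he').1 _ (mem_bd.1 (he 0)).1, ← hcg _ (he 0)]
    exact h0.ne'
  by_contra! h
  exact hpos (sum_eq_zero fun i hi => if_neg (h i (mem_range.1 hi)))

/-! ### Counting polyominoes by their perimeter -/

/-- The turn of the boundary walk at the end of an edge. -/
def turnAt (γ : Finset (ℤ × ℤ)) (e : (ℤ × ℤ) × (ℤ × ℤ)) : Turn :=
  if e.1 + e.2 + rotL e.2 ∈ γ then .R else if e.1 + rotL e.2 ∈ γ then .S else .L

/-- The edge following `e` after a turn. -/
def Turn.move : Turn → (ℤ × ℤ) × (ℤ × ℤ) → (ℤ × ℤ) × (ℤ × ℤ)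
  | .S, e => (e.1 + rotL e.2, e.2)
  | .L, e => (e.1, rotL e.2)
  | .R, e => (e.1 + e.2 + rotL e.2, rotR e.2)

/-- The boundary walk from a given edge. -/
def orbit (γ : Finset (ℤ × ℤ)) (e : (ℤ × ℤ) × (ℤ × ℤ)) : ℕ → (ℤ × ℤ) × (ℤ × ℤ)
  | 0 => e
  | k + 1 => (turnAt γ (orbit γ e k)).move (orbit γ e k)

/-- The first terms of a sequence of turns, most recent first. -/
def turnList (t : ℕ → Turn) : ℕ → List Turn
  | 0 => []
  | k + 1 => t k :: turnList t k

theorem length_turnList (t : ℕ → Turn) (k : ℕ) : (turnList t k).length = k := by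
  induction k with
  | zero => rfl
  | succ k ih => simp [turnList, ih]

theorem turnList_congr {t t' : ℕ → Turn} {k : ℕ} (h : turnList t k = turnList t' k) :
    ∀ i < k, t i = t' i := by
  induction k with
  | zero => intro i hi; exact absurd hi (Nat.not_lt_zero i)
  | succ k ih =>
    intro i hi
    rw [turnList, turnList, List.cons.injEq] at h
    rcases Nat.lt_succ_iff_lt_or_eq.1 hi with hi | rfl
    · exact ih h.2 i hi
    · exact h.1

theorem turnAt_move_mem {γ : Finset (ℤ × ℤ)} {e : (ℤ × ℤ) × (ℤ × ℤ)} (he : e ∈ bd γ) :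
    (turnAt γ e).move e ∈ bd γ := by
  obtain ⟨h1, h2, h3⟩ := mem_bd.1 he
  unfold turnAt
  split_ifs with hR hS
  · have e1 : (Turn.R.move e).1 + (Turn.R.move e).2 = e.1 + e.2 := by
      ext <;> simp [Turn.move, rotL, rotR]
    exact mem_bd.2 ⟨hR, rotR_mem_dirs h2, e1 ▸ h3⟩
  · have e1 : (Turn.S.move e).1 + (Turn.S.move e).2 = e.1 + e.2 + rotL e.2 := by
      simp only [Turn.move]
      abel
    exact mem_bd.2 ⟨hS, h2, e1 ▸ hR⟩
  · exact mem_bd.2 ⟨h1, rotL_mem_dirs h2, hS⟩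

theorem orbit_mem {γ : Finset (ℤ × ℤ)} {e : (ℤ × ℤ) × (ℤ × ℤ)} (he : e ∈ bd γ) (k : ℕ) :
    orbit γ e k ∈ bd γ := by
  induction k with
  | zero => exact he
  | succ k ih => exact turnAt_move_mem ih

theorem etail_move (t : Turn) (e : (ℤ × ℤ) × (ℤ × ℤ)) : etail (t.move e) = ehead e := by
  cases t <;> ext <;> simp [Turn.move, etail, ehead, rotL, rotR] <;> ring

theorem rotL_move (t : Turn) (e : (ℤ × ℤ) × (ℤ × ℤ)) :
    rotL (t.move e).2 = t.act (rotL e.2) := by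
  cases t <;> simp [Turn.move, Turn.act, rotL, rotR]

theorem etail_orbit_succ (γ : Finset (ℤ × ℤ)) (e : (ℤ × ℤ) × (ℤ × ℤ)) (k : ℕ) :
    etail (orbit γ e (k + 1)) = ehead (orbit γ e k) := etail_move _ _

/-- Affine change of frame sending the origin to `c` and the direction `(0, 1)` to `2 h`. -/
def frame (c h z : ℤ × ℤ) : ℤ × ℤ := c + (z.1 + z.1) • rotR h + (z.2 + z.2) • h

theorem unact_act (t : Turn) (h : ℤ × ℤ) : t.unact (t.act h) = h := by
  cases t <;> simp [Turn.act, Turn.unact, rotL, rotR]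

theorem exists_frame_eq {t : ℕ → Turn} {u h : ℕ → ℤ × ℤ} (hu : ∀ k, u (k + 1) = u k + h k + h k)
    (hh : ∀ k, h (k + 1) = (t k).act (h k)) (c H : ℤ × ℤ) (k : ℕ) : ∀ v g : ℤ × ℤ,
    frame c H v = u (k + 1) → g.1 • rotR H + g.2 • H = h k →
    ∀ z ∈ back v g (turnList t k), ∃ i ≤ k, frame c H z = u i := by
  have hsub : ∀ (k : ℕ) (v g : ℤ × ℤ), frame c H v = u (k + 1) →
      g.1 • rotR H + g.2 • H = h k → frame c H (v - g) = u k := by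
    intro k v g hv hg
    have e1 : frame c H (v - g) =
        frame c H v - (g.1 • rotR H + g.2 • H) - (g.1 • rotR H + g.2 • H) := by
      ext <;> simp [frame] <;> ring
    rw [e1, hv, hg, hu]
    abel
  induction k with
  | zero =>
    intro v g hv hg z hz
    rw [turnList, back, List.mem_singleton] at hz
    exact ⟨0, le_rfl, hz ▸ hsub 0 v g hv hg⟩
  | succ k ih =>
    intro v g hv hg z hz
    rw [turnList, back, List.mem_cons] at hz
    rcases hz with rfl | hz
    · exact ⟨k + 1, le_rfl, hsub _ v g hv hg⟩
    · obtain ⟨i, hi, h⟩ := ih (v - g) ((t k).unact g) (hsub _ v g hv hg) (by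
        rw [← unact_act (t k) (h k), ← hh, ← hg]
        cases t k <;> ext <;> simp [Turn.unact, rotL, rotR] <;> ring) z hz
      exact ⟨i, hi.trans k.le_succ, h⟩

theorem isSAW_turnList {t : ℕ → Turn} {u h : ℕ → ℤ × ℤ} {n : ℕ}
    (hu : ∀ k, u (k + 1) = u k + h k + h k) (hh : ∀ k, h (k + 1) = (t k).act (h k))
    (hinj : Set.InjOn u (Set.Iio n)) (k : ℕ) (hk : k + 1 < n) : IsSAW (turnList t k) := by
  induction k with
  | zero => trivial
  | succ k ih =>
    refine ⟨ih (by omega), fun hmem => ?_⟩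
    obtain ⟨i, hi, h'⟩ := exists_frame_eq hu hh (u (k + 1)) (h k) k (0, 0) (0, 1)
      (by ext <;> simp [frame]) (by simp) _ hmem
    have e1 : frame (u (k + 1)) (h k) (t k).target = u (k + 2) := by
      rw [hu (k + 1), hh]
      cases t k <;> ext <;> simp [frame, Turn.target, Turn.act, rotL, rotR] <;> ring
    have := hinj (Set.mem_Iio.2 hk) (Set.mem_Iio.2 (by omega : i < n)) (e1.symm.trans h')
    omega

theorem IsPoly.orbit_bd {γ : Finset (ℤ × ℤ)} (hγ : IsPoly γ) {e : (ℤ × ℤ) × (ℤ × ℤ)}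
    (he : e ∈ bd γ) :
    (∀ e' ∈ bd γ, ∃ k < (bd γ).card, orbit γ e k = e') ∧
      Set.InjOn (fun k => etail (orbit γ e k)) (Set.Iio (bd γ).card) := by
  set u : ℕ → ℤ × ℤ := fun k => etail (orbit γ e k) with hu
  have hex : ∃ j, ∃ i < j, u i = u j := by
    obtain ⟨a, b, hab, h⟩ := Finite.exists_ne_map_eq_of_infinite
      fun k => (⟨orbit γ e k, orbit_mem he k⟩ : bd γ)
    have h' : u a = u b := congrArg etail (Subtype.ext_iff.1 h)
    rcases lt_or_gt_of_ne hab with hab | hab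
    · exact ⟨b, a, hab, h'⟩
    · exact ⟨a, b, hab, h'.symm⟩
  obtain ⟨i, hij, huij⟩ := Nat.find_spec hex
  set j := Nat.find hex with hj
  have hmin : ∀ a b, a < b → b < j → u a ≠ u b := fun a b hab hb h =>
    Nat.find_min hex hb ⟨a, hab, h⟩
  have hcov : ∀ e' ∈ bd γ, ∃ k < j - i, orbit γ e (i + k) = e' := fun e' he' =>
    hγ.exists_eq_of_closed (e := fun k => orbit γ e (i + k)) (by omega)
      (fun k => orbit_mem he _) (fun k => etail_orbit_succ γ e (i + k))
      (by
        have : i + (j - i) = j := by omega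
        simpa [this] using huij.symm) he'
  have hi0 : i = 0 := by
    obtain ⟨k, hk, h⟩ := hcov e he
    by_contra hi
    exact hmin 0 (i + k) (by omega) (by omega) (congrArg etail h).symm
  subst hi0
  simp only [zero_add, Nat.sub_zero] at hcov
  have hinj : Set.InjOn u (Set.Iio j) := by
    intro a ha b hb hab
    rcases lt_trichotomy a b with h | h | h
    · exact absurd hab (hmin a b h hb)
    · exact h
    · exact absurd hab.symm (hmin b a h ha)
  have hcard : (bd γ).card = j := by
    have : bd γ = (range j).image (orbit γ e) := by
      ext e'
      simp only [mem_image, mem_range]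
      exact ⟨fun h => hcov e' h, fun ⟨k, _, h⟩ => h ▸ orbit_mem he k⟩
    rw [this, card_image_of_injOn, card_range]
    intro a ha b hb hab
    exact hinj (by simpa using ha) (by simpa using hb) (congrArg etail hab)
  rw [hcard]
  exact ⟨hcov, hinj⟩

theorem card_polys_le (x : ℤ × ℤ) (n : ℕ) (F : Finset (Finset (ℤ × ℤ)))
    (hF : ∀ γ ∈ F, IsPoly γ ∧ x ∈ γ ∧ (bd γ).card = n + 2) :
    (F.card : ℝ) ≤ (n + 2) * (3 * (1546 * 2.714 ^ n)) := by
  have hexit : ∀ γ : Finset (ℤ × ℤ), ∃ s : ℕ, γ ∈ F →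
      s < n + 2 ∧ (x + (s : ℤ) • (1, 0), (1, 0)) ∈ bd γ := by
    intro γ
    by_cases hγ : γ ∈ F
    swap
    · exact ⟨0, fun h => absurd h hγ⟩
    obtain ⟨_, hx, hn⟩ := hF γ hγ
    obtain ⟨s, h1, h2⟩ := exists_exit γ (r := (1, 0)) (by simp [dirs]) hx
    refine ⟨s, fun _ => ⟨?_, mem_bd.2 ⟨h1 s le_rfl, by simp [dirs], h2⟩⟩⟩
    have h3 : (range (s + 1)).image (fun i : ℕ => x.1 + i) ⊆ γ.image Prod.fst := by
      intro a ha
      obtain ⟨i, hi, rfl⟩ := mem_image.1 ha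
      exact mem_image.2 ⟨_, h1 i (Nat.lt_succ_iff.1 (mem_range.1 hi)), by simp⟩
    have h4 := card_le_card h3
    rw [card_image_of_injective _ (by intro a b hab; simpa using hab), card_range] at h4
    have := two_mul_card_le_card_bd γ
    omega
  choose s hs using hexit
  set start : Finset (ℤ × ℤ) → (ℤ × ℤ) × (ℤ × ℤ) := fun γ =>
    (x + (s γ : ℤ) • (1, 0), (1, 0)) with hstart
  set tl : Finset (ℤ × ℤ) → List Turn := fun γ =>
    turnList (fun k => turnAt γ (orbit γ (start γ) k)) (n + 1) with htl
  set T : Finset (ℕ × List Turn) := range (n + 2) ×ˢ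
    (({.S, .L, .R} : Finset Turn) ×ˢ saws n).image fun a => a.1 :: a.2 with hT
  have hmaps : ∀ γ ∈ F, (s γ, tl γ) ∈ T := by
    intro γ hγ
    obtain ⟨hpoly, hx, hn⟩ := hF γ hγ
    obtain ⟨hs1, hs2⟩ := hs γ hγ
    refine mem_product.2 ⟨mem_range.2 hs1, mem_image.2 ⟨(turnAt γ (orbit γ (start γ) n),
      turnList (fun k => turnAt γ (orbit γ (start γ) k)) n), mem_product.2 ⟨?_, ?_⟩, rfl⟩⟩
    · cases turnAt γ (orbit γ (start γ) n) <;> simp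
    · have hsaw := isSAW_turnList (t := fun k => turnAt γ (orbit γ (start γ) k))
        (u := fun k => etail (orbit γ (start γ) k)) (h := fun k => rotL (orbit γ (start γ) k).2)
        (fun k => by
          rw [etail_orbit_succ]
          simp only [ehead, etail]
          abel) (fun k => rotL_move _ _) (hpoly.orbit_bd hs2).2 n (by omega)
      rw [← mem_saws, length_turnList] at hsaw
      exact hsaw
  have hinj : Set.InjOn (fun γ => (s γ, tl γ)) (F : Set (Finset (ℤ × ℤ))) := by
    intro γ hγ γ' hγ' h
    obtain ⟨hpoly, hx, hn⟩ := hF γ hγ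
    obtain ⟨hpoly', hx', hn'⟩ := hF γ' hγ'
    obtain ⟨h1, h2⟩ := Prod.ext_iff.1 h
    simp only at h1 h2
    have hst : start γ = start γ' := by simp only [hstart, h1]
    have horb : ∀ k < n + 2, orbit γ (start γ) k = orbit γ' (start γ') k := by
      intro k
      induction k with
      | zero => intro _; exact hst
      | succ k ih =>
        intro hk
        have h3 := turnList_congr h2 k (by omega)
        rw [orbit, orbit, h3, ih (by omega)]
    have hbd : bd γ = bd γ' := by
      ext e
      constructor
      · intro he
        obtain ⟨k, hk, rfl⟩ := (hpoly.orbit_bd (hs γ hγ).2).1 e he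
        rw [show orbit γ (x + (s γ : ℤ) • (1, 0), (1, 0)) k = _ from horb k (hn ▸ hk)]
        exact orbit_mem (hs γ' hγ').2 k
      · intro he
        obtain ⟨k, hk, rfl⟩ := (hpoly'.orbit_bd (hs γ' hγ').2).1 e he
        rw [show orbit γ' (x + (s γ' : ℤ) • (1, 0), (1, 0)) k = _ from (horb k (hn' ▸ hk)).symm]
        exact orbit_mem (hs γ hγ).2 k
    exact (subset_of_bd_eq hbd hx hx' hpoly.conn).antisymm
      (subset_of_bd_eq hbd.symm hx' hx hpoly'.conn)
  have hcard : F.card ≤ (n + 2) * (3 * (saws n).card) := by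
    refine (card_le_card_of_injOn _ hmaps hinj).trans ?_
    rw [hT, card_product, card_range]
    refine Nat.mul_le_mul_left _ (card_image_le.trans ?_)
    rw [card_product]
    exact Nat.mul_le_mul_right _ card_le_three
  calc (F.card : ℝ) ≤ (n + 2) * (3 * (saws n).card) := by exact_mod_cast hcard
    _ ≤ _ := by
      have := card_saws_le n
      gcongr

/-- A universal bound for the generating function of polyominoes containing a cell. -/
def polyConst : ℝ := ∑' n : ℕ, (n + 2 : ℝ) * (3 * (1546 * 2.714 ^ n)) *
  Real.exp (-0.999 * (n - 2))

theorem exp_mul_lt_one : 2.714 * Real.exp (-0.999) < 1 := by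
  have h1 := Real.exp_one_gt_d9
  have h2 : (1 : ℝ) - 0.001 ≤ Real.exp (-0.001) := by
    have := Real.add_one_le_exp (-0.001 : ℝ)
    linarith
  have h3 : Real.exp 0.999 = Real.exp 1 * Real.exp (-0.001) := by
    rw [← Real.exp_add]; norm_num
  have h4 : 2.714 < Real.exp 0.999 := by
    rw [h3]
    nlinarith
  rw [Real.exp_neg, ← div_eq_mul_inv, div_lt_one (Real.exp_pos _)]
  exact h4

theorem summable_polyConst : Summable fun n : ℕ => (n + 2 : ℝ) * (3 * (1546 * 2.714 ^ n)) *
    Real.exp (-0.999 * (n - 2)) := by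
  have hr : ‖2.714 * Real.exp (-0.999)‖ < 1 := by
    rw [Real.norm_of_nonneg (by positivity)]
    exact exp_mul_lt_one
  have h0 := summable_geometric_of_norm_lt_one hr
  have h1 := summable_pow_mul_geometric_of_norm_lt_one 1 hr
  have h2 := ((h1.add (h0.mul_left 2)).mul_left (3 * 1546 * Real.exp (0.999 * 2)))
  refine h2.congr fun n => ?_
  have : Real.exp (-0.999 * ((n : ℝ) - 2)) = Real.exp (0.999 * 2) * Real.exp (-0.999) ^ n := by
    rw [← Real.exp_nat_mul, ← Real.exp_add]
    congr 1
    ring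
  rw [this, mul_pow]
  ring

theorem sum_polys_le {β : ℝ} (hβ : 0.999 ≤ β) (x : ℤ × ℤ) (F : Finset (Finset (ℤ × ℤ)))
    (hF : ∀ γ ∈ F, IsPoly γ ∧ x ∈ γ) :
    ∑ γ ∈ F, Real.exp (-β * ((bd γ).card - 4)) ≤ polyConst := by
  have h4 : ∀ γ ∈ F, 4 ≤ (bd γ).card := fun γ hγ => four_le_card_bd (hF γ hγ).2
  rw [← sum_fiberwise_of_maps_to (g := fun γ => (bd γ).card - 2)
    (t := F.image fun γ => (bd γ).card - 2) (fun γ hγ => mem_image_of_mem _ hγ)]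
  refine le_trans (sum_le_sum fun n _ => ?_)
    (summable_polyConst.sum_le_tsum (F.image fun γ => (bd γ).card - 2) fun n _ => by positivity)
  refine (sum_le_card_nsmul _ _ (Real.exp (-0.999 * (n - 2))) fun γ hγ => ?_).trans ?_
  · obtain ⟨hγ, hn⟩ := mem_filter.1 hγ
    have h := h4 γ hγ
    have hn' : ((bd γ).card : ℝ) = n + 2 := by
      rw [← hn]; push_cast [show 2 ≤ (bd γ).card by omega]; ring
    have hc : (4 : ℝ) ≤ (bd γ).card := by exact_mod_cast h
    rw [hn'] at hc ⊢
    apply Real.exp_le_exp.2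
    nlinarith
  · rw [nsmul_eq_mul]
    refine mul_le_mul_of_nonneg_right ?_ (Real.exp_pos _).le
    refine card_polys_le x n _ fun γ hγ => ?_
    obtain ⟨hγ, hn⟩ := mem_filter.1 hγ
    have h := h4 γ hγ
    exact ⟨(hF γ hγ).1, (hF γ hγ).2, by omega⟩

/-! ### Nested level contours -/

theorem Linked.mono {S T : Set (ℤ × ℤ)} (h : S ⊆ T) {p q : ℤ × ℤ} (hpq : Linked S p q) :
    Linked T p q := by
  induction hpq with
  | refl => exact Relation.ReflTransGen.refl
  | tail _ h' ih => exact Relation.ReflTransGen.tail ih ⟨h'.1, h h'.2.1, h h'.2.2⟩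

theorem Linked.symm {S : Set (ℤ × ℤ)} {p q : ℤ × ℤ} (hpq : Linked S p q) : Linked S q p := by
  induction hpq with
  | refl => exact Relation.ReflTransGen.refl
  | tail _ h ih =>
    exact Relation.ReflTransGen.head ⟨by simpa using neg_mem_dirs h.1, h.2.2, h.2.1⟩ ih

/-- The complement of a finite set is connected. -/
def Coconnected (D : Finset (ℤ × ℤ)) : Prop :=
  ∀ p ∉ D, ∀ q ∉ D, Linked (D : Set (ℤ × ℤ))ᶜ p q

/-- The connected component of a site in a set. -/
def comp (S : Set (ℤ × ℤ)) (x : ℤ × ℤ) : Set (ℤ × ℤ) := {p | Linked S x p}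

/-- The sites that a set separates from the exterior of a finite domain. -/
def fill (D : Finset (ℤ × ℤ)) (C : Set (ℤ × ℤ)) : Finset (ℤ × ℤ) :=
  D.filter fun p => ∀ q ∉ D, ¬ Linked Cᶜ p q

theorem mem_fill {D : Finset (ℤ × ℤ)} {C : Set (ℤ × ℤ)} {p : ℤ × ℤ} :
    p ∈ fill D C ↔ ∀ q ∉ D, ¬ Linked Cᶜ p q := by
  rw [fill, mem_filter, and_iff_right_iff_imp]
  intro h
  by_contra hp
  exact h p hp Relation.ReflTransGen.refl

theorem fill_subset (D : Finset (ℤ × ℤ)) (C : Set (ℤ × ℤ)) : fill D C ⊆ D := filter_subset _ _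

theorem fill_mono (D : Finset (ℤ × ℤ)) {C C' : Set (ℤ × ℤ)} (h : C ⊆ C') :
    fill D C ⊆ fill D C' := by
  intro p hp
  rw [mem_fill] at hp ⊢
  exact fun q hq hpq => hp q hq (hpq.mono (Set.compl_subset_compl.2 h))

theorem subset_fill {D : Finset (ℤ × ℤ)} {C : Set (ℤ × ℤ)} (h : C ⊆ D) {p : ℤ × ℤ} (hp : p ∈ C) :
    p ∈ fill D C := by
  rw [mem_fill]
  intro q hq hpq
  rcases Relation.ReflTransGen.cases_head hpq with rfl | ⟨r, hr, _⟩
  · exact hq (h hp)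
  · exact hr.2.1 hp

theorem mem_of_mem_bd_fill {D : Finset (ℤ × ℤ)} {C : Set (ℤ × ℤ)} (h : C ⊆ D) {p r : ℤ × ℤ}
    (hr : r ∈ dirs) (hp : p ∈ fill D C) (hpr : p + r ∉ fill D C) : p ∈ C := by
  by_contra hpC
  have hprC : p + r ∉ C := fun h' => hpr (subset_fill h h')
  rw [mem_fill] at hp hpr
  push Not at hpr
  obtain ⟨q, hq, hl⟩ := hpr
  exact hp q hq (Relation.ReflTransGen.head ⟨by simpa using hr, hpC, hprC⟩ hl)

theorem coconnected_fill {D : Finset (ℤ × ℤ)} (hD : Coconnected D) (C : Set (ℤ × ℤ)) :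
    Coconnected (fill D C) := by
  have key : ∀ p ∉ fill D C, ∃ q ∉ D, Linked (fill D C : Set (ℤ × ℤ))ᶜ p q := by
    intro p hp
    have hp' := hp
    rw [mem_fill] at hp'
    push Not at hp'
    obtain ⟨q, hq, hl⟩ := hp'
    refine ⟨q, hq, ?_⟩
    clear hp
    induction hl using Relation.ReflTransGen.head_induction_on with
    | refl => exact Relation.ReflTransGen.refl
    | head hab hbc ih =>
      refine Relation.ReflTransGen.head ⟨hab.1, ?_, ?_⟩ ih
      · exact fun h => mem_fill.1 h q hq (Relation.ReflTransGen.head hab hbc)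
      · exact fun h => mem_fill.1 h q hq hbc
  intro p hp q hq
  obtain ⟨p', hp', h1⟩ := key p hp
  obtain ⟨q', hq', h2⟩ := key q hq
  have h3 : Linked (fill D C : Set (ℤ × ℤ))ᶜ p' q' := (hD p' hp' q' hq').mono
    (Set.compl_subset_compl.2 (coe_subset.2 (fill_subset D C)))
  exact (h1.trans h3).trans h2.symm

theorem comp_subset {S : Set (ℤ × ℤ)} {x : ℤ × ℤ} (hx : x ∈ S) : comp S x ⊆ S := by
  intro p hp
  rcases Relation.ReflTransGen.cases_tail hp with rfl | ⟨_, _, h⟩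
  · exact hx
  · exact h.2.2

theorem linked_comp {S : Set (ℤ × ℤ)} {x p : ℤ × ℤ} (hp : p ∈ comp S x) :
    Linked (comp S x) x p := by
  induction hp with
  | refl => exact Relation.ReflTransGen.refl
  | tail hab hbc ih =>
    exact Relation.ReflTransGen.tail ih ⟨hbc.1, hab, Relation.ReflTransGen.tail hab hbc⟩

theorem isPoly_fill_comp {D : Finset (ℤ × ℤ)} (hD : Coconnected D) {S : Set (ℤ × ℤ)} (hS : S ⊆ D)
    {x : ℤ × ℤ} (hx : x ∈ S) : IsPoly (fill D (comp S x)) := by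
  have hC : comp S x ⊆ D := (comp_subset hx).trans hS
  have key : ∀ p ∈ fill D (comp S x), Linked (fill D (comp S x)) p x := by
    intro p hp
    obtain ⟨k, h1, h2⟩ := exists_exit _ (r := (1, 0)) (by simp [dirs]) hp
    have hk := mem_of_mem_bd_fill hC (by simp [dirs]) (h1 k le_rfl) h2
    have h3 : Linked (fill D (comp S x)) p (p + (k : ℤ) • (1, 0)) := by
      clear h2 hk
      induction k with
      | zero => simpa [Linked] using Relation.ReflTransGen.refl
      | succ k ih =>
        refine Relation.ReflTransGen.tail (ih fun i hi => h1 i (hi.trans k.le_succ))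
          ⟨?_, h1 k k.le_succ, h1 (k + 1) le_rfl⟩
        simp [dirs]
    exact h3.trans ((linked_comp hk).mono fun q hq => subset_fill hC hq).symm
  exact ⟨fun p hp q hq => (key p hp).trans (key q hq).symm, coconnected_fill hD _⟩

/-- The field crosses level `j` along the whole boundary of `γ`. -/
def Cut (γ : Finset (ℤ × ℤ)) (j : ℤ) (φ : ℤ × ℤ → ℤ) : Prop :=
  ∀ e ∈ bd γ, j ≤ φ e.1 ∧ φ (e.1 + e.2) ≤ j - 1

/-- The list, innermost first, consists of level contours for the levels `b + 1`, `b + 2`, … -/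
def Cuts (b : ℤ) : List (Finset (ℤ × ℤ)) → (ℤ × ℤ → ℤ) → Prop
  | [], _ => True
  | γ :: l, φ => Cut γ (b + l.length + 1) φ ∧ Cuts b l φ

/-- The nested lists of given length, innermost first, with entries in a given finite family. -/
def nestedLists (P : Finset (Finset (ℤ × ℤ))) : ℕ → Finset (List (Finset (ℤ × ℤ)))
  | 0 => {[]}
  | n + 1 => ((P ×ˢ nestedLists P n).filter fun a => ∀ γ ∈ a.2, a.1 ⊆ γ).image fun a => a.1 :: a.2

theorem mem_nestedLists {P : Finset (Finset (ℤ × ℤ))} {n : ℕ} {l : List (Finset (ℤ × ℤ))} :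
    l ∈ nestedLists P n ↔ l.length = n ∧ (∀ γ ∈ l, γ ∈ P) ∧ l.Pairwise (· ⊆ ·) := by
  induction n generalizing l with
  | zero =>
    simp only [nestedLists, mem_singleton, List.length_eq_zero_iff]
    exact ⟨fun h => ⟨h, by simp [h], by simp [h]⟩, fun h => h.1⟩
  | succ n ih =>
    simp only [nestedLists, mem_image, mem_filter, mem_product, Prod.exists]
    constructor
    · rintro ⟨γ, l', ⟨⟨hγ, hl'⟩, hsub⟩, rfl⟩
      obtain ⟨h1, h2, h3⟩ := ih.1 hl'
      exact ⟨by simp [h1], by simpa using ⟨hγ, h2⟩, List.pairwise_cons.2 ⟨hsub, h3⟩⟩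
    · rintro ⟨h1, h2, h3⟩
      cases l with
      | nil => simp at h1
      | cons γ l =>
        rw [List.pairwise_cons] at h3
        exact ⟨γ, l, ⟨⟨h2 γ (by simp), ih.2 ⟨by simpa using h1, fun γ' h => h2 γ' (by simp [h]),
          h3.2⟩⟩, h3.1⟩, rfl⟩

/-- The polyominoes inside a finite domain that contain a given cell. -/
def polysAt (D : Finset (ℤ × ℤ)) (x : ℤ × ℤ) : Finset (Finset (ℤ × ℤ)) :=
  D.powerset.filter fun γ => IsPoly γ ∧ x ∈ γ

theorem mem_polysAt {D : Finset (ℤ × ℤ)} {x : ℤ × ℤ} {γ : Finset (ℤ × ℤ)} :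
    γ ∈ polysAt D x ↔ γ ⊆ D ∧ IsPoly γ ∧ x ∈ γ := by
  simp [polysAt]

theorem exists_cuts {D : Finset (ℤ × ℤ)} (hD : Coconnected D) {φ : ℤ × ℤ → ℤ} {b : ℤ}
    (hφ : ∀ p ∉ D, φ p ≤ b) {x : ℤ × ℤ} (n : ℕ) (hx : b + n ≤ φ x) :
    ∃ l ∈ nestedLists (polysAt D x) n, Cuts b l φ := by
  set S : ℕ → Set (ℤ × ℤ) := fun j => {p | b + j + 1 ≤ φ p} with hS
  set c : ℕ → Finset (ℤ × ℤ) := fun j => fill D (comp (S j) x) with hc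
  have hSD : ∀ j, S j ⊆ D := by
    intro j p hp
    by_contra h
    have h1 := hφ p h
    have h2 : b + j + 1 ≤ φ p := hp
    omega
  have hanti : ∀ i j, i ≤ j → c j ⊆ c i := by
    intro i j hij
    refine fill_mono D fun p hp => Linked.mono ?_ hp
    intro q hq
    have h2 : b + j + 1 ≤ φ q := hq
    change b + i + 1 ≤ φ q
    omega
  have hcut : ∀ j : ℕ, b + j + 1 ≤ φ x → Cut (c j) (b + j + 1) φ := by
    intro j hj e he
    have hCD : comp (S j) x ⊆ D := (comp_subset hj).trans (hSD j)
    obtain ⟨h1, h2, h3⟩ := mem_bd.1 he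
    have h4 : e.1 ∈ comp (S j) x := mem_of_mem_bd_fill hCD h2 h1 h3
    have h5 : e.1 ∈ S j := comp_subset hj h4
    refine ⟨h5, ?_⟩
    by_contra h6
    have h7 : e.1 + e.2 ∈ S j := by
      change b + j + 1 ≤ φ (e.1 + e.2)
      omega
    exact h3 (subset_fill hCD (Relation.ReflTransGen.tail h4 ⟨by simpa using h2, h5, h7⟩))
  suffices h : ∀ m ≤ n, ∃ l ∈ nestedLists (polysAt D x) m, Cuts b l φ ∧
      ∀ γ ∈ l, ∃ j < m, γ = c j by
    obtain ⟨l, h1, h2, _⟩ := h n le_rfl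
    exact ⟨l, h1, h2⟩
  intro m
  induction m with
  | zero => exact fun _ => ⟨[], by simp [nestedLists], trivial, by simp⟩
  | succ m ih =>
    intro hm
    obtain ⟨l, h1, h2, h3⟩ := ih (by omega)
    have hlen := (mem_nestedLists.1 h1).1
    have hmx : b + m + 1 ≤ φ x := by omega
    refine ⟨c m :: l, ?_, ⟨?_, h2⟩, ?_⟩
    · rw [nestedLists, mem_image]
      refine ⟨(c m, l), mem_filter.2 ⟨mem_product.2 ⟨mem_polysAt.2 ⟨fill_subset _ _,
        isPoly_fill_comp hD (hSD m) hmx, ?_⟩, h1⟩, ?_⟩, rfl⟩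
      · exact subset_fill ((comp_subset hmx).trans (hSD m)) Relation.ReflTransGen.refl
      · intro γ hγ
        obtain ⟨j, hj, rfl⟩ := h3 γ hγ
        exact hanti j m hj.le
    · rw [hlen]
      exact hcut m hmx
    · intro γ hγ
      rcases List.mem_cons.1 hγ with rfl | hγ
      · exact ⟨m, m.lt_succ_self, rfl⟩
      · obtain ⟨j, hj, h⟩ := h3 γ hγ
        exact ⟨j, hj.trans m.lt_succ_self, h⟩

/-! ### The cost of nested contours -/

theorem sum_geometric_le_exp {y : ℝ} (h0 : 0 ≤ y) (h1 : y ≤ 1 / 2) (n : ℕ) :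
    ∑ k ∈ range n, y ^ k ≤ Real.exp (2 * y) := by
  have h2 : ∑ k ∈ range n, y ^ k ≤ (1 - y)⁻¹ := by
    rw [← tsum_geometric_of_lt_one h0 (by linarith)]
    exact (summable_geometric_of_lt_one h0 (by linarith)).sum_le_tsum _ fun k _ => by positivity
  refine h2.trans (le_trans ?_ (Real.add_one_le_exp (2 * y)))
  rw [inv_le_iff_one_le_mul₀ (by linarith)]
  nlinarith

theorem sum_prod_pow_le {ι κ : Type*} {Q : Finset ι} {L : Finset κ} {c : κ → ι → ℕ} {y : ι → ℝ}
    {n : ℕ} (hy0 : ∀ i, 0 ≤ y i)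
    (hinj : Set.InjOn (fun (l : κ) (i : ι) (_ : i ∈ Q) => c l i) (L : Set κ))
    (hc : ∀ l ∈ L, ∀ i ∈ Q, c l i ≤ n) :
    ∑ l ∈ L, ∏ i ∈ Q, y i ^ c l i ≤ ∏ i ∈ Q, ∑ k ∈ range (n + 1), y i ^ k := by
  rw [prod_sum Q (fun _ => range (n + 1)) fun i k => y i ^ k]
  have h1 : ∀ l ∈ L, ∏ i ∈ Q, y i ^ c l i =
      (fun p : (i : ι) → i ∈ Q → ℕ => ∏ i ∈ Q.attach, y i.1 ^ p i.1 i.2) fun i _ => c l i :=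
    fun l _ => (prod_attach Q fun i => y i ^ c l i).symm
  rw [sum_congr rfl h1, ← sum_image (f := fun p : (i : ι) → i ∈ Q → ℕ =>
    ∏ i ∈ Q.attach, y i.1 ^ p i.1 i.2) hinj]
  refine sum_le_sum_of_subset_of_nonneg ?_ fun p _ _ => prod_nonneg fun i _ => pow_nonneg (hy0 _) _
  intro p hp
  obtain ⟨l, hl, rfl⟩ := mem_image.1 hp
  exact Finset.mem_pi.2 fun i hi => mem_range.2 (Nat.lt_succ_of_le (hc l hl i hi))

theorem sum_nestedLists_le {β : ℝ} (hβ : 0.999 ≤ β) {x : ℤ × ℤ} {P : Finset (Finset (ℤ × ℤ))}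
    (hP : ∀ γ ∈ P, IsPoly γ ∧ x ∈ γ) (n : ℕ) :
    ∑ l ∈ nestedLists P n, (l.map fun γ => Real.exp (-β * (bd γ).card)).prod ≤
      Real.exp (2 * polyConst) * Real.exp (-(4 * β * n)) := by
  set y : Finset (ℤ × ℤ) → ℝ := fun γ => Real.exp (-β * ((bd γ).card - 4)) with hy
  have hy0 : ∀ γ, 0 ≤ y γ := fun γ => (Real.exp_pos _).le
  set Q := P.erase {x} with hQ
  have hprod : ∀ l : List (Finset (ℤ × ℤ)), (l.map fun γ => Real.exp (-β * (bd γ).card)).prod =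
      Real.exp (-(4 * β * l.length)) * (l.map y).prod := by
    intro l
    induction l with
    | nil => simp
    | cons γ l ih =>
      simp only [List.map_cons, List.prod_cons, ih, hy, List.length_cons]
      rw [mul_left_comm, ← mul_assoc, ← mul_assoc, ← Real.exp_add, ← Real.exp_add]
      push_cast
      ring_nf
  have hcount : ∀ l ∈ nestedLists P n, (l.map y).prod ≤ ∏ γ ∈ Q, y γ ^ l.count γ := by
    intro l hl
    obtain ⟨h1, h2, h3⟩ := mem_nestedLists.1 hl
    have e1 : (l.map y).prod = ∏ γ ∈ P, y γ ^ l.count γ := by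
      rw [prod_list_map_count]
      refine prod_subset (fun γ hγ => h2 γ (List.mem_toFinset.1 hγ)) fun γ _ hγ => ?_
      rw [List.count_eq_zero_of_not_mem (fun h => hγ (List.mem_toFinset.2 h)), pow_zero]
    rw [e1]
    by_cases hx : {x} ∈ P
    · rw [← mul_prod_erase P _ hx]
      refine mul_le_of_le_one_left (prod_nonneg fun γ _ => pow_nonneg (hy0 γ) _) ?_
      refine pow_le_one₀ (hy0 _) (Real.exp_le_one_iff.2 ?_)
      have h4 : (4 : ℝ) ≤ (bd {x}).card := by exact_mod_cast four_le_card_bd (mem_singleton_self x)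
      nlinarith
    · rw [hQ, erase_eq_of_notMem hx]
  have hinj : Set.InjOn (fun (l : List (Finset (ℤ × ℤ))) (γ : Finset (ℤ × ℤ)) (_ : γ ∈ Q) =>
      l.count γ) (nestedLists P n : Set (List (Finset (ℤ × ℤ)))) := by
    intro l hl l' hl' h
    obtain ⟨h1, h2, h3⟩ := mem_nestedLists.1 hl
    obtain ⟨h1', h2', h3'⟩ := mem_nestedLists.1 hl'
    have hQc : ∀ γ ∈ Q, l.count γ = l'.count γ := fun γ hγ => congrFun (congrFun h γ) hγ
    have hlen : ∀ l : List (Finset (ℤ × ℤ)), (∀ γ ∈ l, γ ∈ P) → ∑ γ ∈ P, l.count γ = l.length := by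
      intro l hl
      have := Multiset.sum_count_eq_card (s := P) (m := (l : Multiset _)) (by simpa using hl)
      simpa only [Multiset.coe_count, Multiset.coe_card] using this
    refine List.Perm.eq_of_pairwise (le := (· ⊆ ·)) (fun a b _ _ => Subset.antisymm) h3 h3'
      (List.perm_iff_count.2 fun γ => ?_)
    by_cases hγ : γ ∈ P
    · by_cases hγx : γ = {x}
      · subst hγx
        have e1 := hlen l h2
        have e2 := hlen l' h2'
        rw [← add_sum_erase P _ hγ, ← hQ] at e1 e2
        rw [sum_congr rfl hQc] at e1
        omega
      · exact hQc γ (mem_erase.2 ⟨hγx, hγ⟩)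
    · rw [List.count_eq_zero_of_not_mem fun h => hγ (h2 γ h),
        List.count_eq_zero_of_not_mem fun h => hγ (h2' γ h)]
  have hhalf : ∀ γ ∈ Q, y γ ≤ 1 / 2 := by
    intro γ hγ
    obtain ⟨hne, hγP⟩ := mem_erase.1 hγ
    have h6 : (6 : ℝ) ≤ (bd γ).card := by exact_mod_cast six_le_card_bd (hP γ hγP).2 hne
    have h7 : y γ ≤ Real.exp (-1) := Real.exp_le_exp.2 (by nlinarith)
    refine h7.trans ?_
    rw [Real.exp_neg, one_div]
    exact inv_anti₀ (by norm_num) (by linarith [Real.exp_one_gt_d9])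
  calc ∑ l ∈ nestedLists P n, (l.map fun γ => Real.exp (-β * (bd γ).card)).prod
      = Real.exp (-(4 * β * n)) * ∑ l ∈ nestedLists P n, (l.map y).prod := by
        rw [mul_sum]
        refine sum_congr rfl fun l hl => ?_
        rw [hprod, (mem_nestedLists.1 hl).1]
    _ ≤ Real.exp (-(4 * β * n)) * Real.exp (2 * polyConst) := by
        refine mul_le_mul_of_nonneg_left ?_ (Real.exp_pos _).le
        calc ∑ l ∈ nestedLists P n, (l.map y).prod
            ≤ ∑ l ∈ nestedLists P n, ∏ γ ∈ Q, y γ ^ l.count γ := sum_le_sum hcount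
          _ ≤ ∏ γ ∈ Q, ∑ k ∈ range (n + 1), y γ ^ k :=
              sum_prod_pow_le hy0 hinj fun l hl γ _ =>
                List.count_le_length.trans_eq (mem_nestedLists.1 hl).1
          _ ≤ ∏ γ ∈ Q, Real.exp (2 * y γ) :=
              prod_le_prod (fun γ _ => sum_nonneg fun k _ => pow_nonneg (hy0 γ) k)
                fun γ hγ => sum_geometric_le_exp (hy0 γ) (hhalf γ hγ) _
          _ = Real.exp (2 * ∑ γ ∈ Q, y γ) := by rw [mul_sum, Real.exp_sum]
          _ ≤ Real.exp (2 * polyConst) := by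
              have := sum_polys_le hβ x Q fun γ hγ => hP γ (mem_of_mem_erase hγ)
              exact Real.exp_le_exp.2 (by linarith)
    _ = _ := mul_comm _ _

/-- The mass of a set of fields for given weights. -/
def mass (w : (ℤ × ℤ → ℤ) → ENNReal) (A : Set (ℤ × ℤ → ℤ)) : ENNReal := ∑' φ, A.indicator w φ

theorem mass_mono (w : (ℤ × ℤ → ℤ) → ENNReal) {A B : Set (ℤ × ℤ → ℤ)} (h : A ⊆ B) :
    mass w A ≤ mass w B :=
  ENNReal.tsum_le_tsum fun φ => Set.indicator_le_indicator_of_subset h (fun _ => zero_le) φ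

theorem mass_le_sum {ι : Type*} (w : (ℤ × ℤ → ℤ) → ENNReal) {A : Set (ℤ × ℤ → ℤ)} (s : Finset ι)
    (B : ι → Set (ℤ × ℤ → ℤ)) (h : ∀ φ ∈ A, ∃ i ∈ s, φ ∈ B i) :
    mass w A ≤ ∑ i ∈ s, mass w (B i) := by
  unfold mass
  rw [← Summable.tsum_finsetSum fun i _ => ENNReal.summable]
  refine ENNReal.tsum_le_tsum fun φ => ?_
  by_cases hφ : φ ∈ A
  · obtain ⟨i, hi, hB⟩ := h φ hφ
    rw [Set.indicator_of_mem hφ, ← Set.indicator_of_mem hB w]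
    exact single_le_sum (f := fun i => (B i).indicator w φ) (fun _ _ => zero_le) hi
  · rw [Set.indicator_of_notMem hφ]
    exact zero_le

/-- If each further level contour of perimeter `n` costs a factor `exp (-β n)`, then reaching
height `n` above the boundary value costs `exp (-4 β n)`. -/
theorem mass_height_le {β : ℝ} (hβ : 0.999 ≤ β) {w : (ℤ × ℤ → ℤ) → ENNReal}
    {Ω : Set (ℤ × ℤ → ℤ)} {D : Finset (ℤ × ℤ)} {b : ℤ} {x : ℤ × ℤ} {n : ℕ}
    (hcut : ∀ φ ∈ Ω, b + n ≤ φ x → ∃ l ∈ nestedLists (polysAt D x) n, Cuts b l φ)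
    (hstep : ∀ γ l, IsPoly γ → γ ⊆ D → (∀ γ' ∈ l, γ ⊆ γ' ∧ γ' ⊆ D) → x ∈ γ →
      mass w (Ω ∩ {φ | Cuts b (γ :: l) φ}) ≤
        ENNReal.ofReal (Real.exp (-β * (bd γ).card)) * mass w (Ω ∩ {φ | Cuts b l φ})) :
    mass w (Ω ∩ {φ | b + n ≤ φ x}) ≤
      ENNReal.ofReal (Real.exp (2 * polyConst) * Real.exp (-(4 * β * n))) * mass w Ω := by
  have hlist : ∀ l : List (Finset (ℤ × ℤ)), (∀ γ ∈ l, γ ∈ polysAt D x) → l.Pairwise (· ⊆ ·) →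
      mass w (Ω ∩ {φ | Cuts b l φ}) ≤
        ENNReal.ofReal (l.map fun γ => Real.exp (-β * (bd γ).card)).prod * mass w Ω := by
    intro l
    induction l with
    | nil =>
      intro _ _
      simpa using mass_mono w Set.inter_subset_left
    | cons γ l ih =>
      intro h1 h2
      rw [List.pairwise_cons] at h2
      obtain ⟨h3, h4, h5⟩ := mem_polysAt.1 (h1 γ (by simp))
      have h6 : ∀ γ' ∈ l, γ' ∈ polysAt D x := fun γ' h => h1 γ' (by simp [h])
      refine (hstep γ l h4 h3 (fun γ' h => ⟨h2.1 γ' h, (mem_polysAt.1 (h6 γ' h)).1⟩) h5).trans ?_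
      rw [List.map_cons, List.prod_cons, ENNReal.ofReal_mul (Real.exp_pos _).le, mul_assoc]
      exact mul_le_mul_right (ih h6 h2.2) _
  calc mass w (Ω ∩ {φ | b + n ≤ φ x})
      ≤ ∑ l ∈ nestedLists (polysAt D x) n, mass w (Ω ∩ {φ | Cuts b l φ}) := by
        refine mass_le_sum w _ _ fun φ hφ => ?_
        obtain ⟨l, hl, h⟩ := hcut φ hφ.1 hφ.2
        exact ⟨l, hl, hφ.1, h⟩
    _ ≤ ∑ l ∈ nestedLists (polysAt D x) n,
          ENNReal.ofReal (l.map fun γ => Real.exp (-β * (bd γ).card)).prod * mass w Ω := by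
        refine sum_le_sum fun l hl => ?_
        obtain ⟨_, h2, h3⟩ := mem_nestedLists.1 hl
        exact hlist l h2 h3
    _ = ENNReal.ofReal (∑ l ∈ nestedLists (polysAt D x) n,
          (l.map fun γ => Real.exp (-β * (bd γ).card)).prod) * mass w Ω := by
        rw [← sum_mul, ENNReal.ofReal_sum_of_nonneg]
        intro l _
        refine List.prod_nonneg fun a ha => ?_
        obtain ⟨γ, _, rfl⟩ := List.mem_map.1 ha
        exact (Real.exp_pos _).le
    _ ≤ _ := by
        refine mul_le_mul_left (ENNReal.ofReal_le_ofReal ?_) _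
        exact sum_nestedLists_le hβ (fun γ hγ => (mem_polysAt.1 hγ).2) n

/-! ### The four functions theorem and energy comparisons -/

/-- The Ahlswede–Daykin inequality for the masses of sets of fields. -/
theorem mass_mul_mass_le {f₁ f₂ f₃ f₄ : (ℤ × ℤ → ℤ) → NNReal} {A₁ A₂ A₃ A₄ : Set (ℤ × ℤ → ℤ)}
    (h : ∀ φ ∈ A₁, ∀ ψ ∈ A₂, φ ⊓ ψ ∈ A₃ ∧ φ ⊔ ψ ∈ A₄ ∧ f₁ φ * f₂ ψ ≤ f₃ (φ ⊓ ψ) * f₄ (φ ⊔ ψ)) :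
    mass (fun φ => f₁ φ) A₁ * mass (fun φ => f₂ φ) A₂ ≤
      mass (fun φ => f₃ φ) A₃ * mass (fun φ => f₄ φ) A₄ := by
  have hcoe : ∀ (f : (ℤ × ℤ → ℤ) → NNReal) (A : Set (ℤ × ℤ → ℤ)),
      mass (fun φ => f φ) A = ∑' φ, ((A.indicator f φ : NNReal) : ENNReal) := by
    intro f A
    refine tsum_congr fun φ => ?_
    by_cases hφ : φ ∈ A <;> simp [hφ]
  simp only [hcoe]
  rw [ENNReal.tsum_eq_iSup_sum (f := fun φ => ((A₁.indicator f₁ φ : NNReal) : ENNReal)),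
    ENNReal.tsum_eq_iSup_sum (f := fun φ => ((A₂.indicator f₂ φ : NNReal) : ENNReal)),
    ENNReal.iSup_mul]
  refine iSup_le fun s => ?_
  rw [ENNReal.mul_iSup]
  refine iSup_le fun t => ?_
  have hind : ∀ φ ψ, A₁.indicator f₁ φ * A₂.indicator f₂ ψ ≤
      A₃.indicator f₃ (φ ⊓ ψ) * A₄.indicator f₄ (φ ⊔ ψ) := by
    intro φ ψ
    by_cases hφ : φ ∈ A₁
    · by_cases hψ : ψ ∈ A₂
      · obtain ⟨h1, h2, h3⟩ := h φ hφ ψ hψ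
        rwa [Set.indicator_of_mem hφ, Set.indicator_of_mem hψ, Set.indicator_of_mem h1,
          Set.indicator_of_mem h2]
      · simp [hψ]
    · simp [hφ]
  have h4 := ENNReal.coe_le_coe.2 <| four_functions_theorem _ _ _ _ (fun _ => zero_le)
    (fun _ => zero_le) (fun _ => zero_le) (fun _ => zero_le) hind s t
  simp only [ENNReal.coe_mul, ENNReal.ofNNReal_finsetSum] at h4
  exact h4.trans (mul_le_mul' (ENNReal.sum_le_tsum _) (ENNReal.sum_le_tsum _))

theorem mass_le_of_injOn {w w' : (ℤ × ℤ → ℤ) → ENNReal} {A B : Set (ℤ × ℤ → ℤ)} {c : ENNReal}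
    (T : (ℤ × ℤ → ℤ) → ℤ × ℤ → ℤ) (hinj : Set.InjOn T A) (hmaps : Set.MapsTo T A B)
    (h : ∀ φ ∈ A, w φ ≤ c * w' (T φ)) : mass w A ≤ c * mass w' B := by
  unfold mass
  rw [← _root_.tsum_subtype, ← _root_.tsum_subtype, ← ENNReal.tsum_mul_left]
  refine (ENNReal.tsum_le_tsum fun φ : A => h φ φ.2).trans ?_
  exact ENNReal.tsum_comp_le_tsum_of_injective (f := hmaps.restrict T A B)
    (hmaps.restrict_inj.2 hinj) fun ψ : B => c * w' ψ

theorem Ham_inf_add_Ham_sup_le (N : ℕ) (φ ψ : ℤ × ℤ → ℤ) :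
    Ham N (φ ⊓ ψ) + Ham N (φ ⊔ ψ) ≤ Ham N φ + Ham N ψ := by
  unfold Ham
  rw [← mul_add, ← mul_add, ← sum_add_distrib, ← sum_add_distrib]
  refine mul_le_mul_of_nonneg_left (sum_le_sum fun x _ => ?_) (by norm_num)
  rw [← sum_add_distrib, ← sum_add_distrib]
  refine sum_le_sum fun y _ => ?_
  have h : |φ x ⊓ ψ x - φ y ⊓ ψ y| + |φ x ⊔ ψ x - φ y ⊔ ψ y| ≤ |φ x - φ y| + |ψ x - ψ y| := by
    grind
  exact_mod_cast h

theorem Ham_neg (N : ℕ) (φ : ℤ × ℤ → ℤ) : Ham N (-φ) = Ham N φ := by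
  unfold Ham
  congr 1
  refine sum_congr rfl fun x _ => sum_congr rfl fun y _ => ?_
  rw [← abs_neg]
  congr 1
  simp only [Pi.neg_apply, Int.cast_neg]
  ring

/-- The indicator function of a set of cells. -/
def ind (γ : Finset (ℤ × ℤ)) : ℤ × ℤ → ℤ := fun p => if p ∈ γ then 1 else 0

theorem sum_nbrs (x : ℤ × ℤ) (f : ℤ × ℤ → ℝ) : ∑ y ∈ nbrs x, f y = ∑ r ∈ dirs, f (x + r) := by
  obtain ⟨a, b⟩ := x
  have h : nbrs (a, b) = dirs.image fun r => (a, b) + r := by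
    simp [nbrs, dirs, image_insert, sub_eq_add_neg]
  rw [h, sum_image (add_right_injective _).injOn]

theorem add_dirs_mem_Box {N : ℕ} {x r : ℤ × ℤ} (hx : x ∈ Lam N) (hr : r ∈ dirs) :
    x + r ∈ Box N := by
  obtain ⟨a, b⟩ := x
  simp only [Lam, Box, mem_product, mem_Icc] at *
  rcases mem_dirs.1 hr with rfl | rfl | rfl | rfl <;> (constructor <;> constructor <;> simp <;> omega)

theorem Lam_subset_Box (N : ℕ) : Lam N ⊆ Box N := by
  intro p hp
  simp only [Lam, Box, mem_product, mem_Icc] at *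
  omega

theorem card_bd_eq_sum {γ : Finset (ℤ × ℤ)} {N : ℕ} (hγ : γ ⊆ Lam N) :
    ((bd γ).card : ℝ) = ∑ x ∈ Box N, ∑ r ∈ dirs, if x ∈ γ ∧ x + r ∉ γ then 1 else 0 := by
  rw [← sum_product', sum_boole]
  congr 2
  ext e
  simp only [mem_bd, mem_filter, mem_product]
  exact ⟨fun h => ⟨⟨Lam_subset_Box N (hγ h.1), h.2.1⟩, h.1, h.2.2⟩, fun h => ⟨h.2.1, h.1.2, h.2.2⟩⟩

theorem card_bd_eq_sum' {γ : Finset (ℤ × ℤ)} {N : ℕ} (hγ : γ ⊆ Lam N) :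
    ((bd γ).card : ℝ) = ∑ x ∈ Box N, ∑ r ∈ dirs, if x + r ∈ γ ∧ x ∉ γ then 1 else 0 := by
  rw [← sum_product', sum_boole]
  congr 1
  refine card_nbij' (fun e => (e.1 + e.2, -e.2)) (fun e => (e.1 + e.2, -e.2)) ?_ ?_ ?_ ?_
  · intro e he
    obtain ⟨h1, h2, h3⟩ := mem_bd.1 he
    simp only [mem_coe, mem_filter, mem_product]
    exact ⟨⟨add_dirs_mem_Box (hγ h1) h2, neg_mem_dirs h2⟩, by simpa using h1, h3⟩
  · intro e he
    simp only [mem_coe, mem_filter, mem_product] at he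
    exact mem_bd.2 ⟨he.2.1, neg_mem_dirs he.1.2, by simpa using he.2.2⟩
  · intro e _
    simp
  · intro e _
    simp

/-- Lowering a field by one inside a level contour removes the length of the contour from the
energy. -/
theorem Ham_sub_ind {γ : Finset (ℤ × ℤ)} {N : ℕ} (hγ : γ ⊆ Lam N) {φ : ℤ × ℤ → ℤ} {j : ℤ}
    (h : Cut γ j φ) : Ham N φ = Ham N (φ - ind γ) + (bd γ).card := by
  have h2 : ((bd γ).card : ℝ) = 1 / 2 * ((bd γ).card + (bd γ).card) := by ring
  rw [h2]
  nth_rw 1 [card_bd_eq_sum hγ]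
  rw [card_bd_eq_sum' hγ]
  unfold Ham
  rw [← sum_add_distrib, ← mul_add, ← sum_add_distrib]
  congr 1
  refine sum_congr rfl fun x _ => ?_
  rw [sum_nbrs, sum_nbrs, ← sum_add_distrib, ← sum_add_distrib]
  refine sum_congr rfl fun r hr => ?_
  have key : |φ x - φ (x + r)| = |(φ - ind γ) x - (φ - ind γ) (x + r)| +
      ((if x ∈ γ ∧ x + r ∉ γ then 1 else 0) + if x + r ∈ γ ∧ x ∉ γ then 1 else 0) := by
    simp only [Pi.sub_apply, ind]
    by_cases h3 : x ∈ γ <;> by_cases h4 : x + r ∈ γ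
    · simp [h3, h4]
    · obtain ⟨h5, h6⟩ := h (x, r) (mem_bd.2 ⟨h3, hr, h4⟩)
      simp only at h5 h6
      simp only [h3, h4, not_false_eq_true, and_self, not_true_eq_false, if_true, if_false]
      rw [abs_of_nonneg (by omega), abs_of_nonneg (by omega)]
      omega
    · obtain ⟨h5, h6⟩ := h (x + r, -r) (mem_bd.2 ⟨h4, neg_mem_dirs hr, by simpa using h3⟩)
      simp only [add_neg_cancel_right] at h5 h6
      simp only [h3, h4, not_false_eq_true, and_self, not_true_eq_false, if_true, if_false]
      rw [abs_of_nonpos (by omega), abs_of_nonpos (by omega)]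
      omega
    · simp [h3, h4]
  exact_mod_cast key

/-- Lowering a field by one inside a level contour keeps the contours around it. -/
theorem Cuts.sub_ind {γ : Finset (ℤ × ℤ)} {b : ℤ} {φ : ℤ × ℤ → ℤ} : ∀ {l : List (Finset (ℤ × ℤ))},
    (∀ γ' ∈ l, γ ⊆ γ') → Cut γ (b + l.length + 1) φ → Cuts b l φ → Cuts b l (φ - ind γ) := by
  suffices h : ∀ (l : List (Finset (ℤ × ℤ))) (j : ℤ), b + l.length + 1 ≤ j → (∀ γ' ∈ l, γ ⊆ γ') →
      Cut γ j φ → Cuts b l φ → Cuts b l (φ - ind γ) from fun {l} => h l _ le_rfl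
  intro l
  induction l with
  | nil => exact fun _ _ _ _ _ => trivial
  | cons γ' l ih =>
    intro j hj hsub hcut hcuts
    simp only [List.length_cons, Nat.cast_add, Nat.cast_one] at hj
    refine ⟨fun e he => ?_, ih j (by omega) (fun γ'' h => hsub γ'' (by simp [h])) hcut hcuts.2⟩
    have h1 := hcuts.1 e he
    obtain ⟨h2, h3, h4⟩ := mem_bd.1 he
    have h5 : e.1 + e.2 ∉ γ := fun h => h4 (hsub γ' (by simp) h)
    simp only [Pi.sub_apply, ind, h5, if_false, sub_zero]
    refine ⟨?_, h1.2⟩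
    by_cases h6 : e.1 ∈ γ
    · have := (hcut e (mem_bd.2 ⟨h6, h3, h5⟩)).1
      simp only [h6, if_true]
      omega
    · simpa [h6] using h1.1

theorem Cuts.sup {b : ℤ} {φ ψ : ℤ × ℤ → ℤ} : ∀ {l : List (Finset (ℤ × ℤ))},
    Cuts b l φ → Cuts b l ψ → Cuts b l (φ ⊔ ψ)
  | [], _, _ => trivial
  | _ :: _, hφ, hψ => ⟨fun e he => by
      have h1 := hφ.1 e he
      have h2 := hψ.1 e he
      simp only [Pi.sup_apply]
      omega, Cuts.sup hφ.2 hψ.2⟩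

theorem Cuts.inf {b : ℤ} {φ ψ : ℤ × ℤ → ℤ} : ∀ {l : List (Finset (ℤ × ℤ))},
    Cuts b l φ → Cuts b l ψ → Cuts b l (φ ⊓ ψ)
  | [], _, _ => trivial
  | _ :: _, hφ, hψ => ⟨fun e he => by
      have h1 := hφ.1 e he
      have h2 := hψ.1 e he
      simp only [Pi.inf_apply]
      omega, Cuts.inf hφ.2 hψ.2⟩

/-- The Boltzmann weight of a field for the energy `Ham N` and a site potential `u`. -/
def gibbs (N : ℕ) (β : ℝ) (u : ℤ → ℝ) (φ : ℤ × ℤ → ℤ) : NNReal :=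
  Real.toNNReal (Real.exp (-β * Ham N φ + ∑ x ∈ Lam N, u (φ x)))

theorem gibbs_mul_gibbs_le {N : ℕ} {β : ℝ} (hβ : 0 ≤ β) {u₁ u₂ u₃ u₄ : ℤ → ℝ} {φ ψ : ℤ × ℤ → ℤ}
    (h : ∀ x ∈ Lam N, u₁ (φ x) + u₂ (ψ x) ≤ u₃ (φ x ⊓ ψ x) + u₄ (φ x ⊔ ψ x)) :
    gibbs N β u₁ φ * gibbs N β u₂ ψ ≤ gibbs N β u₃ (φ ⊓ ψ) * gibbs N β u₄ (φ ⊔ ψ) := by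
  unfold gibbs
  rw [← Real.toNNReal_mul (Real.exp_pos _).le, ← Real.toNNReal_mul (Real.exp_pos _).le,
    ← Real.exp_add, ← Real.exp_add]
  refine Real.toNNReal_le_toNNReal (Real.exp_le_exp.2 ?_)
  have h1 := mul_le_mul_of_nonneg_left (Ham_inf_add_Ham_sup_le N φ ψ) hβ
  have h2 := sum_le_sum h
  rw [sum_add_distrib, sum_add_distrib] at h2
  simp only [Pi.inf_apply, Pi.sup_apply]
  linarith

theorem gibbs_le_mul_gibbs {N : ℕ} {β c : ℝ} {u u' : ℤ → ℝ} {φ ψ : ℤ × ℤ → ℤ}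
    (h : -β * Ham N φ + ∑ x ∈ Lam N, u (φ x) ≤ c + (-β * Ham N ψ + ∑ x ∈ Lam N, u' (ψ x))) :
    (gibbs N β u φ : ENNReal) ≤ ENNReal.ofReal (Real.exp c) * gibbs N β u' ψ := by
  change ENNReal.ofReal _ ≤ ENNReal.ofReal _ * ENNReal.ofReal _
  rw [← ENNReal.ofReal_mul (Real.exp_pos _).le, ← Real.exp_add]
  exact ENNReal.ofReal_le_ofReal (Real.exp_le_exp.2 h)

/-! ### The field above the wall -/

/-- Nonnegative fields with value `b` outside the box. -/
def fields (N : ℕ) (b : ℤ) : Set (ℤ × ℤ → ℤ) := {φ | (∀ x, 0 ≤ φ x) ∧ ∀ x ∉ Lam N, φ x = b}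

/-- Reward `t` for sites of height at least `k`. -/
def tilt (t : ℝ) (k v : ℤ) : ℝ := if k ≤ v then t else 0

/-- The cells of `γ` all of whose neighbours are in `γ`. -/
def inner (γ : Finset (ℤ × ℤ)) : Finset (ℤ × ℤ) := γ.filter fun p => ∀ r ∈ dirs, p + r ∈ γ

/-- The upper bounds outside the contours required by `Cuts`. -/
def Outer (b : ℤ) : List (Finset (ℤ × ℤ)) → (ℤ × ℤ → ℤ) → Prop
  | [], _ => True
  | γ :: l, φ => (∀ e ∈ bd γ, φ (e.1 + e.2) ≤ b + l.length) ∧ Outer b l φ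

/-- Fields which are constant along the inside of the innermost contour. -/
def flat (N : ℕ) (b : ℤ) (γ : Finset (ℤ × ℤ)) (l : List (Finset (ℤ × ℤ))) : Set (ℤ × ℤ → ℤ) :=
  fields N b ∩ {φ | (∀ p ∈ γ, p ∉ inner γ → φ p = b + l.length + 1) ∧ Outer b (γ :: l) φ}

theorem mem_inner {γ : Finset (ℤ × ℤ)} {p : ℤ × ℤ} :
    p ∈ inner γ ↔ p ∈ γ ∧ ∀ r ∈ dirs, p + r ∈ γ := by simp [inner]

theorem IsPoly.coconnected_inner {γ : Finset (ℤ × ℤ)} (hγ : IsPoly γ) : Coconnected (inner γ) := by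
  have hsub : (γ : Set (ℤ × ℤ))ᶜ ⊆ (inner γ : Set (ℤ × ℤ))ᶜ := fun p hp h =>
    hp (mem_inner.1 h).1
  have key : ∀ p ∉ inner γ, ∃ q ∉ γ, Linked (inner γ : Set (ℤ × ℤ))ᶜ p q := by
    intro p hp
    by_cases h : p ∈ γ
    · obtain ⟨r, hr, h1⟩ : ∃ r ∈ dirs, p + r ∉ γ := by
        by_contra! h1
        exact hp (mem_inner.2 ⟨h, h1⟩)
      exact ⟨p + r, h1, Relation.ReflTransGen.single ⟨by simpa using hr, hp, hsub h1⟩⟩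
    · exact ⟨p, h, Relation.ReflTransGen.refl⟩
  intro p hp q hq
  obtain ⟨p', h1, h2⟩ := key p hp
  obtain ⟨q', h3, h4⟩ := key q hq
  exact (h2.trans ((hγ.coconn p' h1 q' h3).mono hsub)).trans h4.symm

theorem coconnected_Lam (N : ℕ) : Coconnected (Lam N) := by
  have hrow : ∀ c : ℤ, c ∉ Icc (1 : ℤ) N → ∀ a : ℤ, Linked (Lam N : Set (ℤ × ℤ))ᶜ (a, c) (0, c) := by
    intro c hc a
    have hS : ∀ a : ℤ, (a, c) ∈ (Lam N : Set (ℤ × ℤ))ᶜ := fun a h => hc (mem_product.1 h).2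
    induction a using Int.induction_on with
    | zero => exact Relation.ReflTransGen.refl
    | succ i ih => exact Relation.ReflTransGen.head ⟨by simp [dirs], hS _, hS _⟩ ih
    | pred i ih => exact Relation.ReflTransGen.head ⟨by simp [dirs], hS _, hS _⟩ ih
  have hcol : ∀ a : ℤ, a ∉ Icc (1 : ℤ) N → ∀ c : ℤ, Linked (Lam N : Set (ℤ × ℤ))ᶜ (a, c) (a, 0) := by
    intro a ha c
    have hS : ∀ c : ℤ, (a, c) ∈ (Lam N : Set (ℤ × ℤ))ᶜ := fun c h => ha (mem_product.1 h).1
    induction c using Int.induction_on with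
    | zero => exact Relation.ReflTransGen.refl
    | succ i ih => exact Relation.ReflTransGen.head ⟨by simp [dirs], hS _, hS _⟩ ih
    | pred i ih => exact Relation.ReflTransGen.head ⟨by simp [dirs], hS _, hS _⟩ ih
  have h0 : (0 : ℤ) ∉ Icc (1 : ℤ) N := by simp
  have key : ∀ p ∉ Lam N, Linked (Lam N : Set (ℤ × ℤ))ᶜ p (0, 0) := by
    rintro ⟨a, c⟩ hp
    by_cases ha : a ∈ Icc (1 : ℤ) N
    · have hc : c ∉ Icc (1 : ℤ) N := fun hc => hp (mem_product.2 ⟨ha, hc⟩)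
      exact (hrow c hc a).trans (hcol 0 h0 c)
    · exact (hcol a ha c).trans (hrow 0 h0 a)
  exact fun p hp q hq => (key p hp).trans (key q hq).symm

theorem Cuts.congr {b : ℤ} {φ ψ : ℤ × ℤ → ℤ} : ∀ {l : List (Finset (ℤ × ℤ))},
    (∀ γ ∈ l, ∀ e ∈ bd γ, φ e.1 = ψ e.1 ∧ φ (e.1 + e.2) = ψ (e.1 + e.2)) → Cuts b l φ → Cuts b l ψ
  | [], _, _ => trivial
  | γ :: _, h, hφ => ⟨fun e he => by
      have h1 := h γ (by simp) e he
      rw [← h1.1, ← h1.2]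
      exact hφ.1 e he, Cuts.congr (fun γ' h' => h γ' (by simp [h'])) hφ.2⟩

theorem Outer.congr {b : ℤ} {φ ψ : ℤ × ℤ → ℤ} : ∀ {l : List (Finset (ℤ × ℤ))},
    (∀ γ ∈ l, ∀ e ∈ bd γ, φ (e.1 + e.2) = ψ (e.1 + e.2)) → Outer b l φ → Outer b l ψ
  | [], _, _ => trivial
  | γ :: _, h, hφ => ⟨fun e he => by
      rw [← h γ (by simp) e he]
      exact hφ.1 e he, Outer.congr (fun γ' h' => h γ' (by simp [h'])) hφ.2⟩

theorem Outer.inf {b : ℤ} {φ : ℤ × ℤ → ℤ} (ψ : ℤ × ℤ → ℤ) : ∀ {l : List (Finset (ℤ × ℤ))},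
    Outer b l φ → Outer b l (φ ⊓ ψ)
  | [], _ => trivial
  | _ :: _, hφ => ⟨fun e he => inf_le_left.trans (hφ.1 e he), Outer.inf ψ hφ.2⟩

theorem Outer.of_le {b : ℤ} {φ : ℤ × ℤ → ℤ} : ∀ {l : List (Finset (ℤ × ℤ))},
    (∀ γ ∈ l, ∀ e ∈ bd γ, φ (e.1 + e.2) ≤ b) → Outer b l φ
  | [], _ => trivial
  | γ :: _, h => ⟨fun e he => (h γ (by simp) e he).trans (by omega),
      Outer.of_le fun γ' h' => h γ' (by simp [h'])⟩

theorem Outer.sup_cuts {b : ℤ} {φ ψ : ℤ × ℤ → ℤ} : ∀ {l : List (Finset (ℤ × ℤ))},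
    Outer b l φ → Cuts b l ψ → Cuts b l (φ ⊔ ψ)
  | [], _, _ => trivial
  | _ :: _, hφ, hψ => ⟨fun e he => by
      have h1 := hφ.1 e he
      have h2 := hψ.1 e he
      simp only [Pi.sup_apply]
      omega, Outer.sup_cuts hφ.2 hψ.2⟩

theorem fields_inf {N : ℕ} {b : ℤ} {φ ψ : ℤ × ℤ → ℤ} (hφ : φ ∈ fields N b) (hψ : ψ ∈ fields N b) :
    φ ⊓ ψ ∈ fields N b :=
  ⟨fun x => le_inf (hφ.1 x) (hψ.1 x), fun x hx => by simp [hφ.2 x hx, hψ.2 x hx]⟩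

theorem fields_sup {N : ℕ} {b : ℤ} {φ ψ : ℤ × ℤ → ℤ} (hφ : φ ∈ fields N b) (hψ : ψ ∈ fields N b) :
    φ ⊔ ψ ∈ fields N b :=
  ⟨fun x => le_sup_of_le_left (hφ.1 x), fun x hx => by simp [hφ.2 x hx, hψ.2 x hx]⟩

/-- Inside the innermost contour of level `i`, reaching zero costs `exp (-4 β i)`. -/
theorem mass_flat_le {N : ℕ} {β : ℝ} (hβ : 0.999 ≤ β) {b : ℤ} {γ : Finset (ℤ × ℤ)}
    {l : List (Finset (ℤ × ℤ))} (hγ : IsPoly γ) (hγN : γ ⊆ Lam N) (hl : ∀ γ' ∈ l, γ ⊆ γ')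
    {i : ℕ} (hi : (i : ℤ) = b + l.length + 1) {x : ℤ × ℤ} (hx : x ∈ γ) :
    mass (fun φ => gibbs N β 0 φ) (flat N b γ l ∩ {φ | φ x ≤ 0}) ≤
      ENNReal.ofReal (Real.exp (2 * polyConst) * Real.exp (-(4 * β * i))) *
        mass (fun φ => gibbs N β 0 φ) (flat N b γ l) := by
  set w : (ℤ × ℤ → ℤ) → ENNReal := fun φ => gibbs N β 0 φ with hw
  have hneg : ∀ φ, w (-φ) = w φ := fun φ => by simp [hw, gibbs, Ham_neg]
  set Ω : Set (ℤ × ℤ → ℤ) := {ψ | -ψ ∈ flat N b γ l} with hΩ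
  have h1 : mass w (Ω ∩ {ψ | -(i : ℤ) + i ≤ ψ x}) ≤
      ENNReal.ofReal (Real.exp (2 * polyConst) * Real.exp (-(4 * β * i))) * mass w Ω := by
    refine mass_height_le hβ (D := inner γ) ?_ ?_
    · intro ψ hψ hψx
      have h1 : ∀ p ∉ inner γ, (if p ∈ γ then ψ p else -(i : ℤ)) ≤ -i := by
        intro p hp
        by_cases h : p ∈ γ
        · have := hψ.2.1 p h hp
          simp only [Pi.neg_apply] at this
          simp only [h, if_true]
          omega
        · simp [h]
      obtain ⟨l', h2, h3⟩ := exists_cuts hγ.coconnected_inner h1 (x := x) i (by simpa [hx] using hψx)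
      refine ⟨l', h2, h3.congr fun η hη e he => ?_⟩
      have h4 := (mem_polysAt.1 ((mem_nestedLists.1 h2).2.1 η hη)).1
      have h5 := mem_inner.1 (h4 (mem_bd.1 he).1)
      simp only [h5.1, h5.2 _ (mem_bd.1 he).2.1, if_true, and_self]
    · intro η l' hη hηD hl' hxη
      refine mass_le_of_injOn (fun ψ => ψ - ind η) (fun a _ b _ h => sub_left_injective h) ?_ ?_
      · rintro ψ ⟨⟨⟨h2, h3⟩, h4, h5⟩, h6, h7⟩
        have hout : ∀ p ∉ inner γ, (-(ψ - ind η)) p = (-ψ) p := fun p hp => by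
          have h8 : p ∉ η := fun h => hp (hηD h)
          simp [ind, h8]
        refine ⟨⟨⟨fun p => ?_, fun p hp => ?_⟩, fun p hp hp' => ?_, ?_⟩, ?_⟩
        · have := h2 p
          simp only [Pi.neg_apply, Pi.sub_apply, ind] at *
          split_ifs <;> omega
        · rw [hout p fun h => hp (hγN (mem_inner.1 h).1)]
          exact h3 p hp
        · rw [hout p hp']
          exact h4 p hp hp'
        · refine h5.congr fun γ' hγ' e he => (hout _ fun h => (mem_bd.1 he).2.2 ?_).symm
          have h8 := (mem_inner.1 h).1
          rcases List.mem_cons.1 hγ' with rfl | h9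
          · exact h8
          · exact hl γ' h9 h8
        · exact Cuts.sub_ind (fun γ' h => (hl' γ' h).1) h6 h7
      · rintro ψ ⟨_, h6, _⟩
        refine gibbs_le_mul_gibbs ?_
        rw [Ham_sub_ind ((hηD.trans (filter_subset _ _)).trans hγN) h6]
        simp only [Pi.zero_apply, sum_const_zero]
        linarith
  have h2 : mass w (flat N b γ l ∩ {φ | φ x ≤ 0}) ≤ 1 * mass w (Ω ∩ {ψ | -(i : ℤ) + i ≤ ψ x}) := by
    refine mass_le_of_injOn (fun φ => -φ) (fun a _ b _ h => neg_injective h) ?_ fun φ _ => ?_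
    · rintro φ ⟨h3, h4⟩
      refine ⟨by simpa [hΩ] using h3, ?_⟩
      simpa using h4
    · simp only [hneg, one_mul, le_refl]
  have h3 : mass w Ω ≤ 1 * mass w (flat N b γ l) := by
    refine mass_le_of_injOn (fun φ => -φ) (fun a _ b _ h => neg_injective h) (fun φ h => h)
      fun φ _ => ?_
    simp only [hneg, one_mul, le_refl]
  rw [one_mul] at h2 h3
  exact h2.trans (h1.trans (mul_le_mul_right h3 _))

theorem mass_ne_zero {w : (ℤ × ℤ → ℤ) → ENNReal} {A : Set (ℤ × ℤ → ℤ)} {φ : ℤ × ℤ → ℤ} (hφ : φ ∈ A)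
    (h : w φ ≠ 0) : mass w A ≠ 0 := by
  refine fun h0 => h ?_
  rw [← Set.indicator_of_mem hφ w]
  exact ENNReal.tsum_eq_zero.1 h0 φ

theorem gibbs_ne_zero (N : ℕ) (β : ℝ) (u : ℤ → ℝ) (φ : ℤ × ℤ → ℤ) :
    (gibbs N β u φ : ENNReal) ≠ 0 := by
  simp [gibbs, Real.exp_pos]

theorem flat_nonempty {N : ℕ} {b : ℤ} (hb : 0 ≤ b) {γ : Finset (ℤ × ℤ)}
    {l : List (Finset (ℤ × ℤ))} (hγN : γ ⊆ Lam N) (hl : ∀ γ' ∈ l, γ ⊆ γ') :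
    (flat N b γ l).Nonempty := by
  refine ⟨fun p => if p ∈ γ then b + l.length + 1 else b, ⟨fun p => ?_, fun p hp => ?_⟩,
    fun p hp _ => by simp [hp], Outer.of_le fun γ' hγ' e he => ?_⟩
  · dsimp only
    split_ifs <;> omega
  · have h : p ∉ γ := fun h => hp (hγN h)
    simp [h]
  · have h : e.1 + e.2 ∉ γ := by
      intro h
      refine (mem_bd.1 he).2.2 ?_
      rcases List.mem_cons.1 hγ' with rfl | h9
      · exact h
      · exact hl γ' h9 h
    simp [h]

theorem le_of_flat {N : ℕ} {b : ℤ} {γ : Finset (ℤ × ℤ)} {l : List (Finset (ℤ × ℤ))}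
    {φ ψ : ℤ × ℤ → ℤ} (hφ : φ ∈ flat N b γ l) (hψ : ψ ∈ fields N b ∩ {φ | Cuts b (γ :: l) φ}) :
    φ ⊓ ψ ∈ flat N b γ l ∧ φ ⊔ ψ ∈ fields N b ∩ {φ | Cuts b (γ :: l) φ} := by
  refine ⟨⟨fields_inf hφ.1 hψ.1, fun p hp hp' => ?_, hφ.2.2.inf ψ⟩, fields_sup hφ.1 hψ.1,
    Outer.sup_cuts hφ.2.2 hψ.2⟩
  have h1 := hφ.2.1 p hp hp'
  obtain ⟨r, hr, h2⟩ : ∃ r ∈ dirs, p + r ∉ γ := by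
    by_contra! h2
    exact hp' (mem_inner.2 ⟨hp, h2⟩)
  have h3 := (hψ.2.1 (p, r) (mem_bd.2 ⟨hp, hr, h2⟩)).1
  simp only at h3
  simp only [Pi.inf_apply]
  omega

theorem tilt_mono {t : ℝ} (ht : 0 ≤ t) (k : ℤ) : Monotone (tilt t k) := by
  intro a b hab
  unfold tilt
  split_ifs
  · exact le_rfl
  · omega
  · exact ht
  · exact le_rfl

theorem tilt_add_tilt (t : ℝ) (k a b : ℤ) :
    tilt t k a + tilt t k b ≤ tilt t k (a ⊓ b) + tilt t k (a ⊔ b) := by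
  rcases le_total a b with h | h
  · rw [inf_eq_left.2 h, sup_eq_right.2 h]
  · rw [inf_eq_right.2 h, sup_eq_left.2 h, add_comm]

/-- Conditionally on a chain of contours, a site inside the innermost one is positive with high
probability. -/
theorem le_mass_cuts_pos {N : ℕ} {β : ℝ} (hβ : 0.999 ≤ β) {t : ℝ} (ht : 0 ≤ t) (k : ℤ) {b : ℤ}
    (hb : 0 ≤ b) (hfin : mass (fun φ => gibbs N β 0 φ) (fields N b) ≠ ⊤) {δ : ℝ}
    (hδ : Real.exp (2 * polyConst) * Real.exp (-(4 * β * (b + 1))) ≤ δ) {γ : Finset (ℤ × ℤ)}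
    {l : List (Finset (ℤ × ℤ))} (hγ : IsPoly γ) (hγN : γ ⊆ Lam N) (hl : ∀ γ' ∈ l, γ ⊆ γ')
    {y : ℤ × ℤ} (hy : y ∈ γ) :
    ENNReal.ofReal (1 - δ) * mass (fun φ => gibbs N β (tilt t k) φ)
        (fields N b ∩ {φ | Cuts b (γ :: l) φ}) ≤
      mass (fun φ => gibbs N β (tilt t k) φ)
        (fields N b ∩ {φ | Cuts b (γ :: l) φ} ∩ {φ | 1 ≤ φ y}) := by
  set M := mass (fun φ => gibbs N β 0 φ) (flat N b γ l)
  set M' := mass (fun φ => gibbs N β 0 φ) (flat N b γ l ∩ {φ | 1 ≤ φ y})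
  have hMfin : M ≠ ⊤ := ne_top_of_le_ne_top hfin (mass_mono _ Set.inter_subset_left)
  have hM0 : M ≠ 0 := by
    obtain ⟨φ, hφ⟩ := flat_nonempty hb hγN hl
    exact mass_ne_zero hφ (gibbs_ne_zero N β 0 φ)
  have h1 : mass (fun φ => gibbs N β 0 φ) (flat N b γ l ∩ {φ | φ y ≤ 0}) ≤
      ENNReal.ofReal δ * M := by
    have hi : ((b + l.length + 1).toNat : ℤ) = b + l.length + 1 := Int.toNat_of_nonneg (by omega)
    refine (mass_flat_le hβ hγ hγN hl hi hy).trans (mul_le_mul_left ?_ _)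
    refine ENNReal.ofReal_le_ofReal (le_trans ?_ hδ)
    refine mul_le_mul_of_nonneg_left (Real.exp_le_exp.2 ?_) (Real.exp_pos _).le
    have h2 : (((b + l.length + 1).toNat : ℕ) : ℝ) = b + l.length + 1 := by exact_mod_cast hi
    rw [h2]
    have h3 : (0 : ℝ) ≤ l.length := by positivity
    nlinarith
  have h2 : M ≤ M' + ENNReal.ofReal δ * M := by
    refine le_trans ?_ (add_le_add_right h1 _)
    refine (mass_le_sum _ (univ : Finset Bool) (fun c => if c then flat N b γ l ∩ {φ | 1 ≤ φ y}
      else flat N b γ l ∩ {φ | φ y ≤ 0}) fun φ hφ => ?_).trans_eq (by simp [M'])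
    by_cases h : 1 ≤ φ y
    · exact ⟨true, mem_univ _, by simpa using ⟨hφ, h⟩⟩
    · exact ⟨false, mem_univ _, by simpa using ⟨hφ, by omega⟩⟩
  have hδ0 : 0 ≤ δ := le_trans (by positivity) hδ
  have h3 : ENNReal.ofReal (1 - δ) * M ≤ M' := by
    rw [ENNReal.ofReal_sub _ hδ0, ENNReal.ofReal_one, ENNReal.sub_mul fun _ _ => hMfin, one_mul]
    exact tsub_le_iff_right.2 h2
  have h4 : M' * mass (fun φ => gibbs N β (tilt t k) φ) (fields N b ∩ {φ | Cuts b (γ :: l) φ}) ≤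
      M * mass (fun φ => gibbs N β (tilt t k) φ)
        (fields N b ∩ {φ | Cuts b (γ :: l) φ} ∩ {φ | 1 ≤ φ y}) := by
    refine mass_mul_mass_le fun φ hφ ψ hψ => ?_
    obtain ⟨h5, h6⟩ := le_of_flat hφ.1 hψ
    refine ⟨h5, ⟨h6, hφ.2.trans (le_sup_left : φ y ≤ φ y ⊔ ψ y)⟩, ?_⟩
    refine gibbs_mul_gibbs_le (by linarith) fun x _ => ?_
    simpa using tilt_mono ht k (le_sup_right : ψ x ≤ φ x ⊔ ψ x)
  rw [← ENNReal.mul_le_mul_iff_right hM0 hMfin]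
  refine le_trans (le_of_eq ?_) ((mul_le_mul_left h3 _).trans h4)
  ring

theorem mass_tilt_ne_top {N : ℕ} {β t : ℝ} (ht : 0 ≤ t) (k : ℤ) {b : ℤ}
    (hfin : mass (fun φ => gibbs N β 0 φ) (fields N b) ≠ ⊤) :
    mass (fun φ => gibbs N β (tilt t k) φ) (fields N b) ≠ ⊤ := by
  refine ne_top_of_le_ne_top (ENNReal.mul_ne_top ENNReal.ofReal_ne_top hfin)
    (mass_le_of_injOn (c := ENNReal.ofReal (Real.exp (∑ x ∈ Lam N, t))) id
      Function.injective_id.injOn (Set.mapsTo_id _) fun φ _ => gibbs_le_mul_gibbs ?_)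
  have h : ∑ x ∈ Lam N, tilt t k (φ x) ≤ ∑ x ∈ Lam N, t := by
    refine sum_le_sum fun x _ => ?_
    unfold tilt
    split_ifs <;> linarith
  simp only [id, Pi.zero_apply, sum_const_zero]
  linarith

theorem pow_mul_mass_cuts_le {N : ℕ} {β : ℝ} (hβ : 0.999 ≤ β) {t : ℝ} (ht : 0 ≤ t) (k : ℤ) {b : ℤ}
    (hb : 0 ≤ b) (hfin : mass (fun φ => gibbs N β 0 φ) (fields N b) ≠ ⊤) {δ : ℝ}
    (hδ : Real.exp (2 * polyConst) * Real.exp (-(4 * β * (b + 1))) ≤ δ) {γ : Finset (ℤ × ℤ)}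
    {l : List (Finset (ℤ × ℤ))} (hγ : IsPoly γ) (hγN : γ ⊆ Lam N) (hl : ∀ γ' ∈ l, γ ⊆ γ')
    {S : Finset (ℤ × ℤ)} (hS : S ⊆ γ) :
    ENNReal.ofReal (1 - δ) ^ S.card * mass (fun φ => gibbs N β (tilt t k) φ)
        (fields N b ∩ {φ | Cuts b (γ :: l) φ}) ≤
      mass (fun φ => gibbs N β (tilt t k) φ)
        (fields N b ∩ {φ | Cuts b (γ :: l) φ} ∩ {φ | ∀ y ∈ S, 1 ≤ φ y}) := by
  set A := fields N b ∩ {φ | Cuts b (γ :: l) φ} with hA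
  set w : (ℤ × ℤ → ℤ) → ENNReal := fun φ => gibbs N β (tilt t k) φ with hw
  have hAfin : mass w A ≠ ⊤ :=
    ne_top_of_le_ne_top (mass_tilt_ne_top ht k hfin) (mass_mono _ Set.inter_subset_left)
  by_cases hA0 : mass w A = 0
  · rw [hA0, mul_zero]
    exact zero_le
  induction S using Finset.induction_on with
  | empty => simp
  | insert y S hyS ih =>
    have h1 := ih ((subset_insert y S).trans hS)
    have h2 := le_mass_cuts_pos hβ ht k hb hfin hδ hγ hγN hl (hS (mem_insert_self y S))
    have h3 : mass w (A ∩ {φ | ∀ y ∈ S, 1 ≤ φ y}) * mass w (A ∩ {φ | 1 ≤ φ y}) ≤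
        mass w A * mass w (A ∩ {φ | ∀ z ∈ insert y S, 1 ≤ φ z}) := by
      refine mass_mul_mass_le fun φ hφ ψ hψ => ⟨⟨fields_inf hφ.1.1 hψ.1.1, hφ.1.2.inf hψ.1.2⟩,
        ⟨⟨fields_sup hφ.1.1 hψ.1.1, hφ.1.2.sup hψ.1.2⟩, fun z hz => ?_⟩, ?_⟩
      · rcases mem_insert.1 hz with rfl | hz
        · exact hψ.2.trans (le_sup_right : ψ z ≤ φ z ⊔ ψ z)
        · exact le_sup_of_le_left (hφ.2 z hz)
      · exact gibbs_mul_gibbs_le (by linarith) fun x _ => tilt_add_tilt t k _ _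
    rw [card_insert_of_notMem hyS, pow_succ, ← ENNReal.mul_le_mul_iff_right hA0 hAfin]
    refine le_trans (le_of_eq ?_) ((mul_le_mul' h1 h2).trans h3)
    ring

/-- The cost of a contour in the tilted field above the wall. -/
theorem mass_cuts_cons_le {N : ℕ} {β : ℝ} (hβ : 0.999 ≤ β) {t : ℝ} (ht : 0 ≤ t) (k : ℤ) {b : ℤ}
    (hb : 0 ≤ b) (hfin : mass (fun φ => gibbs N β 0 φ) (fields N b) ≠ ⊤) {δ ε : ℝ}
    (hδ : Real.exp (2 * polyConst) * Real.exp (-(4 * β * (b + 1))) ≤ δ) (hδ2 : δ ≤ 1 / 2)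
    (hε : (2 * δ + t) * N ≤ 2 * ε) {γ : Finset (ℤ × ℤ)}
    {l : List (Finset (ℤ × ℤ))} (hγ : IsPoly γ) (hγN : γ ⊆ Lam N) (hl : ∀ γ' ∈ l, γ ⊆ γ') :
    mass (fun φ => gibbs N β (tilt t k) φ) (fields N b ∩ {φ | Cuts b (γ :: l) φ}) ≤
      ENNReal.ofReal (Real.exp (-(β - ε) * (bd γ).card)) *
        mass (fun φ => gibbs N β (tilt t k) φ) (fields N b ∩ {φ | Cuts b l φ}) := by
  set w : (ℤ × ℤ → ℤ) → ENNReal := fun φ => gibbs N β (tilt t k) φ with hw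
  have hδ0 : 0 ≤ δ := le_trans (by positivity) hδ
  have h1 := pow_mul_mass_cuts_le hβ ht k hb hfin hδ hγ hγN hl Subset.rfl
  have h2 : mass w (fields N b ∩ {φ | Cuts b (γ :: l) φ} ∩ {φ | ∀ y ∈ γ, 1 ≤ φ y}) ≤
      ENNReal.ofReal (Real.exp (t * γ.card - β * (bd γ).card)) *
        mass w (fields N b ∩ {φ | Cuts b l φ}) := by
    refine mass_le_of_injOn (fun φ => φ - ind γ) (fun a _ b _ h => sub_left_injective h) ?_ ?_
    · rintro φ ⟨⟨⟨h2, h3⟩, h4, h5⟩, h6⟩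
      refine ⟨⟨fun p => ?_, fun p hp => ?_⟩, Cuts.sub_ind hl h4 h5⟩
      · have h7 := h2 p
        have h8 := h6 p
        simp only [Pi.sub_apply, ind]
        split_ifs with h9
        · have := h8 h9
          omega
        · omega
      · have h7 : p ∉ γ := fun h => hp (hγN h)
        simp [ind, h7, h3 p hp]
    · rintro φ ⟨⟨_, h4, _⟩, _⟩
      refine gibbs_le_mul_gibbs ?_
      rw [Ham_sub_ind hγN h4]
      have h5 : ∑ x ∈ Lam N, tilt t k (φ x) ≤
          ∑ x ∈ Lam N, (tilt t k ((φ - ind γ) x) + if x ∈ γ then t else 0) := by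
        refine sum_le_sum fun x _ => ?_
        simp only [Pi.sub_apply, ind, tilt]
        split_ifs <;> linarith
      rw [sum_add_distrib, sum_ite_mem, inter_eq_right.2 hγN, sum_const, nsmul_eq_mul] at h5
      linarith
  have h3 : Real.exp (-(2 * δ)) ≤ 1 - δ := by
    rw [Real.exp_neg]
    refine inv_le_of_inv_le₀ (by linarith) ?_
    refine le_trans ?_ (Real.add_one_le_exp _)
    rw [inv_le_iff_one_le_mul₀ (by linarith)]
    nlinarith
  have h4 : ENNReal.ofReal (Real.exp (-(2 * δ * γ.card))) *
      mass w (fields N b ∩ {φ | Cuts b (γ :: l) φ}) ≤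
      ENNReal.ofReal (Real.exp (t * γ.card - β * (bd γ).card)) *
        mass w (fields N b ∩ {φ | Cuts b l φ}) := by
    refine le_trans (mul_le_mul_left ?_ _) (h1.trans h2)
    rw [← ENNReal.ofReal_pow (by linarith)]
    refine ENNReal.ofReal_le_ofReal ?_
    calc Real.exp (-(2 * δ * γ.card)) = Real.exp (-(2 * δ)) ^ γ.card := by
          rw [← Real.exp_nat_mul]
          ring_nf
      _ ≤ _ := pow_le_pow_left₀ (Real.exp_pos _).le h3 _
  calc mass w (fields N b ∩ {φ | Cuts b (γ :: l) φ})
      = ENNReal.ofReal (Real.exp (2 * δ * γ.card)) * (ENNReal.ofReal (Real.exp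
          (-(2 * δ * γ.card))) * mass w (fields N b ∩ {φ | Cuts b (γ :: l) φ})) := by
        rw [← mul_assoc, ← ENNReal.ofReal_mul (Real.exp_pos _).le, ← Real.exp_add, add_neg_cancel,
          Real.exp_zero, ENNReal.ofReal_one, one_mul]
    _ ≤ ENNReal.ofReal (Real.exp (2 * δ * γ.card)) *
        (ENNReal.ofReal (Real.exp (t * γ.card - β * (bd γ).card)) *
          mass w (fields N b ∩ {φ | Cuts b l φ})) := mul_le_mul_right h4 _
    _ = ENNReal.ofReal (Real.exp (2 * δ * γ.card + (t * γ.card - β * (bd γ).card))) *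
          mass w (fields N b ∩ {φ | Cuts b l φ}) := by
        rw [← mul_assoc, ← ENNReal.ofReal_mul (Real.exp_pos _).le, ← Real.exp_add]
    _ ≤ _ := by
        refine mul_le_mul_left (ENNReal.ofReal_le_ofReal (Real.exp_le_exp.2 ?_)) _
        have h5 : (2 : ℝ) * γ.card ≤ N * (bd γ).card := by exact_mod_cast two_mul_card_le hγN
        have h6 : (0 : ℝ) ≤ (bd γ).card := by positivity
        nlinarith [mul_le_mul_of_nonneg_left h5 (show 0 ≤ 2 * δ + t by linarith),
          mul_le_mul_of_nonneg_right hε h6]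

/-- The height of the tilted field above the wall. -/
theorem mass_tilt_height_le {N : ℕ} {β : ℝ} (hβ : 0.999 ≤ β) {t : ℝ} (ht : 0 ≤ t) (k : ℤ) {b : ℤ}
    (hb : 0 ≤ b) (hfin : mass (fun φ => gibbs N β 0 φ) (fields N b) ≠ ⊤) {δ ε : ℝ}
    (hδ : Real.exp (2 * polyConst) * Real.exp (-(4 * β * (b + 1))) ≤ δ) (hδ2 : δ ≤ 1 / 2)
    (hε : (2 * δ + t) * N ≤ 2 * ε) (hβε : 0.999 ≤ β - ε) (x : ℤ × ℤ) (n : ℕ) :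
    mass (fun φ => gibbs N β (tilt t k) φ) (fields N b ∩ {φ | b + n ≤ φ x}) ≤
      ENNReal.ofReal (Real.exp (2 * polyConst) * Real.exp (-(4 * (β - ε) * n))) *
        mass (fun φ => gibbs N β (tilt t k) φ) (fields N b) :=
  mass_height_le hβε
    (fun _ hφ hx => exists_cuts (coconnected_Lam N) (fun p hp => (hφ.2 p hp).le) n hx)
    fun _ _ hγ hγN hl _ => mass_cuts_cons_le hβ ht k hb hfin hδ hδ2 hε hγ hγN fun γ' h => (hl γ' h).1

/-! ### Comparison with the pinned field -/

/-- Reward `h` for sites of height zero. -/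
def pin (h : ℝ) (v : ℤ) : ℝ := if v = 0 then h else 0

/-- The number of sites of height at least `k`. -/
def cnt (N : ℕ) (k : ℤ) (φ : ℤ × ℤ → ℤ) : ℝ := ((Lam N).filter fun x => k ≤ φ x).card

theorem cnt_eq_sum (N : ℕ) (k : ℤ) (φ : ℤ × ℤ → ℤ) :
    cnt N k φ = ∑ x ∈ Lam N, if k ≤ φ x then 1 else 0 := by
  rw [cnt, sum_boole]

theorem card_Lam (N : ℕ) : ((Lam N).card : ℝ) = (N : ℝ) ^ 2 := by
  simp [Lam, sq]

theorem cnt_nonneg (N : ℕ) (k : ℤ) (φ : ℤ × ℤ → ℤ) : 0 ≤ cnt N k φ := Nat.cast_nonneg _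

theorem cnt_le (N : ℕ) (k : ℤ) (φ : ℤ × ℤ → ℤ) : cnt N k φ ≤ (N : ℝ) ^ 2 := by
  rw [← card_Lam]
  exact Nat.cast_le.2 (card_filter_le _ _)

theorem gibbs_pin_add_tilt (N : ℕ) (β h t : ℝ) (k : ℤ) (φ : ℤ × ℤ → ℤ) :
    (gibbs N β (pin h + tilt t k) φ : ENNReal) =
      ENNReal.ofReal (weight N β h φ * Real.exp (t * cnt N k φ)) := by
  change ENNReal.ofReal _ = _
  rw [weight, ← Real.exp_add]
  have h1 : ∑ x ∈ Lam N, pin h (φ x) = h * (levelSet N φ 0).card := by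
    simp only [pin, levelSet]
    rw [← sum_filter, sum_const, nsmul_eq_mul, mul_comm]
  have h2 : ∑ x ∈ Lam N, tilt t k (φ x) = t * cnt N k φ := by
    simp only [tilt, cnt]
    rw [← sum_filter, sum_const, nsmul_eq_mul, mul_comm]
  simp only [Pi.add_apply, sum_add_distrib, h1, h2, add_assoc]

theorem mass_fields_zero_inter (N : ℕ) (g : (ℤ × ℤ → ℤ) → ℝ) (hg : ∀ φ, 0 ≤ g φ)
    (hs : Summable fun φ : Conf N => g φ.val) (B : Set (ℤ × ℤ → ℤ)) :
    mass (fun φ => ENNReal.ofReal (g φ)) (fields N 0 ∩ B) =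
      ENNReal.ofReal (∑' φ : Conf N, B.indicator g φ.val) := by
  have h0 : ∀ φ : Conf N, 0 ≤ B.indicator g φ.val := fun φ =>
    Set.indicator_nonneg (fun ψ _ => hg ψ) _
  rw [ENNReal.ofReal_tsum_of_nonneg h0
    (hs.of_nonneg_of_le h0 fun φ => Set.indicator_le_self' (fun ψ _ => hg ψ) _)]
  unfold mass
  rw [← Set.indicator_indicator, ← _root_.tsum_subtype]
  refine tsum_congr fun φ : fields N 0 => ?_
  by_cases h : φ.val ∈ B <;> simp [h]

theorem Ham_restrict_le (N : ℕ) {b : ℤ} (hb : 0 ≤ b) {φ : ℤ × ℤ → ℤ} (hφ : φ ∈ fields N b) :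
    Ham N (fun p => if p ∈ Lam N then φ p else 0) ≤
      Ham N φ + ∑ x ∈ Box N, ∑ _y ∈ nbrs x, (b : ℝ) := by
  unfold Ham
  simp only [mul_sum]
  rw [← sum_add_distrib]
  refine sum_le_sum fun x _ => ?_
  rw [← sum_add_distrib]
  refine sum_le_sum fun y _ => ?_
  have h1 : |(if x ∈ Lam N then φ x else 0) - (if y ∈ Lam N then φ y else 0)| ≤
      |φ x - φ y| + 2 * b := by
    have h2 := hφ.2 x
    have h3 := hφ.2 y
    split_ifs with h4 h5 h5
    · omega
    · have := h3 h5
      grind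
    · have := h2 h4
      grind
    · rw [h2 h4, h3 h5]
      simpa using hb
  have h2 : |(((if x ∈ Lam N then φ x else 0 : ℤ) : ℝ)) - ((if y ∈ Lam N then φ y else 0 : ℤ) : ℝ)| ≤
      |(φ x : ℝ) - φ y| + 2 * b := by exact_mod_cast h1
  linarith

theorem mass_fields_ne_top {N : ℕ} {β h : ℝ} (hβ : 0 ≤ β) (hh : 0 ≤ h) {b : ℤ} (hb : 0 ≤ b)
    (hs : Summable fun φ : Conf N => weight N β h φ.val) :
    mass (fun φ => gibbs N β 0 φ) (fields N b) ≠ ⊤ := by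
  have h1 : mass (fun φ => gibbs N β 0 φ) (fields N b) ≤
      ENNReal.ofReal (Real.exp (β * ∑ x ∈ Box N, ∑ _y ∈ nbrs x, (b : ℝ))) *
        mass (fun φ => gibbs N β (pin h + tilt 0 0) φ) (fields N 0) := by
    refine mass_le_of_injOn (fun φ p => if p ∈ Lam N then φ p else 0) ?_ ?_ ?_
    · intro φ hφ ψ hψ hφψ
      ext p
      by_cases hp : p ∈ Lam N
      · simpa [hp] using congrFun hφψ p
      · rw [hφ.2 p hp, hψ.2 p hp]
    · intro φ hφ
      refine ⟨fun p => ?_, fun p hp => by simp [hp]⟩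
      have := hφ.1 p
      dsimp only
      split_ifs <;> omega
    · intro φ hφ
      refine gibbs_le_mul_gibbs ?_
      have h1 := mul_le_mul_of_nonneg_left (Ham_restrict_le N hb hφ) hβ
      have h2 : ∀ v, 0 ≤ (pin h + tilt 0 0) v := by
        intro v
        simp only [Pi.add_apply, pin, tilt]
        split_ifs <;> linarith
      have h3 := sum_nonneg fun x (_ : x ∈ Lam N) =>
        h2 (if x ∈ Lam N then φ x else 0)
      simp only [Pi.zero_apply, sum_const_zero]
      linarith
  refine ne_top_of_le_ne_top (ENNReal.mul_ne_top ENNReal.ofReal_ne_top ?_) h1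
  simp only [gibbs_pin_add_tilt, zero_mul, Real.exp_zero, mul_one]
  have h2 := mass_fields_zero_inter N (weight N β h) (fun φ => (Real.exp_pos _).le) hs Set.univ
  rw [Set.inter_univ] at h2
  rw [h2]
  exact ENNReal.ofReal_ne_top

/-- Raising the boundary height and removing the pinning raises the field. -/
theorem mass_pin_height_le {N : ℕ} {β h t q : ℝ} (hβ : 0 ≤ β) (hh : 0 ≤ h) (ht : 0 ≤ t) {k b : ℤ}
    (hb : 0 ≤ b) (hfin : mass (fun φ => gibbs N β 0 φ) (fields N b) ≠ ⊤) {x : ℤ × ℤ}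
    (hq : mass (fun φ => gibbs N β (tilt t k) φ) (fields N b ∩ {φ | k ≤ φ x}) ≤
      ENNReal.ofReal q * mass (fun φ => gibbs N β (tilt t k) φ) (fields N b)) :
    mass (fun φ => gibbs N β (pin h + tilt t k) φ) (fields N 0 ∩ {φ | k ≤ φ x}) ≤
      ENNReal.ofReal q * mass (fun φ => gibbs N β (pin h + tilt t k) φ) (fields N 0) := by
  have h1 : mass (fun φ => gibbs N β (pin h + tilt t k) φ) (fields N 0 ∩ {φ | k ≤ φ x}) *
      mass (fun φ => gibbs N β (tilt t k) φ) (fields N b) ≤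
      mass (fun φ => gibbs N β (pin h + tilt t k) φ) (fields N 0) *
        mass (fun φ => gibbs N β (tilt t k) φ) (fields N b ∩ {φ | k ≤ φ x}) := by
    refine mass_mul_mass_le fun φ hφ ψ hψ => ⟨⟨fun p => le_inf (hφ.1.1 p) (hψ.1 p), fun p hp => ?_⟩,
      ⟨⟨fun p => le_sup_of_le_left (hφ.1.1 p), fun p hp => ?_⟩,
        le_trans hφ.2 (le_sup_left : φ x ≤ φ x ⊔ ψ x)⟩, ?_⟩
    · simp [hφ.1.2 p hp, hψ.2 p hp, hb]
    · simp [hφ.1.2 p hp, hψ.2 p hp, hb]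
    · refine gibbs_mul_gibbs_le hβ fun y _ => ?_
      have h2 := tilt_add_tilt t k (φ y) (ψ y)
      have h3 : pin h (φ y) ≤ pin h (φ y ⊓ ψ y) := by
        have h4 := hφ.1.1 y
        have h5 := hψ.1 y
        unfold pin
        split_ifs with h6 h7
        · exact le_rfl
        · omega
        · exact hh
        · exact le_rfl
      simp only [Pi.add_apply]
      linarith
  have hfin2 := mass_tilt_ne_top ht k hfin
  have h0 : mass (fun φ => gibbs N β (tilt t k) φ) (fields N b) ≠ 0 :=
    mass_ne_zero (φ := fun _ => b) ⟨fun _ => hb, fun _ _ => rfl⟩ (gibbs_ne_zero _ _ _ _)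
  rw [← ENNReal.mul_le_mul_iff_left h0 hfin2]
  refine h1.trans ((mul_le_mul_right hq _).trans_eq ?_)
  ring

/-- A tilted first moment bound yields an exponential tail bound. -/
theorem tsum_le_exp_mul_tsum {ι : Type*} {f A : ι → ℝ} (hf0 : ∀ i, 0 ≤ f i) (hf : Summable f)
    (hA0 : ∀ i, 0 ≤ A i) {M : ℝ} (hAM : ∀ i, A i ≤ M) {t s : ℝ} (ht : 0 ≤ t)
    (h : ∑' i, f i * Real.exp (t * A i) * A i ≤ s / 2 * ∑' i, f i * Real.exp (t * A i)) :
    (∑' i, if s < A i then f i else 0) ≤ Real.exp (-(t * s / 2)) * ∑' i, f i := by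
  set g : ι → ℝ := fun i => f i * Real.exp (t * A i) with hg
  have hg0 : ∀ i, 0 ≤ g i := fun i => mul_nonneg (hf0 i) (Real.exp_pos _).le
  have hgs : Summable g := by
    refine (hf.mul_right (Real.exp (t * M))).of_nonneg_of_le hg0 fun i => ?_
    exact mul_le_mul_of_nonneg_left
      (Real.exp_le_exp.2 (mul_le_mul_of_nonneg_left (hAM i) ht)) (hf0 i)
  have hgA : Summable fun i => g i * A i :=
    (hgs.mul_right M).of_nonneg_of_le (fun i => mul_nonneg (hg0 i) (hA0 i))
      fun i => mul_le_mul_of_nonneg_left (hAM i) (hg0 i)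
  have hfg : ∀ i, f i = g i * Real.exp (-(t * A i)) := fun i => by
    rw [hg, mul_assoc, ← Real.exp_add, add_neg_cancel, Real.exp_zero, mul_one]
  have h1 : (∑' i, if s < A i then f i else 0) ≤ Real.exp (-(t * s)) * ∑' i, g i := by
    rw [← tsum_mul_left]
    have h2 : ∀ i, (if s < A i then f i else 0) ≤ Real.exp (-(t * s)) * g i := by
      intro i
      split_ifs with hi
      · rw [hfg i, mul_comm]
        refine mul_le_mul_of_nonneg_right (Real.exp_le_exp.2 ?_) (hg0 i)
        nlinarith
      · exact mul_nonneg (Real.exp_pos _).le (hg0 i)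
    refine Summable.tsum_le_tsum h2 (hf.of_nonneg_of_le (fun i => ?_) fun i => ?_)
      (hgs.mul_left _)
    · split_ifs
      · exact hf0 i
      · exact le_rfl
    · split_ifs
      · exact le_rfl
      · exact hf0 i
  have h2 : ∑' i, g i ≤ Real.exp (t * s / 2) * ∑' i, f i := by
    have h3 : ∀ i, g i * (1 + t * s / 2) - t * (g i * A i) ≤ Real.exp (t * s / 2) * f i := by
      intro i
      rw [hfg i, mul_left_comm (Real.exp _), ← Real.exp_add]
      have h4 := Real.add_one_le_exp (t * s / 2 + -(t * A i))
      nlinarith [mul_le_mul_of_nonneg_left h4 (hg0 i)]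
    have h5 := Summable.tsum_le_tsum h3 ((hgs.mul_right _).sub (hgA.mul_left t)) (hf.mul_left _)
    rw [Summable.tsum_sub (hgs.mul_right _) (hgA.mul_left t), tsum_mul_left, tsum_mul_left,
      tsum_mul_right] at h5
    nlinarith [mul_le_mul_of_nonneg_left h ht]
  refine h1.trans ((mul_le_mul_of_nonneg_left h2 (Real.exp_pos _).le).trans_eq ?_)
  rw [← mul_assoc, ← Real.exp_add]
  ring_nf

theorem prob_cnt_le {N : ℕ} {β h t a : ℝ} (ht : 0 ≤ t) (ha : 0 ≤ a) {k : ℤ}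
    (hm : (Summable fun φ : Conf N => weight N β h φ.val) → ∀ x ∈ Lam N,
      mass (fun φ => gibbs N β (pin h + tilt t k) φ) (fields N 0 ∩ {φ | k ≤ φ x}) ≤
        ENNReal.ofReal (a / 2) * mass (fun φ => gibbs N β (pin h + tilt t k) φ) (fields N 0)) :
    prob N β h {φ : Conf N | a * (N : ℝ) ^ 2 < cnt N k φ.val} ≤
      Real.exp (-(t * (a * (N : ℝ) ^ 2) / 2)) := by
  unfold prob Z
  by_cases hs : Summable fun φ : Conf N => weight N β h φ.val
  swap
  · rw [tsum_eq_zero_of_not_summable hs, div_zero]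
    exact (Real.exp_pos _).le
  have hw0 : ∀ φ, 0 ≤ weight N β h φ := fun φ => (Real.exp_pos _).le
  refine div_le_of_le_mul₀ (tsum_nonneg fun φ => hw0 _) (Real.exp_pos _).le ?_
  refine tsum_le_exp_mul_tsum (fun φ => hw0 _) hs (A := fun φ : Conf N => cnt N k φ.val)
    (fun φ => cnt_nonneg _ _ _) (fun φ => cnt_le _ _ _) ht ?_
  set g : (ℤ × ℤ → ℤ) → ℝ := fun φ => weight N β h φ * Real.exp (t * cnt N k φ) with hg
  have hg0 : ∀ φ, 0 ≤ g φ := fun φ => mul_nonneg (hw0 φ) (Real.exp_pos _).le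
  have hgs : Summable fun φ : Conf N => g φ.val := by
    refine (hs.mul_right (Real.exp (t * (N : ℝ) ^ 2))).of_nonneg_of_le (fun φ => hg0 _) fun φ => ?_
    exact mul_le_mul_of_nonneg_left
      (Real.exp_le_exp.2 (mul_le_mul_of_nonneg_left (cnt_le _ _ _) ht)) (hw0 _)
  have hind : ∀ x, Summable fun φ : Conf N => {φ : ℤ × ℤ → ℤ | k ≤ φ x}.indicator g φ.val :=
    fun x => hgs.of_nonneg_of_le (fun φ => Set.indicator_nonneg (fun ψ _ => hg0 ψ) _)
      fun φ => Set.indicator_le_self' (fun ψ _ => hg0 ψ) _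
  have h1 : ∀ x ∈ Lam N, ∑' φ : Conf N, {φ : ℤ × ℤ → ℤ | k ≤ φ x}.indicator g φ.val ≤
      a / 2 * ∑' φ : Conf N, g φ.val := by
    intro x hx
    have h2 := hm hs x hx
    have h3 := mass_fields_zero_inter N g hg0 hgs Set.univ
    simp only [gibbs_pin_add_tilt] at h2
    rw [mass_fields_zero_inter N g hg0 hgs] at h2
    simp only [Set.inter_univ, Set.indicator_univ] at h3
    rw [h3, ← ENNReal.ofReal_mul (by linarith)] at h2
    refine (ENNReal.ofReal_le_ofReal_iff ?_).1 h2
    exact mul_nonneg (by linarith) (tsum_nonneg fun φ => hg0 _)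
  calc ∑' φ : Conf N, g φ.val * cnt N k φ.val
      = ∑' φ : Conf N, ∑ x ∈ Lam N, {φ : ℤ × ℤ → ℤ | k ≤ φ x}.indicator g φ.val := by
        refine tsum_congr fun φ => ?_
        rw [cnt_eq_sum, mul_sum]
        refine sum_congr rfl fun x _ => ?_
        simp [Set.indicator_apply]
    _ = ∑ x ∈ Lam N, ∑' φ : Conf N, {φ : ℤ × ℤ → ℤ | k ≤ φ x}.indicator g φ.val :=
        Summable.tsum_finsetSum fun x _ => hind x
    _ ≤ ∑ x ∈ Lam N, a / 2 * ∑' φ : Conf N, g φ.val := sum_le_sum h1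
    _ = a * (N : ℝ) ^ 2 / 2 * ∑' φ : Conf N, g φ.val := by
        rw [sum_const, nsmul_eq_mul, card_Lam]
        ring

/-- The level at which the wall stops being felt, above `⌊log N / (4β)⌋`. -/
def wallGap : ℕ := ⌈2 * polyConst⌉₊ + 8

theorem mass_pin_height_le_exp {N : ℕ} (hN : 1 ≤ N) {β h : ℝ} (hβ : 1 ≤ β) (hh : 0 ≤ h) {m : ℤ}
    (hm : (4 * wallGap + 1 : ℝ) ≤ m) (hs : Summable fun φ : Conf N => weight N β h φ.val)
    (x : ℤ × ℤ) :
    mass (fun φ => gibbs N β (pin h + tilt (0.001 / N) (⌊Real.log N / (4 * β)⌋ + m)) φ)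
        (fields N 0 ∩ {φ | ⌊Real.log N / (4 * β)⌋ + m ≤ φ x}) ≤
      ENNReal.ofReal (Real.exp (-2 * β * m) / 2) *
        mass (fun φ => gibbs N β (pin h + tilt (0.001 / N) (⌊Real.log N / (4 * β)⌋ + m)) φ)
          (fields N 0) := by
  have hN' : (1 : ℝ) ≤ N := by exact_mod_cast hN
  set H := ⌊Real.log N / (4 * β)⌋ with hH
  have hH0 : 0 ≤ H := Int.floor_nonneg.2 (div_nonneg (Real.log_nonneg hN') (by linarith))
  have hgap : 2 * polyConst + 8 ≤ (wallGap : ℝ) := by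
    have := Nat.le_ceil (2 * polyConst)
    simp only [wallGap]
    push_cast
    linarith
  have hgap8 : (8 : ℝ) ≤ wallGap := by
    have : 8 ≤ wallGap := Nat.le_add_left _ _
    exact_mod_cast this
  have hb : 0 ≤ H + wallGap := by omega
  have ht : (0 : ℝ) ≤ 0.001 / N := by positivity
  have hfin := mass_fields_ne_top (by linarith) hh hb hs
  obtain ⟨n, hn⟩ : ∃ n : ℕ, (n : ℤ) = m - wallGap := by
    have h1 : (4 * wallGap + 1 : ℤ) ≤ m := by exact_mod_cast hm
    exact ⟨(m - wallGap).toNat, Int.toNat_of_nonneg (by omega)⟩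
  have hn' : (n : ℝ) = m - wallGap := by exact_mod_cast hn
  have hk : H + m = H + wallGap + n := by omega
  set δ := Real.exp (2 * polyConst) * Real.exp (-(4 * β * (((H + wallGap : ℤ) : ℝ) + 1))) with hδ
  have hδN : δ * N ≤ 0.0005 := by
    have h1 : Real.log N < 4 * β * (H + 1) := by
      have := Int.lt_floor_add_one (Real.log N / (4 * β))
      rw [div_lt_iff₀ (by linarith)] at this
      linarith
    have h2 : Real.exp (-8) ≤ 0.0005 := by
      have h3 : (2.7 : ℝ) ^ 8 ≤ Real.exp 8 := by
        calc (2.7 : ℝ) ^ 8 ≤ Real.exp 1 ^ 8 :=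
              pow_le_pow_left₀ (by norm_num) (by linarith [Real.exp_one_gt_d9]) 8
          _ = Real.exp 8 := by
              rw [← Real.exp_nat_mul]
              norm_num
      rw [Real.exp_neg]
      refine inv_le_of_inv_le₀ (by norm_num) (le_trans ?_ h3)
      norm_num
    calc δ * N = Real.exp (2 * polyConst + -(4 * β * (((H + wallGap : ℤ) : ℝ) + 1)) +
          Real.log N) := by
          rw [Real.exp_add, Real.exp_add, Real.exp_log (by linarith)]
      _ ≤ Real.exp (-8) := by
          refine Real.exp_le_exp.2 ?_
          push_cast
          nlinarith
      _ ≤ _ := h2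
  have hδ0 : 0 ≤ δ := by positivity
  have htN : 0.001 / (N : ℝ) * N = 0.001 := div_mul_cancel₀ _ (by linarith)
  have h1 := mass_tilt_height_le (N := N) (by linarith) ht (H + m) hb hfin (ε := 0.001) hδ.ge
    (by nlinarith) (by linarith) (by linarith) x n
  rw [← hk] at h1
  refine mass_pin_height_le (by linarith) hh ht hb hfin
    (h1.trans (mul_le_mul_left (ENNReal.ofReal_le_ofReal ?_) _))
  have h2 : (2 : ℝ) ≤ Real.exp 1 := by linarith [Real.exp_one_gt_d9]
  rw [le_div_iff₀ (by norm_num)]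
  calc Real.exp (2 * polyConst) * Real.exp (-(4 * (β - 0.001) * n)) * 2
      ≤ Real.exp (2 * polyConst) * Real.exp (-(4 * (β - 0.001) * n)) * Real.exp 1 :=
        mul_le_mul_of_nonneg_left h2 (by positivity)
    _ = Real.exp (2 * polyConst + -(4 * (β - 0.001) * n) + 1) := by
        rw [Real.exp_add, Real.exp_add]
    _ ≤ _ := by
        refine Real.exp_le_exp.2 ?_
        rw [hn']
        nlinarith [mul_nonneg (show 0 ≤ β - 1 by linarith) (show (0 : ℝ) ≤ m - 2 * wallGap by linarith)]

end SOS

/-- Theorem 1.2-(i): upward fluctuations in the subcritical regime `0 < h < h_w(β)`. -/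
theorem upward_fluctuations_subcritical :
    ∃ C K : ℝ, 0 < C ∧ 0 < K ∧
      ∀ (β h : ℝ) (m : ℤ) (N : ℕ), 1 ≤ β → 0 < h → h < hw β → K ≤ (m : ℝ) → 1 ≤ N →
        prob N β h
            {φ : Conf N |
              (((Lam N).filter fun x =>
                  ⌊Real.log (N:ℝ) / (4*β)⌋ + m ≤ φ.val x).card : ℝ) >
                Real.exp (-2*β*(m:ℝ)) * (N:ℝ)^2} ≤
          Real.exp (-(C * Real.exp (-2*β*(m:ℝ)) * (N:ℝ) *
            min 1 (Real.exp (-2*β*(m:ℝ)) * (N:ℝ) * ((Real.log (N:ℝ))^8)⁻¹))) := by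
  refine ⟨0.0005, 4 * SOS.wallGap + 1, by norm_num, by positivity, ?_⟩
  intro β h m N hβ hh _ hm hN
  have hN' : (1 : ℝ) ≤ N := by exact_mod_cast hN
  refine (SOS.prob_cnt_le (t := 0.001 / N) (by positivity) (Real.exp_pos _).le fun hs x _ =>
    SOS.mass_pin_height_le_exp hN hβ hh.le hm hs x).trans (Real.exp_le_exp.2 (neg_le_neg ?_))
  have h1 : 0.001 / (N : ℝ) * (Real.exp (-2 * β * m) * (N : ℝ) ^ 2) / 2 =
      0.0005 * Real.exp (-2 * β * m) * N := by
    field_simp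
    norm_num
  rw [h1]
  exact mul_le_of_le_one_right (by positivity) (min_le_left _ _)
end
end

section
/- For every real β ≥ 1, every real h with 0 < h < h_w(β) = log(e^{4β}/(e^{4β}−1)), every real δ > 0, every positive integer m and every integer N ≥ 1, letting H = ⌊(4β)^{−1} log N⌋ and κ = (4β + δ)/log(e^{−h} + e^{−4β}), one has P_N^{β,h}( {φ ∈ Ω_N : |{x ∈ Λ_N : φ(x) ≤ H − m}| > 2 e^{−2βm} N²} ) ≤ 3 exp( − min( (1/2) e^{2βm} − 4β(1+κ), δ ) · N ). -/
open Real Finset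
open scoped Classical

noncomputable section

/-- A one-to-many comparison: if every configuration of `E` is sent injectively to a family of
configurations indexed by the subsets of a finite set, and the total weight of the family is large,
then `E` has small total weight. -/
theorem tsum_indicator_le_of_injective_family {Ω ι : Type*} {w : Ω → ℝ} (hs : Summable w)
    (hw : ∀ φ, 0 ≤ w φ) (E : Set Ω) (L : Ω → Finset ι) (T : Ω → Finset ι → Ω)
    (hT : ∀ φ ∈ E, ∀ A ⊆ L φ, ∀ φ' ∈ E, ∀ A' ⊆ L φ', T φ A = T φ' A' → φ = φ' ∧ A = A')
    (c a b K : ℝ) (hK : 0 ≤ K)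
    (hle : ∀ φ ∈ E, ∀ A ⊆ L φ, c * (a ^ #A * b ^ (#(L φ) - #A)) * w φ ≤ w (T φ A))
    (hE : ∀ φ ∈ E, 1 ≤ K * (c * (a + b) ^ #(L φ))) :
    (∑' φ, if φ ∈ E then w φ else 0) ≤ K * ∑' φ, w φ := by
  refine Real.tsum_le_of_sum_le (fun φ => by split_ifs <;> simp [hw]) fun F => ?_
  rw [← Finset.sum_filter]
  set G := F.filter (· ∈ E)
  have hG : ∀ φ ∈ G, φ ∈ E := fun φ h => (Finset.mem_filter.1 h).2
  have hinj : Set.InjOn (fun p : (_ : Ω) × Finset ι => T p.1 p.2)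
      (G.sigma fun φ => (L φ).powerset : Finset _) := by
    rintro ⟨φ, A⟩ h ⟨φ', A'⟩ h' heq
    simp only [Finset.coe_sigma, Set.mem_sigma_iff, Finset.mem_coe, Finset.mem_powerset] at h h'
    obtain ⟨rfl, rfl⟩ := hT φ (hG _ h.1) A h.2 φ' (hG _ h'.1) A' h'.2 heq
    rfl
  calc ∑ φ ∈ G, w φ ≤ ∑ φ ∈ G, K * (c * (a + b) ^ #(L φ)) * w φ :=
        Finset.sum_le_sum fun φ h => le_mul_of_one_le_left (hw φ) (hE φ (hG φ h))
    _ = K * ∑ φ ∈ G, ∑ A ∈ (L φ).powerset, c * (a ^ #A * b ^ (#(L φ) - #A)) * w φ := by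
        rw [Finset.mul_sum]
        refine Finset.sum_congr rfl fun φ _ => ?_
        rw [← Finset.sum_pow_mul_eq_add_pow, ← Finset.sum_mul, ← Finset.mul_sum, mul_assoc]
    _ ≤ K * ∑ φ ∈ G, ∑ A ∈ (L φ).powerset, w (T φ A) := by
        refine mul_le_mul_of_nonneg_left (Finset.sum_le_sum fun φ h =>
          Finset.sum_le_sum fun A hA => hle φ (hG φ h) A (Finset.mem_powerset.1 hA)) hK
    _ = K * ∑ ψ ∈ (G.sigma fun φ => (L φ).powerset).image
          (fun p : (_ : Ω) × Finset ι => T p.1 p.2), w ψ := by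
        rw [Finset.sum_image hinj, Finset.sum_sigma]
    _ ≤ K * ∑' φ, w φ :=
        mul_le_mul_of_nonneg_left (hs.sum_le_tsum _ fun φ _ => hw φ) hK

theorem sum_Ico_le_two_mul_of_halving {f : ℕ → ℝ} (h0 : ∀ i, 0 ≤ f i)
    (hf : ∀ i, 2 * f (i + 1) ≤ f i) (m n : ℕ) : ∑ i ∈ Finset.Ico m n, f i ≤ 2 * f m := by
  rcases le_total n m with h | h
  · rw [Finset.Ico_eq_empty_of_le h, Finset.sum_empty]
    linarith [h0 m]
  · suffices ∑ i ∈ Finset.Ico m n, f i ≤ 2 * f m - 2 * f n by linarith [h0 n]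
    induction n, h using Nat.le_induction with
    | base => simp
    | succ n hn ih =>
      rw [Finset.sum_Ico_succ_top hn]
      linarith [hf n]

theorem exp_half_le_one_add {a : ℝ} (h0 : 0 ≤ a) (h1 : a ≤ 1) : Real.exp (a / 2) ≤ 1 + a := by
  have h := Real.add_one_le_exp (-(a / 2))
  have hm : Real.exp (a / 2) * Real.exp (-(a / 2)) = 1 := by rw [← Real.exp_add]; simp
  have : 1 ≤ (1 + a) * Real.exp (-(a / 2)) := by nlinarith
  have hp := Real.exp_pos (a / 2)
  nlinarith

theorem mem_Lam {N : ℕ} {x : ℤ × ℤ} :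
    x ∈ Lam N ↔ (1 ≤ x.1 ∧ x.1 ≤ N) ∧ 1 ≤ x.2 ∧ x.2 ≤ N := by
  simp [Lam]

theorem mem_Box {N : ℕ} {x : ℤ × ℤ} :
    x ∈ Box N ↔ (0 ≤ x.1 ∧ x.1 ≤ N + 1) ∧ 0 ≤ x.2 ∧ x.2 ≤ N + 1 := by
  simp [Box]

theorem mem_levelSet {N : ℕ} {φ : ℤ × ℤ → ℤ} {k : ℤ} {x : ℤ × ℤ} :
    x ∈ levelSet N φ k ↔ x ∈ Lam N ∧ φ x = k := by
  simp [levelSet]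

theorem sum_nbrs (f : ℤ × ℤ → ℝ) (x : ℤ × ℤ) :
    ∑ y ∈ nbrs x, f y =
      f (x + (1, 0)) + f (x + (-1, 0)) + f (x + (0, 1)) + f (x + (0, -1)) := by
  obtain ⟨a, b⟩ := x
  rw [nbrs, Finset.sum_insert, Finset.sum_insert, Finset.sum_insert, Finset.sum_singleton]
  · simp [sub_eq_add_neg, add_assoc]
  all_goals simp
  all_goals omega

theorem sum_Box_shift_le {N : ℕ} {g : ℤ × ℤ → ℝ} (hg : ∀ x, 0 ≤ g x)
    (hL : ∀ x ∉ Lam N, g x = 0) (e : ℤ × ℤ) :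
    ∑ x ∈ Box N, g (x + e) ≤ ∑ x ∈ Lam N, g x := by
  rw [← Finset.sum_image (g := fun x => x + e) (f := g) fun x _ y _ h => add_right_cancel h,
    ← Finset.sum_filter_of_ne (p := (· ∈ Lam N)) fun x _ hx => not_imp_comm.1 (hL x) hx]
  exact Finset.sum_le_sum_of_subset_of_nonneg (fun x hx => (Finset.mem_filter.1 hx).2)
    fun x _ _ => hg x

/-- The indicator that exactly one of two sites lies in `Λ_N`. -/
def crossing (N : ℕ) (x y : ℤ × ℤ) : ℝ := if (x ∈ Lam N ↔ y ∈ Lam N) then 0 else 1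

theorem sum_crossing_le {N : ℕ} {e : ℤ × ℤ}
    (he : e = (1, 0) ∨ e = (-1, 0) ∨ e = (0, 1) ∨ e = (0, -1)) :
    ∑ x ∈ Box N, crossing N x (x + e) ≤ 2 * N := by
  have key : ∀ S : Finset (ℤ × ℤ), #S ≤ 2 * N →
      (∀ x, ¬ (x ∈ Lam N ↔ x + e ∈ Lam N) → x ∈ S) →
      ∑ x ∈ Box N, crossing N x (x + e) ≤ 2 * N := by
    intro S hS hsub
    calc ∑ x ∈ Box N, crossing N x (x + e)
        = (#((Box N).filter fun x => ¬ (x ∈ Lam N ↔ x + e ∈ Lam N)) : ℝ) := by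
          rw [Finset.card_filter, Nat.cast_sum]
          refine Finset.sum_congr rfl fun x _ => ?_
          by_cases h : (x ∈ Lam N ↔ x + e ∈ Lam N) <;> simp [crossing, h]
      _ ≤ (#S : ℝ) := by
          exact_mod_cast Finset.card_le_card fun x hx => hsub x (Finset.mem_filter.1 hx).2
      _ ≤ 2 * N := by exact_mod_cast hS
  have hcard : ∀ p q : ℤ, #(({p, q} : Finset ℤ) ×ˢ Finset.Icc (1 : ℤ) N) ≤ 2 * N ∧
      #(Finset.Icc (1 : ℤ) N ×ˢ ({p, q} : Finset ℤ)) ≤ 2 * N := by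
    intro p q
    have := Finset.card_le_two (a := p) (b := q)
    simp only [Finset.card_product, Int.card_Icc, add_sub_cancel_right, Int.toNat_natCast]
    constructor <;> nlinarith
  rcases he with rfl | rfl | rfl | rfl
  · refine key _ (hcard 0 N).1 fun x hx => ?_
    simp [mem_Lam] at hx ⊢
    omega
  · refine key _ (hcard 1 (N + 1)).1 fun x hx => ?_
    simp [mem_Lam] at hx ⊢
    omega
  · refine key _ (hcard 0 N).2 fun x hx => ?_
    simp [mem_Lam] at hx ⊢
    omega
  · refine key _ (hcard 1 (N + 1)).2 fun x hx => ?_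
    simp [mem_Lam] at hx ⊢
    omega

theorem Ham_le_of_edge_le {N : ℕ} {φ ψ g : ℤ × ℤ → ℤ} (hg : ∀ x, 0 ≤ g x)
    (hL : ∀ x ∉ Lam N, g x = 0)
    (h : ∀ x y, |ψ x - ψ y| ≤
      |φ x - φ y| + g x + g y + if (x ∈ Lam N ↔ y ∈ Lam N) then 0 else 1) :
    Ham N ψ ≤ Ham N φ + 4 * ((∑ x ∈ Lam N, g x : ℤ) : ℝ) + 4 * N := by
  have hg : ∀ x, (0 : ℝ) ≤ g x := fun x => by exact_mod_cast hg x
  have hL : ∀ x ∉ Lam N, (g x : ℝ) = 0 := fun x hx => by exact_mod_cast hL x hx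
  have h : ∀ x y, |(ψ x : ℝ) - ψ y| ≤ |(φ x : ℝ) - φ y| + g x + g y + crossing N x y :=
    fun x y => by
      have := h x y
      rw [← @Int.cast_le ℝ] at this
      simpa [crossing] using this
  rw [Int.cast_sum]
  have hsum : ∑ x ∈ Box N, ∑ y ∈ nbrs x, |(ψ x : ℝ) - ψ y| ≤
      ∑ x ∈ Box N, ∑ y ∈ nbrs x, (|(φ x : ℝ) - φ y| + g x + g y + crossing N x y) :=
    Finset.sum_le_sum fun x _ => Finset.sum_le_sum fun y _ => h x y
  have hself : ∑ x ∈ Box N, (g x : ℝ) ≤ ∑ x ∈ Lam N, (g x : ℝ) := by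
    simpa using sum_Box_shift_le hg hL 0
  have h1 := sum_Box_shift_le hg hL (1, 0)
  have h2 := sum_Box_shift_le hg hL (-1, 0)
  have h3 := sum_Box_shift_le hg hL (0, 1)
  have h4 := sum_Box_shift_le hg hL (0, -1)
  have c1 := sum_crossing_le (N := N) (e := (1, 0)) (by simp)
  have c2 := sum_crossing_le (N := N) (e := (-1, 0)) (by simp)
  have c3 := sum_crossing_le (N := N) (e := (0, 1)) (by simp)
  have c4 := sum_crossing_le (N := N) (e := (0, -1)) (by simp)
  unfold Ham
  simp only [sum_nbrs, Finset.sum_add_distrib] at hsum ⊢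
  linarith

/-- Extension by zero of a nonnegative field outside `Λ_N`. -/
def Conf.ofFun (N : ℕ) (g : ℤ × ℤ → ℤ) (hg : ∀ x, 0 ≤ g x) : Conf N :=
  ⟨fun x => if x ∈ Lam N then g x else 0, fun x => by dsimp only; split_ifs <;> simp [hg],
    fun x hx => by simp [hx]⟩

/-- Raise the field by one, except on `A` where it is set to `0`. -/
def liftPin {N : ℕ} (φ : Conf N) (A : Finset (ℤ × ℤ)) : Conf N :=
  Conf.ofFun N (fun x => if x ∈ A then 0 else φ.val x + 1) fun x => by
    have := φ.2.1 x
    split_ifs <;> omega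

/-- Raise the positive part of the field by one, except on `A` where it is set to `1`. -/
def liftSpike {N : ℕ} (φ : Conf N) (A : Finset (ℤ × ℤ)) : Conf N :=
  Conf.ofFun N (fun x => if φ.val x = 0 then 0 else if x ∈ A then 1 else φ.val x + 1) fun x => by
    have := φ.2.1 x
    split_ifs <;> omega

theorem liftPin_val {N : ℕ} (φ : Conf N) (A : Finset (ℤ × ℤ)) (x : ℤ × ℤ) :
    (liftPin φ A).val x = if x ∈ Lam N then if x ∈ A then 0 else φ.val x + 1 else 0 := rfl

theorem liftSpike_val {N : ℕ} (φ : Conf N) (A : Finset (ℤ × ℤ)) (x : ℤ × ℤ) :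
    (liftSpike φ A).val x = if x ∈ Lam N then
      if φ.val x = 0 then 0 else if x ∈ A then 1 else φ.val x + 1 else 0 := rfl

theorem liftPin_injective {N : ℕ} {φ φ' : Conf N} {A A' : Finset (ℤ × ℤ)}
    (hA : A ⊆ levelSet N φ.val 0) (hA' : A' ⊆ levelSet N φ'.val 0)
    (h : liftPin φ A = liftPin φ' A') : φ = φ' ∧ A = A' := by
  have hx : ∀ x, φ.val x = φ'.val x ∧ (x ∈ A ↔ x ∈ A') := by
    intro x
    have e : (liftPin φ A).val x = (liftPin φ' A').val x := by rw [h]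
    have a := fun hx => mem_levelSet.1 (@hA x hx)
    have a' := fun hx => mem_levelSet.1 (@hA' x hx)
    have p := φ.2.1 x
    have p' := φ'.2.1 x
    have o := φ.2.2 x
    have o' := φ'.2.2 x
    rw [liftPin_val, liftPin_val] at e
    clear h hA hA'
    by_cases h3 : x ∈ Lam N
    · by_cases h1 : x ∈ A <;> by_cases h2 : x ∈ A' <;>
        simp only [h1, h2, h3, forall_const, if_true, if_false, true_and, and_true, iff_true,
          iff_false, not_true_eq_false] at e a a' ⊢ <;> omega
    · exact ⟨(o h3).trans (o' h3).symm, fun t => absurd (a t).1 h3, fun t => absurd (a' t).1 h3⟩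
  exact ⟨Subtype.ext (funext fun x => (hx x).1), Finset.ext fun x => (hx x).2⟩

theorem liftSpike_injective {N : ℕ} {j : ℤ} (hj : 1 ≤ j) {φ φ' : Conf N} {A A' : Finset (ℤ × ℤ)}
    (hA : A ⊆ levelSet N φ.val j) (hA' : A' ⊆ levelSet N φ'.val j)
    (h : liftSpike φ A = liftSpike φ' A') : φ = φ' ∧ A = A' := by
  have hx : ∀ x, φ.val x = φ'.val x ∧ (x ∈ A ↔ x ∈ A') := by
    intro x
    have e : (liftSpike φ A).val x = (liftSpike φ' A').val x := by rw [h]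
    have a := fun hx => mem_levelSet.1 (@hA x hx)
    have a' := fun hx => mem_levelSet.1 (@hA' x hx)
    have p := φ.2.1 x
    have p' := φ'.2.1 x
    have o := φ.2.2 x
    have o' := φ'.2.2 x
    rw [liftSpike_val, liftSpike_val] at e
    clear h hA hA'
    by_cases h3 : x ∈ Lam N
    · by_cases h1 : x ∈ A <;> by_cases h2 : x ∈ A' <;>
        simp only [h1, h2, h3, forall_const, if_true, if_false, true_and, and_true, iff_true,
          iff_false, not_true_eq_false] at e a a' ⊢ <;> split_ifs at e <;> omega
    · exact ⟨(o h3).trans (o' h3).symm, fun t => absurd (a t).1 h3, fun t => absurd (a' t).1 h3⟩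
  exact ⟨Subtype.ext (funext fun x => (hx x).1), Finset.ext fun x => (hx x).2⟩

theorem sum_Lam_indicator {N : ℕ} {A : Finset (ℤ × ℤ)} (hA : A ⊆ Lam N) (c : ℤ) :
    ∑ x ∈ Lam N, (if x ∈ A then c else 0) = c * #A := by
  rw [Finset.sum_ite_mem, Finset.inter_eq_right.2 hA, Finset.sum_const, nsmul_eq_mul, mul_comm]

theorem levelSet_subset (N : ℕ) (φ : ℤ × ℤ → ℤ) (k : ℤ) : levelSet N φ k ⊆ Lam N :=
  Finset.filter_subset _ _

theorem Ham_liftPin_le {N : ℕ} {φ : Conf N} {A : Finset (ℤ × ℤ)}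
    (hA : A ⊆ levelSet N φ.val 0) :
    Ham N (liftPin φ A).val ≤ Ham N φ.val + 4 * #A + 4 * N := by
  have hAL := hA.trans (levelSet_subset _ _ _)
  have := Ham_le_of_edge_le (N := N) (φ := φ.val) (ψ := (liftPin φ A).val)
    (g := fun x => if x ∈ A then 1 else 0) (fun x => by positivity)
    (fun x hx => if_neg fun h => hx (hAL h)) fun x y => ?_
  · rw [sum_Lam_indicator hAL, one_mul] at this
    exact_mod_cast this
  · have ax := fun h => (mem_levelSet.1 (@hA x h))
    have ay := fun h => (mem_levelSet.1 (@hA y h))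
    have px := φ.2.1 x
    have py := φ.2.1 y
    have ox := φ.2.2 x
    have oy := φ.2.2 y
    have hd := le_abs_self (φ.val x - φ.val y)
    have hd' := neg_le_abs (φ.val x - φ.val y)
    rw [abs_le]
    generalize |φ.val x - φ.val y| = d at hd hd' ⊢
    simp only [liftPin_val]
    by_cases hx : x ∈ Lam N <;> by_cases hy : y ∈ Lam N <;> by_cases hxA : x ∈ A <;>
      by_cases hyA : y ∈ A <;>
      simp only [hx, hy, hxA, hyA, forall_const, if_true, if_false, true_and, iff_true,
        iff_false, not_true_eq_false, not_false_eq_true] at ax ay ox oy ⊢ <;>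
      omega

theorem Ham_liftSpike_le {N : ℕ} {j : ℤ} (hj : 1 ≤ j) {φ : Conf N} {A : Finset (ℤ × ℤ)}
    (hA : A ⊆ levelSet N φ.val j) :
    Ham N (liftSpike φ A).val ≤
      Ham N φ.val + 4 * (j * #A + #(levelSet N φ.val 0)) + 4 * N := by
  have hAL := hA.trans (levelSet_subset _ _ _)
  have hj0 : 0 ≤ j := by omega
  have := Ham_le_of_edge_le (N := N) (φ := φ.val) (ψ := (liftSpike φ A).val)
    (g := fun x => (if x ∈ A then j else 0) + if x ∈ levelSet N φ.val 0 then 1 else 0)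
    (fun x => by positivity)
    (fun x hx => by
      rw [if_neg fun h => hx (hAL h), if_neg fun h => hx (levelSet_subset _ _ _ h), add_zero])
    fun x y => ?_
  · rw [Finset.sum_add_distrib, sum_Lam_indicator hAL,
      sum_Lam_indicator (levelSet_subset _ _ _), one_mul] at this
    exact_mod_cast this
  · have ax := fun h => (mem_levelSet.1 (@hA x h))
    have ay := fun h => (mem_levelSet.1 (@hA y h))
    have px := φ.2.1 x
    have py := φ.2.1 y
    have ox := φ.2.2 x
    have oy := φ.2.2 y
    have hd := le_abs_self (φ.val x - φ.val y)
    have hd' := neg_le_abs (φ.val x - φ.val y)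
    rw [abs_le]
    generalize |φ.val x - φ.val y| = d at hd hd' ⊢
    simp only [liftSpike_val, mem_levelSet]
    by_cases hx : x ∈ Lam N <;> by_cases hy : y ∈ Lam N <;> by_cases hxA : x ∈ A <;>
      by_cases hyA : y ∈ A <;> by_cases hx0 : φ.val x = 0 <;> by_cases hy0 : φ.val y = 0 <;>
      simp only [hx, hy, hxA, hyA, hx0, hy0, forall_const, if_true, if_false, true_and, iff_true,
        iff_false, not_true_eq_false, not_false_eq_true, false_and, and_false, and_true,
        and_self] at ax ay ox oy ⊢ <;>
      omega

theorem levelSet_liftPin {N : ℕ} {φ : Conf N} {A : Finset (ℤ × ℤ)}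
    (hA : A ⊆ levelSet N φ.val 0) : levelSet N (liftPin φ A).val 0 = A := by
  ext x
  have := φ.2.1 x
  have ax := fun h => (mem_levelSet.1 (@hA x h)).1
  rw [mem_levelSet, liftPin_val]
  by_cases hx : x ∈ Lam N <;> by_cases hxA : x ∈ A <;> simp_all
  omega

theorem levelSet_liftSpike {N : ℕ} (φ : Conf N) (A : Finset (ℤ × ℤ)) :
    levelSet N (liftSpike φ A).val 0 = levelSet N φ.val 0 := by
  ext x
  have := φ.2.1 x
  rw [mem_levelSet, mem_levelSet, liftSpike_val]
  refine and_congr_right fun hx => ?_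
  rw [if_pos hx]
  split_ifs <;> omega

theorem weight_nonneg (N : ℕ) (β h : ℝ) (φ : ℤ × ℤ → ℤ) : 0 ≤ weight N β h φ :=
  (Real.exp_pos _).le

/-- The configurations with at most `z` zeros and more than `t` sites at height `j`. -/
def fewZerosLargeLevel (N : ℕ) (z t : ℝ) (j : ℤ) : Set (Conf N) :=
  {φ | #(levelSet N φ.val 0) ≤ z ∧ t < #(levelSet N φ.val j)}

theorem tsum_many_zeros_le {N : ℕ} {β h κ δ : ℝ} (hβ : 0 ≤ β)
    (hs : Summable fun φ : Conf N => weight N β h φ.val)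
    (hq : 1 ≤ Real.exp (-h) + Real.exp (-4 * β))
    (hκ : κ * Real.log (Real.exp (-h) + Real.exp (-4 * β)) = 4 * β + δ) :
    (∑' φ : Conf N, if φ ∈ {φ : Conf N | κ * N < #(levelSet N φ.val 0)} then
      weight N β h φ.val else 0) ≤ Real.exp (-δ * N) * Z N β h := by
  refine tsum_indicator_le_of_injective_family hs (fun φ => weight_nonneg _ _ _ _) _
    (fun φ => levelSet N φ.val 0) liftPin
    (fun φ _ A hA φ' _ A' hA' => liftPin_injective hA hA') (Real.exp (-4 * β * N))
    (Real.exp (-4 * β)) (Real.exp (-h)) _ (Real.exp_pos _).le ?_ ?_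
  · intro φ _ A hA
    rw [weight, weight, levelSet_liftPin hA, ← Real.exp_nat_mul, ← Real.exp_nat_mul,
      ← Real.exp_add, ← Real.exp_add, ← Real.exp_add, Real.exp_le_exp,
      Nat.cast_sub (Finset.card_le_card hA)]
    have := mul_le_mul_of_nonneg_left (Ham_liftPin_le hA) hβ
    linarith
  · intro φ hφ
    have hφ : κ * N < #(levelSet N φ.val 0) := hφ
    have hlog := Real.log_nonneg hq
    rw [add_comm, ← Real.exp_log (zero_lt_one.trans_le hq), ← Real.exp_nat_mul, ← Real.exp_add,
      ← Real.exp_add, Real.one_le_exp_iff]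
    have := mul_le_mul_of_nonneg_right hφ.le hlog
    have e : κ * N * Real.log (Real.exp (-h) + Real.exp (-4 * β)) = (4 * β + δ) * N := by
      rw [← hκ]; ring
    linarith

theorem tsum_large_level_le {N : ℕ} {β h κ t : ℝ} {j : ℤ} (hβ : 0 ≤ β) (hj : 1 ≤ j)
    (hs : Summable fun φ : Conf N => weight N β h φ.val) :
    (∑' φ : Conf N, if φ ∈ fewZerosLargeLevel N (κ * N) t j then
      weight N β h φ.val else 0) ≤
      Real.exp (4 * β * (1 + κ) * N - t * (Real.exp (-4 * β * j) / 2)) * Z N β h := by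
  have hj0 : (0 : ℝ) ≤ j := by exact_mod_cast (by omega : 0 ≤ j)
  refine tsum_indicator_le_of_injective_family hs (fun φ => weight_nonneg _ _ _ _) _
    (fun φ => levelSet N φ.val j) liftSpike
    (fun φ _ A hA φ' _ A' hA' => liftSpike_injective hj hA hA')
    (Real.exp (-4 * β * (1 + κ) * N)) (Real.exp (-4 * β * j)) 1 _ (Real.exp_pos _).le ?_ ?_
  · rintro φ ⟨hz, -⟩ A hA
    rw [weight, weight, levelSet_liftSpike, one_pow, mul_one, ← Real.exp_nat_mul,
      ← Real.exp_add, ← Real.exp_add, Real.exp_le_exp]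
    have := mul_le_mul_of_nonneg_left (Ham_liftSpike_le hj hA) hβ
    have := mul_le_mul_of_nonneg_left hz hβ
    linarith
  · rintro φ ⟨-, ht⟩
    have ha : Real.exp (-4 * β * j) ≤ 1 := Real.exp_le_one_iff.2 (by nlinarith)
    have hpow := pow_le_pow_left₀ (Real.exp_pos _).le
      (exp_half_le_one_add (Real.exp_pos _).le ha) #(levelSet N φ.val j)
    rw [← Real.exp_nat_mul, add_comm] at hpow
    refine le_trans ?_ (mul_le_mul_of_nonneg_left
      (mul_le_mul_of_nonneg_left hpow (Real.exp_pos _).le) (Real.exp_pos _).le)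
    rw [← Real.exp_add, ← Real.exp_add, Real.one_le_exp_iff]
    have := mul_le_mul_of_nonneg_right ht.le (half_pos (Real.exp_pos (-4 * β * j))).le
    linarith

theorem card_low_sites_le {N H m : ℕ} {φ : Conf N} {t : ℕ → ℝ}
    (h : ∀ i ∈ Finset.Ico m (H + 1), #(levelSet N φ.val ((H : ℤ) - i)) ≤ t i) :
    (#((Lam N).filter fun x => φ.val x ≤ (H : ℤ) - m) : ℝ) ≤
      ∑ i ∈ Finset.Ico m (H + 1), t i := by
  have hsub : ((Lam N).filter fun x => φ.val x ≤ (H : ℤ) - m) ⊆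
      (Finset.Ico m (H + 1)).biUnion fun i => levelSet N φ.val ((H : ℤ) - i) := by
    intro x hx
    obtain ⟨hx, hle⟩ := Finset.mem_filter.1 hx
    have := φ.2.1 x
    refine Finset.mem_biUnion.2 ⟨((H : ℤ) - φ.val x).toNat, ?_, mem_levelSet.2 ⟨hx, ?_⟩⟩
    · rw [Finset.mem_Ico]; omega
    · omega
  calc (#((Lam N).filter fun x => φ.val x ≤ (H : ℤ) - m) : ℝ)
      ≤ ∑ i ∈ Finset.Ico m (H + 1), (#(levelSet N φ.val ((H : ℤ) - i)) : ℝ) := by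
        exact_mod_cast (Finset.card_le_card hsub).trans Finset.card_biUnion_le
    _ ≤ _ := Finset.sum_le_sum h

theorem tsum_indicator_le_of_subset_union {Ω ι : Type*} {w : Ω → ℝ} (hs : Summable w)
    (hw : ∀ φ, 0 ≤ w φ) {E B : Set Ω} {G : ι → Set Ω} (s : Finset ι)
    (hsub : ∀ φ ∈ E, φ ∈ B ∨ ∃ i ∈ s, φ ∈ G i) :
    (∑' φ, if φ ∈ E then w φ else 0) ≤
      (∑' φ, if φ ∈ B then w φ else 0) + ∑ i ∈ s, ∑' φ, if φ ∈ G i then w φ else 0 := by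
  have hind : ∀ S : Set Ω, Summable fun φ => if φ ∈ S then w φ else 0 := fun S =>
    hs.of_nonneg_of_le (fun φ => by split_ifs <;> simp [hw])
      fun φ => by split_ifs <;> simp [hw]
  have h0 : ∀ (S : Set Ω) φ, 0 ≤ if φ ∈ S then w φ else 0 := fun S φ => by
    split_ifs <;> simp [hw]
  rw [← Summable.tsum_finsetSum fun i _ => hind (G i),
    ← (hind B).tsum_add (summable_sum fun i _ => hind (G i))]
  refine (hind E).tsum_le_tsum (fun φ => ?_) ((hind B).add (summable_sum fun i _ => hind (G i)))
  have hsum := Finset.sum_nonneg (s := s) fun i _ => h0 (G i) φ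
  by_cases hE : φ ∈ E
  · rw [if_pos hE]
    rcases hsub φ hE with hB | ⟨i, hi, hG⟩
    · rw [if_pos hB]; linarith
    · have := Finset.single_le_sum (f := fun i => if φ ∈ G i then w φ else 0)
        (fun i _ => h0 (G i) φ) hi
      simp only [if_pos hG] at this
      linarith [h0 B φ]
  · rw [if_neg hE]
    exact add_nonneg (h0 B φ) hsum

theorem prob_le_of_tsum_le {N : ℕ} {β h C : ℝ} {E : Set (Conf N)} (hC : 0 ≤ C)
    (hle : Summable (fun φ : Conf N => weight N β h φ.val) →
      (∑' φ : Conf N, if φ ∈ E then weight N β h φ.val else 0) ≤ C * Z N β h) :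
    prob N β h E ≤ C := by
  have hZ : 0 ≤ Z N β h := tsum_nonneg fun φ => weight_nonneg _ _ _ _
  by_cases hs : Summable fun φ : Conf N => weight N β h φ.val
  · exact div_le_of_le_mul₀ hZ hC (hle hs)
  · rw [prob, Z, tsum_eq_zero_of_not_summable hs, div_zero]
    exact hC

theorem one_lt_exp_neg_add_of_lt_hw {β h : ℝ} (hβ : 0 < β) (hh : h < hw β) :
    1 < Real.exp (-h) + Real.exp (-4 * β) := by
  have h1 : 1 < Real.exp (4 * β) := Real.one_lt_exp_iff.2 (by linarith)
  have h2 : 0 < Real.exp (4 * β) - 1 := by linarith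
  have h3 : Real.exp h < Real.exp (4 * β) / (Real.exp (4 * β) - 1) := by
    rw [← Real.lt_log_iff_exp_lt (by positivity)]
    exact hh
  rw [lt_div_iff₀ h2] at h3
  have e1 : Real.exp h * Real.exp (-h) = 1 := by rw [← Real.exp_add]; simp
  have e2 : Real.exp (4 * β) * Real.exp (-4 * β) = 1 := by rw [← Real.exp_add]; simp
  have p : 0 < Real.exp (-h) * Real.exp (-4 * β) := by positivity
  linear_combination mul_lt_mul_of_pos_right h3 p +
    (Real.exp (-4 * β) - Real.exp (4 * β) * Real.exp (-4 * β)) * e1 +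
    (Real.exp (-h) - 1) * e2

theorem two_le_exp_two_mul {β : ℝ} (hβ : 1 ≤ β) : 2 ≤ Real.exp (2 * β) := by
  linarith [Real.add_one_le_exp (2 * β)]

theorem two_mul_exp_neg_succ_le {β : ℝ} (hβ : 1 ≤ β) (i : ℕ) :
    2 * Real.exp (-2 * β * (i + 1 : ℕ)) ≤ Real.exp (-2 * β * i) := by
  have e : Real.exp (-2 * β * i) = Real.exp (2 * β) * Real.exp (-2 * β * (i + 1 : ℕ)) := by
    rw [← Real.exp_add]; push_cast; ring_nf
  rw [e]
  exact mul_le_mul_of_nonneg_right (two_le_exp_two_mul hβ) (Real.exp_pos _).le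

theorem two_mul_exp_neg_exp_succ_le {β : ℝ} (hβ : 1 ≤ β) {N : ℕ} (hN : 1 ≤ N) (i : ℕ) (C : ℝ) :
    2 * Real.exp (C - (1 / 2) * Real.exp (2 * β * (i + 1 : ℕ)) * N) ≤
      Real.exp (C - (1 / 2) * Real.exp (2 * β * i) * N) := by
  have e : Real.exp (2 * β * (i + 1 : ℕ)) = Real.exp (2 * β) * Real.exp (2 * β * i) := by
    rw [← Real.exp_add]; push_cast; ring_nf
  have h1 : 1 ≤ Real.exp (2 * β * i) := Real.one_le_exp (by positivity)
  have h2 : 3 ≤ Real.exp (2 * β) := by linarith [Real.add_one_le_exp (2 * β)]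
  have hN' : (1 : ℝ) ≤ N := by exact_mod_cast hN
  have h3 : 2 ≤ Real.exp ((1 / 2) * (Real.exp (2 * β * (i + 1 : ℕ)) -
      Real.exp (2 * β * i)) * N) := by
    have : 1 ≤ (1 / 2) * (Real.exp (2 * β * (i + 1 : ℕ)) - Real.exp (2 * β * i)) * N := by
      rw [e]
      have : 1 ≤ (1 / 2) * (Real.exp (2 * β) * Real.exp (2 * β * i) -
        Real.exp (2 * β * i)) := by nlinarith
      nlinarith
    linarith [Real.add_one_le_exp ((1 / 2) * (Real.exp (2 * β * (i + 1 : ℕ)) -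
      Real.exp (2 * β * i)) * N)]
  calc _ ≤ Real.exp ((1 / 2) * (Real.exp (2 * β * (i + 1 : ℕ)) - Real.exp (2 * β * i)) * N) *
        Real.exp (C - (1 / 2) * Real.exp (2 * β * (i + 1 : ℕ)) * N) :=
        mul_le_mul_of_nonneg_right h3 (Real.exp_pos _).le
    _ = _ := by rw [← Real.exp_add]; ring_nf

/-- Theorem 1.2-(ii): downward fluctuations in the subcritical regime `0 < h < h_w(β)`. -/
theorem downward_fluctuations_subcritical (β h δ : ℝ) (m N : ℕ)
    (hβ : 1 ≤ β) (hh0 : 0 < h) (hhw : h < hw β) (hδ : 0 < δ) (hm : 1 ≤ m) (hN : 1 ≤ N) :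
    prob N β h
        {φ : Conf N |
          (((Lam N).filter fun x =>
              φ.val x ≤ ⌊Real.log (N:ℝ) / (4*β)⌋ - (m:ℤ)).card : ℝ) >
            2 * Real.exp (-2*β*(m:ℝ)) * (N:ℝ)^2} ≤
      3 * Real.exp (-(min
          ((1/2) * Real.exp (2*β*(m:ℝ)) -
            4*β*(1 + (4*β + δ) / Real.log (Real.exp (-h) + Real.exp (-4*β)))) δ) * (N:ℝ)) := by
  have hβ0 : 0 < β := by linarith
  have hN1 : (1 : ℝ) ≤ N := by exact_mod_cast hN
  have hN0 : (0 : ℝ) < N := by linarith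
  have hq := one_lt_exp_neg_add_of_lt_hw hβ0 hhw
  have hlog := Real.log_pos hq
  set κ := (4 * β + δ) / Real.log (Real.exp (-h) + Real.exp (-4 * β)) with hκdef
  have hκ : κ * Real.log (Real.exp (-h) + Real.exp (-4 * β)) = 4 * β + δ :=
    div_mul_cancel₀ _ hlog.ne'
  have hκ0 : 0 < κ := by positivity
  set M := min ((1 / 2) * Real.exp (2 * β * (m : ℝ)) - 4 * β * (1 + κ)) δ with hM
  obtain ⟨H, hH⟩ : ∃ H : ℕ, ⌊Real.log (N : ℝ) / (4 * β)⌋ = (H : ℤ) :=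
    Int.eq_ofNat_of_zero_le (Int.floor_nonneg.2 (div_nonneg (Real.log_nonneg hN1) (by linarith)))
  rw [hH]
  have hHN : Real.exp (4 * β * H) ≤ N := by
    rw [← Real.le_log_iff_exp_le hN0, mul_comm, ← le_div_iff₀ (by linarith)]
    have := Int.floor_le (Real.log (N : ℝ) / (4 * β))
    rwa [hH, Int.cast_natCast] at this
  refine prob_le_of_tsum_le (by positivity) fun hs => ?_
  have hZ : 0 ≤ Z N β h := tsum_nonneg fun φ => weight_nonneg _ _ _ _
  have hw0 : ∀ φ : Conf N, 0 ≤ weight N β h φ.val := fun φ => weight_nonneg _ _ _ _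
  rcases le_or_gt M 0 with hM0 | hM0
  · have h1 : 1 ≤ Real.exp (-M * N) := Real.one_le_exp (by nlinarith)
    calc _ ≤ Z N β h := by
          refine (hs.of_nonneg_of_le (fun φ => ?_) fun φ => ?_).tsum_le_tsum (fun φ => ?_) hs <;>
            split_ifs <;> simp [hw0]
      _ ≤ _ := le_mul_of_one_le_left hZ (by linarith)
  set t : ℕ → ℝ := fun i => Real.exp (-2 * β * i) * (N : ℝ) ^ 2 with ht
  refine (tsum_indicator_le_of_subset_union hs hw0
    (B := {φ : Conf N | κ * N < #(levelSet N φ.val 0)})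
    (G := fun i : ℕ => fewZerosLargeLevel N (κ * N) (t i) ((H : ℤ) - i)) (Finset.Ico m H) fun φ hφ => ?_).trans ?_
  · by_contra! hcon
    obtain ⟨hB, hG⟩ := hcon
    simp only [fewZerosLargeLevel, Set.mem_ofPred_eq, not_lt, not_and] at hB hG
    refine absurd hφ (not_lt.2 ((card_low_sites_le (t := t) fun i hi => ?_).trans ?_))
    · rw [Finset.mem_Ico] at hi
      rcases (Nat.lt_succ_iff.1 hi.2).lt_or_eq with h' | rfl
      · exact hG i (Finset.mem_Ico.2 ⟨hi.1, h'⟩) hB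
      · rw [sub_self]
        refine hB.trans ?_
        have hκH : κ ≤ Real.exp (2 * β * i) := by
          have h1 := hM0.trans_le (min_le_left _ _)
          have h2 : Real.exp (2 * β * m) ≤ Real.exp (2 * β * i) :=
            Real.exp_le_exp.2 (mul_le_mul_of_nonneg_left (by exact_mod_cast hi.1) (by linarith))
          nlinarith
        have e1 : Real.exp (2 * β * i) = Real.exp (-2 * β * i) * Real.exp (4 * β * i) := by
          rw [← Real.exp_add]; ring_nf
        calc κ * N ≤ Real.exp (-2 * β * i) * Real.exp (4 * β * i) * N := by
              rw [← e1]; exact mul_le_mul_of_nonneg_right hκH hN0.le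
          _ ≤ Real.exp (-2 * β * i) * N * N := by gcongr
          _ = t i := by rw [ht]; ring
    · have := sum_Ico_le_two_mul_of_halving (f := fun i : ℕ => Real.exp (-2 * β * i))
        (fun i => (Real.exp_pos _).le) (two_mul_exp_neg_succ_le hβ) m (H + 1)
      rw [ht, ← Finset.sum_mul]
      gcongr
  · have hB := tsum_many_zeros_le hβ0.le hs hq.le hκ
    have hG : ∀ i ∈ Finset.Ico m H,
        (∑' φ : Conf N, if φ ∈ fewZerosLargeLevel N (κ * N) (t i) ((H : ℤ) - i) then
          weight N β h φ.val else 0) ≤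
        Real.exp (4 * β * (1 + κ) * N - (1 / 2) * Real.exp (2 * β * i) * N) * Z N β h := by
      intro i hi
      rw [Finset.mem_Ico] at hi
      refine (tsum_large_level_le hβ0.le (by omega) hs).trans ?_
      refine mul_le_mul_of_nonneg_right (Real.exp_le_exp.2 (sub_le_sub_left ?_ _)) hZ
      have e2 : Real.exp (2 * β * i) = Real.exp (-2 * β * i) *
          Real.exp (-4 * β * ((H : ℤ) - i : ℤ)) * Real.exp (4 * β * H) := by
        rw [← Real.exp_add, ← Real.exp_add]; push_cast; ring_nf
      have h1 : Real.exp (2 * β * i) ≤ Real.exp (-2 * β * i) *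
          Real.exp (-4 * β * ((H : ℤ) - i : ℤ)) * N := by
        rw [e2]; gcongr
      calc _ ≤ (1 / 2) * (Real.exp (-2 * β * i) *
            Real.exp (-4 * β * ((H : ℤ) - i : ℤ)) * N) * N := by gcongr
        _ = _ := by rw [ht]; ring
    have hsum := sum_Ico_le_two_mul_of_halving
      (f := fun i : ℕ => Real.exp (4 * β * (1 + κ) * N - (1 / 2) * Real.exp (2 * β * i) * N))
      (fun i => (Real.exp_pos _).le) (fun i => two_mul_exp_neg_exp_succ_le hβ hN i _) m H
    have h1 : Real.exp (-δ * N) ≤ Real.exp (-M * N) := by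
      have := min_le_right ((1 / 2) * Real.exp (2 * β * (m : ℝ)) - 4 * β * (1 + κ)) δ
      gcongr
    have h2 : Real.exp (4 * β * (1 + κ) * N - (1 / 2) * Real.exp (2 * β * m) * N) ≤
        Real.exp (-M * N) := by
      have := mul_le_mul_of_nonneg_right
        (min_le_left ((1 / 2) * Real.exp (2 * β * (m : ℝ)) - 4 * β * (1 + κ)) δ) hN0.le
      rw [← hM] at this
      exact Real.exp_le_exp.2 (by linarith)
    refine (add_le_add hB (Finset.sum_le_sum hG)).trans ?_
    rw [← Finset.sum_mul, ← add_mul]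
    exact mul_le_mul_of_nonneg_right (by linarith) hZ
end
end
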